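/- Pointwise systolic estimate via the nilpotence radius (Corollary 6.2): For all real P0, r0, δ > 0 there exist constants ε0 > 0, depending only on P0 and r0, and H0 > 0, depending only on P0, r0 and δ, such that for every δ-hyperbolic GCB-space (X,σ) which is P0-packed at scale r0, every non-elementary, discrete group Γ of σ-isometries of X, and every x ∈ X with nilrad(Γ,x) < +∞, the minimal free displacement satisfies sys⁰(Γ,x) ≥ min{ ε0, (1/H0)·exp(−H0·nilrad(Γ,x)) }. -/

import Mathlib

open Metric Filter

/-- Four-points condition for `δ`-hyperbolicity. -/
def IsDeltaHyperbolic (X : Type*) [MetricSpace X] (δ : ℝ) : Prop :=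
  ∀ x y z w : X,
    dist x y + dist z w ≤ max (dist x z + dist y w) (dist x w + dist y z) + 2 * δ

/-- `X` is `P₀`-packed at scale `r₀`: any subset of a closed ball of radius `3r₀` whose
points are pairwise at distance `> 2r₀` has cardinality at most `P₀`. -/
def IsPacked (X : Type*) [MetricSpace X] (P₀ r₀ : ℝ) : Prop :=
  ∀ x : X, ∀ S : Finset X, (↑S ⊆ closedBall x (3 * r₀)) →
    (∀ a ∈ S, ∀ b ∈ S, a ≠ b → 2 * r₀ < dist a b) → (S.card : ℝ) ≤ P₀

/-- A geodesically complete, convex, consistent, reversible geodesic bicombing on `X`.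
Together with completeness of `X` this is the notion of GCB-space. -/
structure IsGCB {X : Type*} [MetricSpace X] (σ : X → X → ℝ → X) : Prop where
  source : ∀ x y : X, σ x y 0 = x
  target : ∀ x y : X, σ x y 1 = y
  geodesic : ∀ x y : X, ∀ t ∈ Set.Icc (0:ℝ) 1, ∀ t' ∈ Set.Icc (0:ℝ) 1,
    dist (σ x y t) (σ x y t') = |t - t'| * dist x y
  convex : ∀ x y x' y' : X,
    ConvexOn ℝ (Set.Icc (0:ℝ) 1) fun t => dist (σ x y t) (σ x' y' t)
  consistent : ∀ x y : X, ∀ s t l : ℝ, 0 ≤ s → s ≤ t → t ≤ 1 → l ∈ Set.Icc (0:ℝ) 1 →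
    σ (σ x y s) (σ x y t) l = σ x y ((1 - l) * s + l * t)
  reversible : ∀ x y : X, ∀ t ∈ Set.Icc (0:ℝ) 1, σ x y t = σ y x (1 - t)
  geodComplete : ∀ x y : X, ∃ γ : ℝ → X, Isometry γ ∧
    (∀ s t : ℝ, s ≤ t → ∀ l ∈ Set.Icc (0:ℝ) 1, σ (γ s) (γ t) l = γ (s + l * (t - s))) ∧
    (∀ t ∈ Set.Icc (0:ℝ) 1, σ x y t = γ (t * dist x y))

/-- `g` is a `σ`-isometry: a surjective isometry preserving the bicombing `σ`. -/
def IsSigmaIsometry {X : Type*} [MetricSpace X] (σ : X → X → ℝ → X) (g : X ≃ᵢ X) : Prop :=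
  ∀ x y : X, ∀ t ∈ Set.Icc (0:ℝ) 1, g (σ x y t) = σ (g x) (g y) t

/-- A group of isometries is discrete if for every `x` and `R` only finitely many of its
elements displace `x` at most `R`. -/
def IsDiscreteSubgroup {X : Type*} [MetricSpace X] (Γ : Subgroup (X ≃ᵢ X)) : Prop :=
  ∀ x : X, ∀ R : ℝ, {g : X ≃ᵢ X | g ∈ Γ ∧ dist x (g x) ≤ R}.Finite

/-- A group is virtually nilpotent if it has a nilpotent subgroup of finite index. -/
def IsVirtuallyNilpotent (G : Type*) [Group G] : Prop :=
  ∃ H : Subgroup G, H.FiniteIndex ∧ Group.IsNilpotent H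

/-- `Γ` is non-elementary: it contains two elements generating a subgroup that is not
virtually nilpotent. -/
def IsNonElementary {X : Type*} [MetricSpace X] (Γ : Subgroup (X ≃ᵢ X)) : Prop :=
  ∃ a b : X ≃ᵢ X, a ∈ Γ ∧ b ∈ Γ ∧
    ¬ IsVirtuallyNilpotent ↥(Subgroup.closure ({a, b} : Set (X ≃ᵢ X)))

/-- An isometry is non-elliptic if its orbits are unbounded. -/
def IsNonElliptic {X : Type*} [MetricSpace X] (g : X ≃ᵢ X) : Prop :=
  ∀ x : X, ¬ Bornology.IsBounded (Set.range fun n : ℤ => (g ^ n) x)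

/-- The `r`-almost stabilizer `Γ_r(x)`, generated by the elements of `Γ` displacing `x`
at most `r`. -/
def almostStabilizer {X : Type*} [MetricSpace X] (Γ : Subgroup (X ≃ᵢ X)) (r : ℝ) (x : X) :
    Subgroup (X ≃ᵢ X) :=
  Subgroup.closure {g : X ≃ᵢ X | g ∈ Γ ∧ dist x (g x) ≤ r}

/-- The nilpotence radius of `Γ` at `x`. -/
noncomputable def nilrad {X : Type*} [MetricSpace X] (Γ : Subgroup (X ≃ᵢ X)) (x : X) : ℝ :=
  sSup {r : ℝ | 0 ≤ r ∧ IsVirtuallyNilpotent ↥(almostStabilizer Γ r x)}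

/-- The Margulis domain `M_ε(g)`. -/
def margulisDomain {X : Type*} [MetricSpace X] (g : X ≃ᵢ X) (ε : ℝ) : Set X :=
  {x : X | dist x (g x) ≤ ε}

/-- The generalized Margulis domain `ℳ_ε(g) = ⋃_{i ≠ 0} M_ε(gⁱ)`. -/
def genMargulisDomain {X : Type*} [MetricSpace X] (g : X ≃ᵢ X) (ε : ℝ) : Set X :=
  ⋃ i ∈ {i : ℤ | i ≠ 0}, margulisDomain (g ^ i) ε

/-- `f` parameterizes a geodesic segment from `x` to `y` on `[0, dist x y]`. -/
def IsGeodesicFrom {X : Type*} [MetricSpace X] (f : ℝ → X) (x y : X) : Prop :=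
  f 0 = x ∧ f (dist x y) = y ∧
    ∀ s ∈ Set.Icc 0 (dist x y), ∀ t ∈ Set.Icc 0 (dist x y), dist (f s) (f t) = |s - t|

/-- `X` is a geodesic space. -/
def IsGeodesicSpace (X : Type*) [MetricSpace X] : Prop :=
  ∀ x y : X, ∃ f : ℝ → X, IsGeodesicFrom f x y

/-- `C` is `lam`-quasiconvex: any two of its points are joined by a geodesic contained in
the closed `lam`-neighbourhood of `C`. -/
def IsQuasiconvex {X : Type*} [MetricSpace X] (lam : ℝ) (C : Set X) : Prop :=
  ∀ x ∈ C, ∀ y ∈ C, ∃ f : ℝ → X, IsGeodesicFrom f x y ∧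
    ∀ t ∈ Set.Icc 0 (dist x y), infDist (f t) C ≤ lam

/-- `C` is a convex subset: any two of its points are joined by a geodesic inside `C`. -/
def IsConvexSubset {X : Type*} [MetricSpace X] (C : Set X) : Prop :=
  ∀ x ∈ C, ∀ y ∈ C, ∃ f : ℝ → X, IsGeodesicFrom f x y ∧
    ∀ t ∈ Set.Icc 0 (dist x y), f t ∈ C

/-- Arc-length concatenation of three paths, of respective lengths `d₁`, `d₂` and the rest. -/
noncomputable def concatPath {X : Type*} (d₁ d₂ : ℝ) (f₁ f₂ f₃ : ℝ → X) : ℝ → X :=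
  fun t => if t ≤ d₁ then f₁ t else if t ≤ d₁ + d₂ then f₂ (t - d₁) else f₃ (t - d₁ - d₂)

section Growth
open scoped Pointwise

/-- Every finite subset of `G` has growth bounded by a polynomial of degree `d`. -/
def GrowthLE (G : Type*) [Group G] (d : ℕ) : Prop :=
  ∀ S : Set G, S.Finite → ∃ C : ℕ, ∀ n : ℕ, 1 ≤ n → ∀ T : Finset G, (T : Set G) ⊆ S ^ n →
    T.card ≤ C * n ^ d

theorem card_le_of_injOn_mem {G ι : Type*} {A : Set G} {N : ℕ}
    (h : ∀ T : Finset G, (T : Set G) ⊆ A → T.card ≤ N) (I : Finset ι) (f : ι → G)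
    (hf : Set.InjOn f I) (hA : ∀ i ∈ I, f i ∈ A) : I.card ≤ N := by
  classical
  rw [← Finset.card_image_of_injOn hf]
  apply h
  intro x hx
  simp only [Finset.coe_image, Set.mem_image, Finset.mem_coe] at hx
  obtain ⟨i, hi, rfl⟩ := hx
  exact hA i hi

theorem GrowthLE.of_injective {G H : Type*} [Group G] [Group H] {d : ℕ} (hG : GrowthLE G d)
    (f : H →* G) (hf : Function.Injective f) : GrowthLE H d := by
  intro S hS
  obtain ⟨C, hC⟩ := hG (f '' S) (hS.image f)
  refine ⟨C, fun n hn T hT => ?_⟩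
  refine card_le_of_injOn_mem (hC n hn) T f hf.injOn fun i hi => ?_
  rw [← Set.image_pow]
  exact ⟨i, hT hi, rfl⟩

theorem GrowthLE.subgroup {G : Type*} [Group G] {d : ℕ} (hG : GrowthLE G d)
    (H : Subgroup G) : GrowthLE H d :=
  hG.of_injective H.subtype H.subtype_injective

theorem exists_lift_set {G H : Type*} [Group G] [Group H] (f : G →* H)
    (hf : Function.Surjective f) (S : Set H) (hS : S.Finite) :
    ∃ S' : Set G, S'.Finite ∧ f '' S' = S := by
  refine ⟨Function.surjInv hf '' S, hS.image _, ?_⟩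
  rw [← Set.image_comp]
  convert Set.image_id S
  simp only [Function.comp_apply, id]
  exact Function.surjInv_eq hf _

theorem GrowthLE.of_surjective {G H : Type*} [Group G] [Group H] {d : ℕ} (hG : GrowthLE G d)
    (f : G →* H) (hf : Function.Surjective f) : GrowthLE H d := by
  intro S hS
  obtain ⟨S', hS', rfl⟩ := exists_lift_set f hf S hS
  obtain ⟨C, hC⟩ := hG S' hS'
  refine ⟨C, fun n hn T hT => ?_⟩
  have hT' : ∀ x : H, ∃ y : G, x ∈ T → y ∈ S' ^ n ∧ f y = x := by
    intro x
    by_cases hx : x ∈ T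
    · have := hT hx
      rw [← Set.image_pow] at this
      obtain ⟨y, hy, rfl⟩ := this
      exact ⟨y, fun _ => ⟨hy, rfl⟩⟩
    · exact ⟨1, fun h => absurd h hx⟩
  choose l hl using hT'
  refine card_le_of_injOn_mem (hC n hn) T l ?_ fun i hi => (hl i hi).1
  intro a ha b hb hab
  rw [← (hl a ha).2, ← (hl b hb).2, hab]

theorem pow_mem_pow_of_le {G : Type*} [Group G] {S : Set G} (h1 : (1 : G) ∈ S) {m n : ℕ}
    (h : m ≤ n) {x : G} (hx : x ∈ S ^ m) : x ∈ S ^ n :=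
  Set.pow_subset_pow_right h1 h hx

theorem pow_mem_set_pow {G : Type*} [Group G] {S : Set G} {x : G} (hx : x ∈ S) (n : ℕ) :
    x ^ n ∈ S ^ n :=
  Set.pow_mem_pow hx

/-- If `a` ranges over a set of growth `T` and can be multiplied by `t ^ j`, the growth exponent
of the first factor is one less. -/
theorem card_mul_le {C d n c : ℕ} (hn : 1 ≤ n)
    (h : c * n ≤ C * (2 * n) ^ (d + 1)) : c ≤ (C * 2 ^ (d + 1)) * n ^ d := by
  have : c * n ≤ (C * 2 ^ (d + 1) * n ^ d) * n := by
    calc c * n ≤ C * (2 * n) ^ (d + 1) := h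
      _ = _ := by ring
  exact Nat.le_of_mul_le_mul_right this hn

theorem GrowthLE.quotient_step {G Q : Type*} [Group G] [Group Q] {d : ℕ}
    (hG : GrowthLE G (d + 1)) (q : G →* Q) (hq : Function.Surjective q) (z : G)
    (hz : ¬ IsOfFinOrder z) (hqz : q z = 1) : GrowthLE Q d := by
  intro S hS
  obtain ⟨S', hS', rfl⟩ := exists_lift_set q hq S hS
  set U : Set G := S' ∪ {1, z} with hU
  have hUf : U.Finite := hS'.union (by simp)
  have h1U : (1 : G) ∈ U := by simp [hU]
  have hzU : z ∈ U := by simp [hU]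
  obtain ⟨C, hC⟩ := hG U hUf
  refine ⟨C * 2 ^ (d + 1), fun n hn T hT => card_mul_le hn ?_⟩
  have hT' : ∀ x : Q, ∃ y : G, x ∈ T → y ∈ S' ^ n ∧ q y = x := by
    intro x
    by_cases hx : x ∈ T
    · have := hT hx
      rw [← Set.image_pow] at this
      obtain ⟨y, hy, rfl⟩ := this
      exact ⟨y, fun _ => ⟨hy, rfl⟩⟩
    · exact ⟨1, fun h => absurd h hx⟩
  choose l hl using hT'
  have := card_le_of_injOn_mem (hC (2 * n) (by omega)) (T ×ˢ Finset.range n)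
    (fun p => l p.1 * z ^ p.2) ?_ ?_
  · simpa using this
  · rintro ⟨a, i⟩ ha ⟨b, j⟩ hb hab
    simp only [Finset.coe_product, Set.mem_prod, Finset.mem_coe, Finset.mem_range] at ha hb hab
    have hab' : a = b := by
      have := congrArg q hab
      simpa [hqz, (hl a ha.1).2, (hl b hb.1).2] using this
    subst hab'
    have : z ^ i = z ^ j := mul_left_cancel hab
    have : i = j := (injective_pow_iff_not_isOfFinOrder.2 hz) this
    rw [this]
  · rintro ⟨a, i⟩ ha
    simp only [Finset.mem_product, Finset.mem_range] at ha
    rw [two_mul, pow_add]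
    refine Set.mul_mem_mul (Set.pow_subset_pow_left Set.subset_union_left (hl a ha.1).1) ?_
    exact pow_mem_pow_of_le h1U ha.2.le (pow_mem_set_pow hzU i)

theorem GrowthLE.kernel_step {G K A : Type*} [Group G] [Group K] [Group A] {d : ℕ}
    (hG : GrowthLE G (d + 1)) (i : K →* G) (hi : Function.Injective i) (φ : G →* A)
    (hφ : ∀ k, φ (i k) = 1) (t : G) (ht : ¬ IsOfFinOrder (φ t)) : GrowthLE K d := by
  intro S hS
  set U : Set G := i '' S ∪ {1, t} with hU
  have hUf : U.Finite := (hS.image _).union (by simp)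
  have h1U : (1 : G) ∈ U := by simp [hU]
  have hzU : t ∈ U := by simp [hU]
  obtain ⟨C, hC⟩ := hG U hUf
  refine ⟨C * 2 ^ (d + 1), fun n hn T hT => card_mul_le hn ?_⟩
  have := card_le_of_injOn_mem (hC (2 * n) (by omega)) (T ×ˢ Finset.range n)
    (fun p => i p.1 * t ^ p.2) ?_ ?_
  · simpa using this
  · rintro ⟨a, k⟩ ha ⟨b, j⟩ hb hab
    simp only at hab
    have h2 : k = j := by
      have := congrArg φ hab
      simp only [map_mul, hφ, map_pow, one_mul] at this
      exact (injective_pow_iff_not_isOfFinOrder.2 ht) this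
    subst h2
    have := hi (mul_right_cancel hab)
    rw [this]
  · rintro ⟨a, k⟩ ha
    simp only [Finset.mem_product, Finset.mem_range] at ha
    rw [two_mul, pow_add]
    refine Set.mul_mem_mul (Set.pow_subset_pow_left (s := i '' S) Set.subset_union_left ?_) ?_
    · rw [← Set.image_pow]
      exact ⟨a, hT ha.1, rfl⟩
    exact pow_mem_pow_of_le h1U ha.2.le (pow_mem_set_pow hzU k)

/-- A finite symmetric generating set containing the identity. -/
structure IsSymGen {G : Type*} [Group G] (S : Set G) : Prop where
  finite : S.Finite
  one_mem : (1 : G) ∈ S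
  inv_mem : ∀ s ∈ S, s⁻¹ ∈ S
  closure_eq : Subgroup.closure S = ⊤

theorem exists_isSymGen (G : Type*) [Group G] [Group.FG G] : ∃ S : Set G, IsSymGen S := by
  obtain ⟨S, hS, hf⟩ := Group.fg_iff.1 (inferInstance : Group.FG G)
  refine ⟨S ∪ S⁻¹ ∪ {1}, ⟨(hf.union hf.inv).union (Set.finite_singleton 1), by simp, ?_, ?_⟩⟩
  · intro s hs
    simp only [Set.mem_union, Set.mem_inv, Set.mem_singleton_iff, inv_inv, inv_eq_one] at hs ⊢
    tauto
  · rw [eq_top_iff, ← hS]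
    exact Subgroup.closure_mono (fun x hx => Or.inl (Or.inl hx))

theorem IsSymGen.inv_pow_mem {G : Type*} [Group G] {S : Set G} (hS : IsSymGen S) (n : ℕ) :
    ∀ g ∈ S ^ n, g⁻¹ ∈ S ^ n := by
  induction n with
  | zero => simp
  | succ n ih =>
    intro g hg
    rw [pow_succ] at hg
    obtain ⟨a, ha, b, hb, rfl⟩ := hg
    rw [mul_inv_rev, pow_succ']
    exact Set.mul_mem_mul (hS.inv_mem b hb) (ih a ha)

theorem IsSymGen.exists_mem_pow {G : Type*} [Group G] {S : Set G} (hS : IsSymGen S) (g : G) :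
    ∃ n : ℕ, g ∈ S ^ n := by
  have hg : g ∈ Subgroup.closure S := by rw [hS.closure_eq]; trivial
  induction hg using Subgroup.closure_induction with
  | mem x hx => exact ⟨1, by simpa using hx⟩
  | one => exact ⟨0, by simp⟩
  | mul x y _ _ hx hy =>
    obtain ⟨m, hm⟩ := hx
    obtain ⟨n, hn⟩ := hy
    exact ⟨m + n, by rw [pow_add]; exact Set.mul_mem_mul hm hn⟩
  | inv x _ hx =>
    obtain ⟨m, hm⟩ := hx
    exact ⟨m, hS.inv_pow_mem m x hm⟩

theorem GrowthLE.finite_of_zero {G : Type*} [Group G] [Group.FG G] (hG : GrowthLE G 0) :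
    Finite G := by
  obtain ⟨S, hS⟩ := exists_isSymGen G
  obtain ⟨C, hC⟩ := hG S hS.finite
  by_contra hinf
  rw [not_finite_iff_infinite] at hinf
  obtain ⟨T, hT⟩ := Infinite.exists_subset_card_eq G (C + 1)
  choose n hn using hS.exists_mem_pow
  have := hC (T.sup n + 1) (by omega) T (fun x hx =>
    pow_mem_pow_of_le hS.one_mem (Nat.le_succ_of_le (Finset.le_sup (f := n) hx)) (hn x))
  rw [hT] at this
  simp at this

/-- The product `∏_{i<n} (e ^ ε i * t)`. -/
def milnorWord {G : Type*} [Group G] (t e : G) (ε : ℕ → Bool) : ℕ → G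
  | 0 => 1
  | n + 1 => milnorWord t e ε n * ((if ε n then e else 1) * t)

theorem milnorWord_mem {G : Type*} [Group G] (t e : G) (ε : ℕ → Bool) (n : ℕ) :
    milnorWord t e ε n ∈ ({1, e, t} : Set G) ^ (2 * n) := by
  induction n with
  | zero => simp [milnorWord]
  | succ n ih =>
    rw [milnorWord, mul_add, pow_add]
    refine Set.mul_mem_mul ih ?_
    rw [mul_one, pow_two]
    refine Set.mul_mem_mul ?_ (by simp)
    split_ifs <;> simp

theorem exists_pow_lt_two_pow (C d : ℕ) : ∃ n : ℕ, 1 ≤ n ∧ C * n ^ d < 2 ^ n := by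
  have h := tendsto_pow_const_div_const_pow_of_one_lt d (r := (2 : ℝ)) (by norm_num)
  have h2 : Tendsto (fun n : ℕ => (C : ℝ) * ((n : ℝ) ^ d / 2 ^ n)) atTop (nhds (C * 0)) :=
    h.const_mul _
  rw [mul_zero] at h2
  have h3 := (h2.eventually (gt_mem_nhds (zero_lt_one))).and (eventually_ge_atTop 1)
  obtain ⟨n, hn, hn1⟩ := h3.exists
  refine ⟨n, hn1, ?_⟩
  have h4 : (0 : ℝ) < 2 ^ n := by positivity
  rw [← mul_div_assoc, div_lt_one h4] at hn
  exact_mod_cast hn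

theorem GrowthLE.exists_coincidence {G : Type*} [Group G] {d : ℕ} (hG : GrowthLE G d) (t e : G) :
    ∃ (m : ℕ) (ε ε' : ℕ → Bool), milnorWord t e ε m * e = milnorWord t e ε' m := by
  classical
  have key : ∃ n : ℕ, ∃ ε ε' : ℕ → Bool, milnorWord t e ε n = milnorWord t e ε' n ∧
      ∃ i < n, ε i ≠ ε' i := by
    obtain ⟨C, hC⟩ := hG {1, e, t} (by simp)
    obtain ⟨n, hn1, hn⟩ := exists_pow_lt_two_pow (C * 2 ^ d) d
    by_contra hcon
    push Not at hcon
    have := card_le_of_injOn_mem (hC (2 * n) (by omega)) (Finset.univ : Finset (Fin n → Bool))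
      (fun f => milnorWord t e (fun i => if h : i < n then f ⟨i, h⟩ else false) n) ?_
      (fun f _ => milnorWord_mem _ _ _ _)
    · simp only [Finset.card_univ, Fintype.card_fun, Fintype.card_bool, Fintype.card_fin] at this
      have e2 : C * (2 * n) ^ d = C * 2 ^ d * n ^ d := by ring
      omega
    · intro f _ f' _ hff
      ext i
      have := hcon n _ _ hff i i.2
      simpa using this
  obtain ⟨ε, ε', h1, i, hi, hne⟩ := Nat.find_spec key
  set n := Nat.find key with hn
  obtain ⟨m, hm⟩ : ∃ m, n = m + 1 := ⟨n - 1, by omega⟩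
  rw [hm] at h1
  have hd : ε m ≠ ε' m := by
    intro heq
    rw [milnorWord, milnorWord, heq] at h1
    have h2 := mul_right_cancel h1
    refine Nat.find_min key (m := m) (by omega) ⟨ε, ε', h2, i, ?_, hne⟩
    rcases Nat.lt_succ_iff_lt_or_eq.1 (show i < m + 1 by omega) with h | h
    · exact h
    · exact absurd (h ▸ heq) hne
  rw [milnorWord, milnorWord] at h1
  cases h : ε m <;> cases h' : ε' m
  · simp [h, h'] at hd
  · refine ⟨m, ε', ε, ?_⟩
    simp [h, h'] at h1
    rw [← mul_assoc] at h1
    exact (mul_right_cancel h1).symm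
  · refine ⟨m, ε, ε', ?_⟩
    simp [h, h'] at h1
    rw [← mul_assoc] at h1
    exact mul_right_cancel h1
  · simp [h, h'] at hd

theorem milnorWord_mem_closure {G : Type*} [Group G] (t e : G) (ε : ℕ → Bool) (n : ℕ)
    (H : Subgroup G) (hH : ∀ i < n, t ^ i * e * (t ^ i)⁻¹ ∈ H) :
    milnorWord t e ε n * (t ^ n)⁻¹ ∈ H := by
  induction n with
  | zero => simp [milnorWord]
  | succ n ih =>
    have h1 := ih (fun i hi => hH i (by omega))
    have : milnorWord t e ε (n + 1) * (t ^ (n + 1))⁻¹ = (milnorWord t e ε n * (t ^ n)⁻¹) *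
        (t ^ n * (if ε n then e else 1) * (t ^ n)⁻¹) := by
      rw [milnorWord, pow_succ]; group
    rw [this]
    refine H.mul_mem h1 ?_
    split_ifs
    · exact hH n (by omega)
    · simp

theorem GrowthLE.exists_conj_mem {G : Type*} [Group G] {d : ℕ} (hG : GrowthLE G d) (t e : G) :
    ∃ m : ℕ, ∀ H : Subgroup G, (∀ i < m, t ^ i * e * (t ^ i)⁻¹ ∈ H) →
      t ^ m * e * (t ^ m)⁻¹ ∈ H := by
  obtain ⟨m, ε, ε', h⟩ := hG.exists_coincidence t e
  refine ⟨m, fun H hH => ?_⟩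
  have h1 := milnorWord_mem_closure t e ε m H hH
  have h2 := milnorWord_mem_closure t e ε' m H hH
  have : t ^ m * e * (t ^ m)⁻¹ =
      (milnorWord t e ε m * (t ^ m)⁻¹)⁻¹ * (milnorWord t e ε' m * (t ^ m)⁻¹) := by
    rw [← h]; group
  rw [this]
  exact H.mul_mem (H.inv_mem h1) h2

/-- All the positive conjugates lie in a subgroup as soon as enough of them do. -/
theorem GrowthLE.exists_conj_all {G : Type*} [Group G] {d : ℕ} (hG : GrowthLE G d) (t e : G) :
    ∃ m : ℕ, ∀ H : Subgroup G, (∀ i < m, t ^ i * e * (t ^ i)⁻¹ ∈ H) →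
      ∀ i : ℕ, t ^ i * e * (t ^ i)⁻¹ ∈ H := by
  obtain ⟨m, hm⟩ := hG.exists_conj_mem t e
  refine ⟨m, fun H hH i => ?_⟩
  induction i using Nat.strong_induction_on with
  | _ i ih =>
    by_cases hi : i < m
    · exact hH i hi
    · push Not at hi
      obtain ⟨j, rfl⟩ := Nat.exists_eq_add_of_le hi
      have h1 := hm (H.comap (MulAut.conj (t ^ j)).toMonoidHom) (fun i hi => by
        simp only [Subgroup.mem_comap, MulEquiv.coe_toMonoidHom, MulAut.conj_apply]
        have := ih (j + i) (by omega)
        rw [pow_add] at this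
        convert this using 1
        group)
      simp only [Subgroup.mem_comap, MulEquiv.coe_toMonoidHom, MulAut.conj_apply] at h1
      convert h1 using 1
      rw [add_comm, pow_add]; group

theorem GrowthLE.fg_ker {G : Type*} [Group G] [Group.FG G] {d : ℕ} (hG : GrowthLE G d)
    (φ : G →* Multiplicative ℤ) (t : G) (ht : φ t = Multiplicative.ofAdd 1) :
    Group.FG φ.ker := by
  classical
  obtain ⟨S, hS⟩ := exists_isSymGen G
  choose m hm using fun e => hG.exists_conj_all t e
  choose m' hm' using fun e => hG.exists_conj_all t⁻¹ e
  set ex : G → G := fun s => s * (t ^ (Multiplicative.toAdd (φ s)))⁻¹ with hex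
  set E : Set G := ex '' S with hE
  have hEf : E.Finite := hS.finite.image _
  set F : Set G := ⋃ e ∈ E, ((fun i => t ^ i * e * (t ^ i)⁻¹) '' {i : ℕ | i < m e}) ∪
      ((fun i => t⁻¹ ^ i * e * (t⁻¹ ^ i)⁻¹) '' {i : ℕ | i < m' e}) with hF
  have hFf : F.Finite := hEf.biUnion fun e _ =>
    ((Set.finite_lt_nat _).image _).union ((Set.finite_lt_nat _).image _)
  set H := Subgroup.closure F with hH
  have hφt : ∀ k : ℤ, φ (t ^ k) = Multiplicative.ofAdd k := by
    intro k; rw [map_zpow, ht, ← ofAdd_zsmul]; simp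
  have hconj : ∀ e ∈ E, ∀ i : ℤ, t ^ i * e * (t ^ i)⁻¹ ∈ H := by
    intro e he i
    obtain ⟨n, rfl | rfl⟩ := i.eq_nat_or_neg
    · rw [zpow_natCast]
      refine hm e H (fun i hi => Subgroup.subset_closure ?_) n
      rw [hF]
      exact Set.mem_biUnion he (Or.inl ⟨i, hi, rfl⟩)
    · rw [zpow_neg, zpow_natCast, ← inv_pow]
      refine hm' e H (fun i hi => Subgroup.subset_closure ?_) n
      rw [hF]
      exact Set.mem_biUnion he (Or.inr ⟨i, hi, rfl⟩)
  set L := Subgroup.closure {x : G | ∃ e ∈ E, ∃ i : ℤ, x = t ^ i * e * (t ^ i)⁻¹} with hL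
  have hLH : L ≤ H := by
    rw [hL, Subgroup.closure_le]
    rintro x ⟨e, he, i, rfl⟩
    exact hconj e he i
  have hLt : ∀ j : ℤ, ∀ x ∈ L, t ^ j * x * (t ^ j)⁻¹ ∈ L := by
    intro j x hx
    induction hx using Subgroup.closure_induction with
    | mem x hx =>
      obtain ⟨e, he, i, rfl⟩ := hx
      refine Subgroup.subset_closure ⟨e, he, j + i, ?_⟩
      rw [zpow_add]; group
    | one => simp
    | mul x y _ _ hx hy =>
      have : t ^ j * (x * y) * (t ^ j)⁻¹ = (t ^ j * x * (t ^ j)⁻¹) * (t ^ j * y * (t ^ j)⁻¹) := by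
        group
      rw [this]; exact L.mul_mem hx hy
    | inv x _ hx =>
      have : t ^ j * x⁻¹ * (t ^ j)⁻¹ = (t ^ j * x * (t ^ j)⁻¹)⁻¹ := by group
      rw [this]; exact L.inv_mem hx
  have hLφ : ∀ x ∈ L, φ x = 1 := by
    intro x hx
    have : L ≤ φ.ker := by
      rw [hL, Subgroup.closure_le]
      rintro x ⟨e, ⟨s, _, rfl⟩, i, rfl⟩
      simp only [SetLike.mem_coe, MonoidHom.mem_ker, hex, map_mul, map_inv, hφt]
      simp
    exact this hx
  have hall : ∀ g : G, g * (t ^ (Multiplicative.toAdd (φ g)))⁻¹ ∈ L := by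
    intro g
    have hg : g ∈ Subgroup.closure S := by rw [hS.closure_eq]; trivial
    induction hg using Subgroup.closure_induction with
    | mem x hx => exact Subgroup.subset_closure ⟨ex x, ⟨x, hx, rfl⟩, 0, by simp [hex]⟩
    | one => simp
    | mul x y _ _ hx hy =>
      have h3 := L.mul_mem hx (hLt (Multiplicative.toAdd (φ x)) _ hy)
      convert h3 using 1
      rw [map_mul, toAdd_mul, zpow_add]
      group
    | inv x _ hx =>
      have h3 := hLt (-(Multiplicative.toAdd (φ x))) _ (L.inv_mem hx)
      convert h3 using 1
      rw [map_inv, toAdd_inv]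
      group
  have hker : φ.ker = H := by
    apply le_antisymm
    · intro g hg
      have := hall g
      rw [MonoidHom.mem_ker.1 hg] at this
      simp at this
      exact hLH this
    · rw [hH, Subgroup.closure_le]
      intro x hx
      rw [hF] at hx
      simp only [Set.mem_iUnion] at hx
      obtain ⟨e, ⟨s, hs, rfl⟩, hx⟩ := hx
      have he : φ (ex s) = 1 := by
        simp [hex, hφt]
      rcases hx with ⟨i, _, rfl⟩ | ⟨i, _, rfl⟩ <;>
      · simp only [SetLike.mem_coe, MonoidHom.mem_ker, map_mul, map_inv, he]
        simp
  rw [hker, Group.fg_iff_subgroup_fg]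
  exact (Subgroup.fg_iff _).2 ⟨F, rfl, hFf⟩

end Growth

section OrthogonalRep
open scoped RealInnerProductSpace Pointwise

variable {G E : Type*} [Group G] [NormedAddCommGroup E] [InnerProductSpace ℝ E]

/-- The average of a vector over a finite set of group elements. -/
noncomputable def repAvg (L : G →* Module.End ℝ E) (S : Finset G) (u : E) : E :=
  (S.card : ℝ)⁻¹ • ∑ s ∈ S, L s u

variable {L : G →* Module.End ℝ E}
  {S : Finset G}

theorem rep_inner_inv (hL : ∀ g a b, ⟪L g a, L g b⟫ = ⟪a, b⟫)
    (g : G) (a b : E) : ⟪L g a, b⟫ = ⟪a, L g⁻¹ b⟫ := by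
  rw [← hL g a (L g⁻¹ b), ← Module.End.mul_apply, ← map_mul]
  simp

theorem rep_norm (hL : ∀ g a b, ⟪L g a, L g b⟫ = ⟪a, b⟫)
    (g : G) (a : E) : ‖L g a‖ = ‖a‖ := by
  rw [norm_eq_sqrt_real_inner, hL, ← norm_eq_sqrt_real_inner]

theorem IsSymGen.sum_inv {M : Type*} [AddCommMonoid M] (hS : IsSymGen (S : Set G))
    (f : G → M) :
    ∑ s ∈ S, f s⁻¹ = ∑ s ∈ S, f s := by
  refine Finset.sum_nbij' (fun s => s⁻¹) (fun s => s⁻¹) ?_ ?_ ?_ ?_ ?_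
  · intro s hs; exact hS.inv_mem s hs
  · intro s hs; exact hS.inv_mem s hs
  · simp
  · simp
  · simp

theorem IsSymGen.card_pos (hS : IsSymGen (S : Set G)) : 0 < (S.card : ℝ) := by
  exact_mod_cast Finset.card_pos.2 ⟨1, hS.one_mem⟩

theorem repAvg_symm (hL : ∀ g a b, ⟪L g a, L g b⟫ = ⟪a, b⟫) (hS : IsSymGen (S : Set G))
    (a b : E) : ⟪repAvg L S a, b⟫ = ⟪a, repAvg L S b⟫ := by
  simp only [repAvg, inner_smul_left, inner_smul_right, sum_inner, inner_sum]
  congr 1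
  rw [← hS.sum_inv (fun s => ⟪a, L s b⟫)]
  exact Finset.sum_congr rfl fun s _ => rep_inner_inv hL s a b

theorem repAvg_sub (a b : E) : repAvg L S (a - b) = repAvg L S a - repAvg L S b := by
  simp only [repAvg, map_sub, Finset.sum_sub_distrib, smul_sub]

theorem card_smul_sub_repAvg (hS : IsSymGen (S : Set G))
    (u : E) :
    ∑ s ∈ S, (L s u - u) = (S.card : ℝ) • (repAvg L S u - u) := by
  rw [repAvg, smul_sub, smul_inv_smul₀ hS.card_pos.ne', Finset.sum_sub_distrib, Finset.sum_const,
    ← Nat.cast_smul_eq_nsmul ℝ]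

theorem sum_norm_sq_sub (hL : ∀ g a b, ⟪L g a, L g b⟫ = ⟪a, b⟫) (hS : IsSymGen (S : Set G))
    (u : E) :
    ∑ s ∈ S, ‖L s u - u‖ ^ 2 = 2 * S.card * ⟪u - repAvg L S u, u⟫ := by
  have h1 : ∀ s, ‖L s u - u‖ ^ 2 = -2 * ⟪L s u - u, u⟫ := by
    intro s
    rw [norm_sub_sq_real, rep_norm hL, inner_sub_left, real_inner_self_eq_norm_sq]
    ring
  simp only [h1]
  rw [← Finset.mul_sum, ← sum_inner, card_smul_sub_repAvg hS, inner_smul_left, ← neg_sub,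
    inner_neg_left]
  simp
  ring

theorem energy_nonneg (hL : ∀ g a b, ⟪L g a, L g b⟫ = ⟪a, b⟫) (hS : IsSymGen (S : Set G))
    (u : E) : 0 ≤ ⟪u - repAvg L S u, u⟫ := by
  have h := sum_norm_sq_sub hL hS u
  have h2 : 0 ≤ ∑ s ∈ S, ‖L s u - u‖ ^ 2 := Finset.sum_nonneg fun _ _ => by positivity
  rw [h] at h2
  have := hS.card_pos
  by_contra hn
  push Not at hn
  nlinarith

theorem energy_drop (hL : ∀ g a b, ⟪L g a, L g b⟫ = ⟪a, b⟫) (hS : IsSymGen (S : Set G))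
    (u : E) :
    ⟪repAvg L S u - repAvg L S (repAvg L S u), repAvg L S u⟫ ≤
      ⟪u - repAvg L S u, u⟫ - 2 / S.card * ‖u - repAvg L S u‖ ^ 2 := by
  classical
  have hq := hS.card_pos
  set w := u - repAvg L S u with hw
  have h1 : ⟪repAvg L S w, w⟫ ≥ (2 / S.card - 1) * ‖w‖ ^ 2 := by
    have h3 : ⟪repAvg L S w, w⟫ = (S.card : ℝ)⁻¹ * ∑ s ∈ S, ⟪L s w, w⟫ := by
      simp [repAvg, inner_smul_left, sum_inner]
    have h4 : ∑ s ∈ S, ⟪L s w, w⟫ ≥ ‖w‖ ^ 2 - (S.card - 1) * ‖w‖ ^ 2 := by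
      rw [← Finset.add_sum_erase S _ hS.one_mem]
      have h5 : ∑ s ∈ S.erase 1, ⟪L s w, w⟫ ≥ ∑ s ∈ S.erase 1, -‖w‖ ^ 2 := by
        refine Finset.sum_le_sum fun s _ => ?_
        have := neg_le_of_abs_le (abs_real_inner_le_norm (L s w) w)
        rw [rep_norm hL] at this
        linarith [sq (‖w‖)]
      rw [Finset.sum_const, Finset.card_erase_of_mem hS.one_mem, nsmul_eq_mul,
        Nat.cast_sub (by exact_mod_cast hq)] at h5
      simp only [map_one, Module.End.one_apply, real_inner_self_eq_norm_sq]
      push_cast at h5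
      linarith
    rw [h3]
    calc (2 / S.card - 1) * ‖w‖ ^ 2 = (S.card : ℝ)⁻¹ * (‖w‖ ^ 2 - (S.card - 1) * ‖w‖ ^ 2) := by
          field_simp; ring
      _ ≤ _ := mul_le_mul_of_nonneg_left h4 (by positivity)
  have h2 : repAvg L S u - repAvg L S (repAvg L S u) = repAvg L S w := by rw [hw, repAvg_sub]
  rw [h2]
  have h6 : ⟪repAvg L S w, repAvg L S u⟫ = ⟪w, u⟫ - ‖w‖ ^ 2 - ⟪repAvg L S w, w⟫ := by
    have e1 : repAvg L S u = u - w := by rw [hw]; abel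
    have e2 : repAvg L S w = repAvg L S u - repAvg L S (repAvg L S u) := h2.symm
    rw [e1, inner_sub_right, repAvg_symm hL hS w u, e1, inner_sub_right, real_inner_self_eq_norm_sq]
  rw [h6]
  linarith [sub_mul (2 / (S.card : ℝ)) 1 (‖w‖ ^ 2)]

theorem norm_rep_sub_le (hL : ∀ g a b, ⟪L g a, L g b⟫ = ⟪a, b⟫) (hS : IsSymGen (S : Set G))
    (u : E) (n : ℕ) : ∀ g ∈ (S : Set G) ^ n,
    ‖L g u - u‖ ≤ n * √(2 * S.card * ⟪u - repAvg L S u, u⟫) := by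
  induction n with
  | zero => intro g hg; simp at hg; simp [hg]
  | succ n ih =>
    intro g hg
    rw [pow_succ] at hg
    obtain ⟨a, ha, b, hb, rfl⟩ := hg
    have h1 : L (a * b) u - u = L a (L b u - u) + (L a u - u) := by
      simp [map_mul]
    have h2 : ‖L b u - u‖ ≤ √(2 * S.card * ⟪u - repAvg L S u, u⟫) := by
      apply Real.le_sqrt_of_sq_le
      rw [← sum_norm_sq_sub hL hS]
      exact Finset.single_le_sum (f := fun s => ‖L s u - u‖ ^ 2) (fun _ _ => by positivity) hb
    rw [h1]
    refine (norm_add_le _ _).trans ?_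
    rw [rep_norm hL]
    push_cast
    linarith [ih a ha]

/-- A vector that is almost fixed, relative to its energy, by the averaging operator yields an
almost harmonic function. -/
theorem exists_almost_harmonic (hL : ∀ g a b, ⟪L g a, L g b⟫ = ⟪a, b⟫)
    (hS : IsSymGen (S : Set G)) (u : E) (η : ℝ) (hpos : 0 < ⟪u - repAvg L S u, u⟫)
    (hη : ‖u - repAvg L S u‖ ^ 2 ≤ η * ⟪u - repAvg L S u, u⟫) :
    ∃ f : G → ℝ, f 1 = 0 ∧ (∀ x, ∀ s ∈ S, |f (x * s) - f x| ≤ S.card) ∧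
      (∀ x, |∑ s ∈ S, (f (x * s) - f x)| ≤ S.card * √η) ∧ ∃ s ∈ S, 1 ≤ f s := by
  have hq := hS.card_pos
  set a := ⟪u - repAvg L S u, u⟫ with ha
  have hsum := sum_norm_sq_sub hL hS u
  rw [← ha] at hsum
  obtain ⟨s₀, hs₀, hs₀'⟩ : ∃ s ∈ S, 2 * a ≤ ‖L s u - u‖ ^ 2 := by
    by_contra hcon
    push Not at hcon
    have := Finset.sum_lt_sum_of_nonempty ⟨1, hS.one_mem⟩ hcon
    rw [hsum, Finset.sum_const, nsmul_eq_mul] at this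
    linarith
  set r := √(2 * a) with hr
  have hr2 : r ^ 2 = 2 * a := Real.sq_sqrt (by linarith)
  have hrpos : 0 < r := Real.sqrt_pos.2 (by linarith)
  have hn0 : r ≤ ‖L s₀ u - u‖ := by
    rw [hr]; exact Real.sqrt_le_iff.2 ⟨norm_nonneg _, hs₀'⟩
  set v := ‖L s₀ u - u‖⁻¹ • (L s₀ u - u) with hv
  have hne : ‖L s₀ u - u‖ ≠ 0 := by linarith
  have hvn : ‖v‖ = 1 := by
    rw [hv, norm_smul, norm_inv, norm_norm, inv_mul_cancel₀ hne]
  have hdiff : ∀ x s, ⟪L (x * s) u - u, v⟫ / r - ⟪L x u - u, v⟫ / r = ⟪L x (L s u - u), v⟫ / r := by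
    intro x s
    rw [← sub_div, ← inner_sub_left]
    congr 2
    simp [map_mul]
  refine ⟨fun x => ⟪L x u - u, v⟫ / r, by simp, fun x s hs => ?_, fun x => ?_, s₀, hs₀, ?_⟩
  · simp only [hdiff]
    rw [abs_div, abs_of_pos hrpos, div_le_iff₀ hrpos]
    refine (abs_real_inner_le_norm _ _).trans ?_
    rw [rep_norm hL, hvn, mul_one]
    apply abs_le_of_sq_le_sq' _ (by positivity) |>.2
    have h1 : ‖L s u - u‖ ^ 2 ≤ 2 * S.card * a := by
      rw [← hsum]
      exact Finset.single_le_sum (f := fun s => ‖L s u - u‖ ^ 2) (fun _ _ => by positivity) hs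
    have h2 : (1 : ℝ) ≤ S.card := by exact_mod_cast hq
    have h3 : (S.card : ℝ) * (2 * a) ≤ S.card ^ 2 * (2 * a) :=
      mul_le_mul_of_nonneg_right (by nlinarith) (by linarith)
    rw [mul_pow, hr2]
    linarith
  · simp only [hdiff]
    rw [← Finset.sum_div, ← sum_inner, ← map_sum, card_smul_sub_repAvg hS, abs_div,
      abs_of_pos hrpos, div_le_iff₀ hrpos]
    refine (abs_real_inner_le_norm _ _).trans ?_
    rw [rep_norm hL, hvn, mul_one, norm_smul, Real.norm_of_nonneg hq.le, mul_assoc]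
    refine mul_le_mul_of_nonneg_left ?_ hq.le
    rw [norm_sub_rev]
    have hη0 : 0 ≤ η := by
      by_contra hcon
      push Not at hcon
      nlinarith [sq_nonneg ‖u - repAvg L S u‖]
    apply abs_le_of_sq_le_sq' _ (by positivity) |>.2
    rw [mul_pow, hr2, Real.sq_sqrt hη0]
    nlinarith
  · beta_reduce
    rw [hv, inner_smul_right, real_inner_self_eq_norm_sq, le_div_iff₀ hrpos, sq, ← mul_assoc,
      inv_mul_cancel₀ hne]
    linarith

end OrthogonalRep

section Walk
open scoped Pointwise Classical

variable {G : Type*} [Group G]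

/-- The law at time `n` of the random walk with uniform steps in `S`. -/
noncomputable def walk (S : Finset G) : ℕ → G → ℝ
  | 0 => fun y => if y = 1 then 1 else 0
  | n + 1 => fun y => (S.card : ℝ)⁻¹ * ∑ s ∈ S, walk S n (s⁻¹ * y)

variable {S : Finset G}

theorem walk_nonneg (n : ℕ) (y : G) : 0 ≤ walk S n y := by
  induction n generalizing y with
  | zero => simp only [walk]; split_ifs <;> norm_num
  | succ n ih =>
    simp only [walk]
    exact mul_nonneg (by positivity) (Finset.sum_nonneg fun _ _ => ih _)

theorem walk_eq_zero (n : ℕ) (y : G) (hy : y ∉ (S : Set G) ^ n) : walk S n y = 0 := by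
  induction n generalizing y with
  | zero => simp only [walk]; rw [if_neg]; simpa using hy
  | succ n ih =>
    simp only [walk]
    rw [Finset.sum_eq_zero, mul_zero]
    intro s hs
    apply ih
    intro hcon
    apply hy
    rw [pow_succ']
    exact ⟨s, hs, _, hcon, by simp⟩

theorem finite_set_pow {S : Set G} (hS : S.Finite) (n : ℕ) : (S ^ n).Finite := by
  induction n with
  | zero => simp
  | succ n ih => rw [pow_succ]; exact ih.mul hS

theorem walk_support (n : ℕ) : Function.support (walk S n) ⊆ (S : Set G) ^ n := by
  intro y hy
  by_contra h
  exact hy (walk_eq_zero n y h)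

theorem walk_support_finite (n : ℕ) : (Function.support (walk S n)).Finite :=
  (finite_set_pow S.finite_toSet n).subset (walk_support n)

theorem walk_summable (n : ℕ) (F : G → ℝ) : Summable fun y => walk S n y * F y :=
  summable_of_hasFiniteSupport ((walk_support_finite n).subset
    (Function.support_mul_subset_left _ _))

theorem walk_summable_left (n : ℕ) (s : G) (F : G → ℝ) :
    Summable fun y => walk S n (s * y) * F y := by
  have := walk_summable (S := S) n (fun y => F (s⁻¹ * y))
  rw [← (Equiv.mulLeft s).summable_iff] at this
  simpa [Function.comp_def] using this

/-- The averaging operator over right translations. -/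
noncomputable def rAvg (S : Finset G) (F : G → ℝ) : G → ℝ :=
  fun x => (S.card : ℝ)⁻¹ * ∑ s ∈ S, F (x * s)

theorem walk_tsum_shift (n : ℕ) (s : G) (F : G → ℝ) (x : G) :
    ∑' y, walk S n (s⁻¹ * y) * F (x * y) = ∑' y, walk S n y * F (x * s * y) := by
  rw [← Equiv.tsum_eq (Equiv.mulLeft s)]
  simp [mul_assoc]

theorem rAvg_iterate_eq (n : ℕ) (F : G → ℝ) (x : G) :
    (rAvg S)^[n] F x = ∑' y, walk S n y * F (x * y) := by
  induction n generalizing x with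
  | zero =>
    rw [tsum_eq_single 1]
    · simp [walk]
    · intro y hy; simp [walk, hy]
  | succ n ih =>
    rw [Function.iterate_succ_apply']
    simp only [rAvg, walk, ih]
    simp only [mul_assoc, Finset.sum_mul]
    rw [tsum_mul_left, Summable.tsum_finsetSum]
    · simp only [walk_tsum_shift]
      simp only [mul_assoc]
    · intro s _
      exact walk_summable_left n s⁻¹ _

theorem rAvg_const (hS : S.Nonempty) (c : ℝ) : rAvg S (fun _ => c) = fun _ => c := by
  have : (S.card : ℝ) ≠ 0 := by exact_mod_cast hS.card_ne_zero
  ext x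
  simp [rAvg, this]

theorem rAvg_iterate_const (hS : S.Nonempty) (c : ℝ) (n : ℕ) :
    (rAvg S)^[n] (fun _ => c) = fun _ => c := by
  induction n with
  | zero => rfl
  | succ n ih => rw [Function.iterate_succ_apply', ih, rAvg_const hS]

theorem walk_tsum_one (hS : S.Nonempty) (n : ℕ) : ∑' y, walk S n y = 1 := by
  have := rAvg_iterate_eq (S := S) n (fun _ => 1) 1
  rw [rAvg_iterate_const hS] at this
  simpa using this.symm

end Walk

section Regular
open scoped Pointwise RealInnerProductSpace Classical

variable {G : Type*} [Group G]

theorem memℓp_translate (g : G) (f : lp (fun _ : G => ℝ) 2) :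
    Memℓp (fun h => f (g⁻¹ * h)) 2 := by
  have h := lp.memℓp f
  rw [memℓp_gen_iff (by norm_num)] at h ⊢
  exact h.comp_injective (Equiv.mulLeft g⁻¹).injective

/-- The left regular representation on square-summable functions. -/
noncomputable def leftRegular (G : Type*) [Group G] :
    G →* Module.End ℝ (lp (fun _ : G => ℝ) 2) where
  toFun g :=
    { toFun := fun f => ⟨fun h => f (g⁻¹ * h), memℓp_translate g f⟩
      map_add' := fun _ _ => rfl
      map_smul' := fun _ _ => rfl }
  map_one' := by
    ext f h
    change f (1⁻¹ * h) = f h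
    simp
  map_mul' a b := by
    ext f h
    change f ((a * b)⁻¹ * h) = f (b⁻¹ * (a⁻¹ * h))
    simp [mul_assoc]

theorem leftRegular_apply (g : G) (f : lp (fun _ : G => ℝ) 2) (h : G) :
    leftRegular G g f h = f (g⁻¹ * h) := rfl

theorem leftRegular_inner (g : G) (a b : lp (fun _ : G => ℝ) 2) :
    ⟪leftRegular G g a, leftRegular G g b⟫ = ⟪a, b⟫ := by
  rw [lp.inner_eq_tsum, lp.inner_eq_tsum]
  simp only [leftRegular_apply]
  exact Equiv.tsum_eq (Equiv.mulLeft g⁻¹) (fun h => ⟪a h, b h⟫)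

variable {S : Finset G}

/-- The law of the random walk as a square-summable function. -/
noncomputable def walkLp (S : Finset G) (n : ℕ) : lp (fun _ : G => ℝ) 2 :=
  ⟨walk S n, memℓp_gen (summable_of_hasFiniteSupport ((walk_support_finite (S := S) n).subset
    (by intro y hy h; apply hy; simp [h])))⟩

theorem walkLp_apply (n : ℕ) (y : G) : walkLp S n y = walk S n y := rfl

theorem walkLp_succ (n : ℕ) : walkLp S (n + 1) = repAvg (leftRegular G) S (walkLp S n) := by
  ext y
  rw [walkLp_apply, repAvg]
  simp only [lp.coeFn_smul, lp.coeFn_sum, Pi.smul_apply, Finset.sum_apply, smul_eq_mul,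
    leftRegular_apply, walkLp_apply]
  rfl

theorem one_le_card_mul_norm_sq (hS : S.Nonempty) (n : ℕ) (B : Finset G)
    (hB : (B : Set G) = (S : Set G) ^ n) : 1 ≤ (B.card : ℝ) * ‖walkLp S n‖ ^ 2 := by
  have h1 : ∑ y ∈ B, walk S n y = 1 := by
    rw [← walk_tsum_one hS n, tsum_eq_sum]
    intro y hy
    exact walk_eq_zero n y (by rw [← hB]; exact hy)
  have h2 := sq_sum_le_card_mul_sum_sq (s := B) (f := walk S n)
  rw [h1] at h2
  have h3 : ∑ y ∈ B, walk S n y ^ 2 ≤ ‖walkLp S n‖ ^ 2 := by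
    rw [← real_inner_self_eq_norm_sq]
    have := lp.hasSum_inner (𝕜 := ℝ) (walkLp S n) (walkLp S n)
    have h4 := sum_le_hasSum B (fun y _ => by
      simp only [walkLp_apply, real_inner_self_eq_norm_sq]; positivity) this
    refine le_trans (le_of_eq ?_) h4
    refine Finset.sum_congr rfl fun y _ => ?_
    simp [walkLp_apply]
  have h5 : (0 : ℝ) ≤ B.card := by positivity
  nlinarith

theorem walkLp_inner_eq_zero (hS : IsSymGen (S : Set G)) (n : ℕ) (g : G)
    (hg : g ∉ (S : Set G) ^ (2 * n)) :
    ⟪leftRegular G g (walkLp S n), walkLp S n⟫ = 0 := by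
  rw [lp.inner_eq_tsum]
  convert tsum_zero with h
  rw [leftRegular_apply, walkLp_apply, walkLp_apply]
  by_cases h1 : g⁻¹ * h ∈ (S : Set G) ^ n
  · by_cases h2 : h ∈ (S : Set G) ^ n
    · exfalso
      apply hg
      rw [two_mul, pow_add]
      exact ⟨h, h2, _, hS.inv_pow_mem n _ h1, by simp⟩
    · rw [walk_eq_zero n h h2]; simp
  · rw [walk_eq_zero n _ h1]; simp

theorem IsSymGen.exists_notMem_pow [Infinite G] (hS : IsSymGen (S : Set G)) (n : ℕ) :
    ∃ g ∈ (S : Set G) ^ (n + 1), g ∉ (S : Set G) ^ n := by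
  by_contra hcon
  push Not at hcon
  have h : ∀ m, (S : Set G) ^ (n + m) ⊆ (S : Set G) ^ n := by
    intro m
    induction m with
    | zero => simp
    | succ m ih =>
      rw [← add_assoc, pow_succ]
      refine (Set.mul_subset_mul_right ih).trans ?_
      rw [← pow_succ]
      exact hcon
  have : (Set.univ : Set G) ⊆ (S : Set G) ^ n := by
    intro g _
    obtain ⟨m, hm⟩ := hS.exists_mem_pow g
    exact h m (pow_mem_pow_of_le hS.one_mem (by omega) hm)
  exact Set.infinite_univ ((finite_set_pow S.finite_toSet n).subset this)

theorem energy_lower_bound [Infinite G] (hS : IsSymGen (S : Set G)) (n : ℕ) (B : Finset G)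
    (hB : (B : Set G) = (S : Set G) ^ n) :
    1 ≤ (B.card : ℝ) * ((2 * n + 1) ^ 2 * S.card *
      ⟪walkLp S n - walkLp S (n + 1), walkLp S n⟫) := by
  obtain ⟨g, hg, hg'⟩ := hS.exists_notMem_pow (2 * n)
  have h1 := norm_rep_sub_le (leftRegular_inner (G := G)) hS (walkLp S n) _ g hg
  have h2 : ‖leftRegular G g (walkLp S n) - walkLp S n‖ ^ 2 = 2 * ‖walkLp S n‖ ^ 2 := by
    rw [norm_sub_sq_real, walkLp_inner_eq_zero hS n g hg', rep_norm leftRegular_inner]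
    ring
  have h3 := one_le_card_mul_norm_sq ⟨1, hS.one_mem⟩ n B hB
  have h4 := energy_nonneg (leftRegular_inner (G := G)) hS (walkLp S n)
  rw [← walkLp_succ] at h1 h4
  have h5 := pow_le_pow_left₀ (norm_nonneg _) h1 2
  rw [h2, mul_pow, Real.sq_sqrt (by positivity)] at h5
  push_cast at h5
  refine h3.trans (mul_le_mul_of_nonneg_left ?_ (by positivity))
  linarith

theorem exists_small_laplacian [Infinite G] {d : ℕ} (hG : GrowthLE G d)
    (hS : IsSymGen (S : Set G)) (η : ℝ) (hη : 0 < η) :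
    ∃ n : ℕ, 0 < ⟪walkLp S n - walkLp S (n + 1), walkLp S n⟫ ∧
      ‖walkLp S n - walkLp S (n + 1)‖ ^ 2 ≤ η * ⟪walkLp S n - walkLp S (n + 1), walkLp S n⟫ := by
  have hq := hS.card_pos
  obtain ⟨C, hC⟩ := hG S S.finite_toSet
  set a : ℕ → ℝ := fun n => ⟪walkLp S n - walkLp S (n + 1), walkLp S n⟫ with ha
  have hlow : ∀ n ≥ 1, 1 ≤ (C : ℝ) * n ^ d * ((2 * n + 1) ^ 2 * S.card * a n) := by
    intro n hn
    set B := (finite_set_pow S.finite_toSet n).toFinset with hB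
    have h := energy_lower_bound hS n B (by simp [hB])
    have hc := hC n hn B (by simp [hB])
    have h4 := energy_nonneg (leftRegular_inner (G := G)) hS (walkLp S n)
    rw [← walkLp_succ] at h4
    refine h.trans (mul_le_mul_of_nonneg_right (by exact_mod_cast hc) ?_)
    positivity
  have hpos : ∀ n ≥ 1, 0 < a n := by
    intro n hn
    by_contra hcon
    push Not at hcon
    have := hlow n hn
    have h2 : (C : ℝ) * n ^ d * ((2 * n + 1) ^ 2 * S.card * a n) ≤ 0 :=
      mul_nonpos_of_nonneg_of_nonpos (by positivity)
        (mul_nonpos_of_nonneg_of_nonpos (by positivity) hcon)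
    linarith
  by_contra hcon
  push Not at hcon
  set θ : ℝ := 1 - 2 / S.card * η with hθ
  have hθ1 : θ < 1 := by have : 0 < 2 / S.card * η := by positivity
                         linarith
  have hdrop : ∀ n ≥ 1, a (n + 1) ≤ θ * a n := by
    intro n hn
    have h1 := energy_drop (leftRegular_inner (G := G)) hS (walkLp S n)
    rw [← walkLp_succ, ← walkLp_succ] at h1
    have h2 := hcon n (hpos n hn)
    have h3 : 2 / S.card * (η * a n) ≤ 2 / S.card * ‖walkLp S n - walkLp S (n + 1)‖ ^ 2 :=
      mul_le_mul_of_nonneg_left h2.le (by positivity)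
    have h4 : a (n + 1) ≤ a n - 2 / S.card * (η * a n) := by
      simp only [ha] at h3 ⊢
      linarith
    rw [hθ]; linarith
  have hθ0 : 0 < θ := by
    have h1 := hdrop 1 le_rfl
    have h2 := hpos 1 le_rfl
    have h3 := hpos 2 (by norm_num)
    by_contra hc
    push Not at hc
    nlinarith
  have hexp : ∀ n, a (n + 1) ≤ θ ^ n * a 1 := by
    intro n
    induction n with
    | zero => simp
    | succ n ih =>
      calc a (n + 2) ≤ θ * a (n + 1) := hdrop _ (by omega)
        _ ≤ θ * (θ ^ n * a 1) := mul_le_mul_of_nonneg_left ih hθ0.le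
        _ = _ := by ring
  have hlim := tendsto_pow_const_mul_const_pow_of_abs_lt_one (d + 2) (r := θ)
    (by rw [abs_of_pos hθ0]; exact hθ1)
  have hlim2 := (tendsto_add_atTop_iff_nat 1).2 hlim
  set K : ℝ := C * 9 * S.card * a 1 / θ with hK
  have hlim3 := hlim2.const_mul K
  rw [mul_zero] at hlim3
  obtain ⟨n, hn⟩ := (hlim3.eventually (gt_mem_nhds zero_lt_one)).exists
  have h1 := hlow (n + 1) (by omega)
  have h2 : (C : ℝ) * (n + 1 : ℕ) ^ d * ((2 * (n + 1 : ℕ) + 1) ^ 2 * S.card * a (n + 1)) ≤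
      C * (n + 1 : ℕ) ^ d * ((3 * (n + 1 : ℕ)) ^ 2 * S.card * (θ ^ n * a 1)) := by
    have := hexp n
    have h0 := (hpos (n + 1) (by omega)).le
    gcongr
    have : (1 : ℝ) ≤ (n + 1 : ℕ) := by exact_mod_cast (by omega : 1 ≤ n + 1)
    linarith
  have h3 : (C : ℝ) * (n + 1 : ℕ) ^ d * ((3 * (n + 1 : ℕ)) ^ 2 * S.card * (θ ^ n * a 1)) =
      K * (((n + 1 : ℕ) : ℝ) ^ (d + 2) * θ ^ (n + 1)) := by
    rw [hK]
    field_simp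
    ring
  linarith

theorem exists_almost_harmonic_seq [Infinite G] {d : ℕ} (hG : GrowthLE G d)
    (hS : IsSymGen (S : Set G)) (n : ℕ) :
    ∃ f : G → ℝ, f 1 = 0 ∧ (∀ x, ∀ s ∈ S, |f (x * s) - f x| ≤ S.card) ∧
      (∀ x, |∑ s ∈ S, (f (x * s) - f x)| ≤ S.card * (1 / ((n : ℝ) + 1))) ∧ ∃ s ∈ S, 1 ≤ f s := by
  obtain ⟨k, h1, h2⟩ := exists_small_laplacian hG hS ((1 / ((n : ℝ) + 1)) ^ 2) (by positivity)
  rw [walkLp_succ] at h1 h2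
  obtain ⟨f, hf⟩ := exists_almost_harmonic leftRegular_inner hS _ _ h1 h2
  rw [Real.sqrt_sq (by positivity)] at hf
  exact ⟨f, hf⟩

end Regular

section Limits

/-- Bounded real sequences converge along the hyperfilter. -/
theorem exists_tendsto_hyperfilter (a : ℕ → ℝ) (B : ℝ) (h : ∀ n, |a n| ≤ B) :
    ∃ l, Tendsto a (hyperfilter ℕ : Filter ℕ) (nhds l) := by
  have hc : IsCompact (Set.Icc (-B) B) := isCompact_Icc
  obtain ⟨l, _, hl⟩ := hc.ultrafilter_le_nhds' ((hyperfilter ℕ).map a) (by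
    rw [Ultrafilter.mem_map]
    exact Filter.univ_mem' fun n => abs_le.1 (h n))
  exact ⟨l, hl⟩

theorem tendsto_hyperfilter_of_atTop {α : Type*} {a : ℕ → α} {l : Filter α}
    (h : Tendsto a atTop l) : Tendsto a (hyperfilter ℕ : Filter ℕ) l :=
  h.mono_left Nat.hyperfilter_le_atTop

end Limits

section Harmonic
open scoped Pointwise Classical

variable {G : Type*} [Group G]

/-- Lipschitz harmonic functions vanishing at the identity. -/
def lipHarm (S : Finset G) : Submodule ℝ (G → ℝ) where
  carrier := {f | f 1 = 0 ∧ (∃ C : ℝ, ∀ x, ∀ s ∈ S, |f (x * s) - f x| ≤ C) ∧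
    ∀ x, ∑ s ∈ S, (f (x * s) - f x) = 0}
  zero_mem' := ⟨rfl, ⟨0, by simp⟩, by simp⟩
  add_mem' := by
    rintro f g ⟨hf1, ⟨C, hC⟩, hf⟩ ⟨hg1, ⟨D, hD⟩, hg⟩
    refine ⟨by simp [hf1, hg1], ⟨C + D, fun x s hs => ?_⟩, fun x => ?_⟩
    · have : (f + g) (x * s) - (f + g) x = (f (x * s) - f x) + (g (x * s) - g x) := by
        simp only [Pi.add_apply]; ring
      rw [this]
      exact (abs_add_le _ _).trans (add_le_add (hC x s hs) (hD x s hs))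
    · have h1 := hf x
      have h2 := hg x
      have : ∑ s ∈ S, ((f + g) (x * s) - (f + g) x) =
          ∑ s ∈ S, (f (x * s) - f x) + ∑ s ∈ S, (g (x * s) - g x) := by
        rw [← Finset.sum_add_distrib]
        refine Finset.sum_congr rfl fun s _ => ?_
        simp only [Pi.add_apply]; ring
      rw [this, h1, h2]; ring
  smul_mem' := by
    rintro c f ⟨hf1, ⟨C, hC⟩, hf⟩
    refine ⟨by simp [hf1], ⟨|c| * C, fun x s hs => ?_⟩, fun x => ?_⟩
    · simp only [Pi.smul_apply, smul_eq_mul]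
      rw [← mul_sub, abs_mul]
      exact mul_le_mul_of_nonneg_left (hC x s hs) (abs_nonneg _)
    · simp only [Pi.smul_apply, smul_eq_mul, ← mul_sub]
      rw [← Finset.mul_sum, hf x, mul_zero]

variable {S : Finset G}

theorem lipschitz_pow {f : G → ℝ} {C : ℝ} (hC : ∀ x, ∀ s ∈ S, |f (x * s) - f x| ≤ C) (n : ℕ) :
    ∀ x, ∀ y ∈ (S : Set G) ^ n, |f (x * y) - f x| ≤ n * C := by
  induction n with
  | zero => intro x y hy; simp at hy; simp [hy]
  | succ n ih =>
    intro x y hy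
    rw [pow_succ] at hy
    obtain ⟨a, ha, b, hb, rfl⟩ := hy
    have h1 := ih x a ha
    have h2 := hC (x * a) b hb
    beta_reduce
    rw [← mul_assoc]
    have : f (x * a * b) - f x = (f (x * a * b) - f (x * a)) + (f (x * a) - f x) := by ring
    rw [this]
    push_cast
    linarith [abs_add_le (f (x * a * b) - f (x * a)) (f (x * a) - f x)]

theorem exists_lipHarm_ne_zero [Infinite G] {d : ℕ} (hG : GrowthLE G d)
    (hS : IsSymGen (S : Set G)) : ∃ f ∈ lipHarm S, f ≠ 0 := by
  choose f h1 hLip hharm hs using exists_almost_harmonic_seq hG hS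
  have hbound : ∀ x, ∃ l, Tendsto (fun n => f n x) (hyperfilter ℕ : Filter ℕ) (nhds l) := by
    intro x
    obtain ⟨k, hk⟩ := hS.exists_mem_pow x
    refine exists_tendsto_hyperfilter _ (k * S.card) fun n => ?_
    have := lipschitz_pow (hLip n) k 1 x hk
    rwa [one_mul, h1, sub_zero] at this
  choose F hF using hbound
  refine ⟨F, ⟨?_, ⟨S.card, fun x s hs => ?_⟩, fun x => ?_⟩, ?_⟩
  · refine tendsto_nhds_unique (hF 1) ?_
    simp only [h1]
    exact tendsto_const_nhds
  · refine le_of_tendsto ((hF (x * s)).sub (hF x)).abs ?_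
    exact Filter.Eventually.of_forall fun n => hLip n x s hs
  · have t1 : Tendsto (fun n => ∑ s ∈ S, (f n (x * s) - f n x)) (hyperfilter ℕ : Filter ℕ)
        (nhds (∑ s ∈ S, (F (x * s) - F x))) :=
      tendsto_finsetSum _ fun s _ => (hF (x * s)).sub (hF x)
    have t2 : Tendsto (fun n : ℕ => (S.card : ℝ) * (1 / ((n : ℝ) + 1)))
        (hyperfilter ℕ : Filter ℕ) (nhds (S.card * 0)) :=
      (tendsto_hyperfilter_of_atTop tendsto_one_div_add_atTop_nhds_zero_nat).const_mul _
    rw [mul_zero] at t2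
    exact tendsto_nhds_unique t1 (squeeze_zero_norm (fun n => hharm n x) t2)
  · intro h0
    have hsum : ∀ n, 1 ≤ ∑ s ∈ S, |f n s| := by
      intro n
      obtain ⟨s, hs, h⟩ := hs n
      exact h.trans ((le_abs_self _).trans
        (Finset.single_le_sum (f := fun s => |f n s|) (fun _ _ => abs_nonneg _) hs))
    have t : Tendsto (fun n => ∑ s ∈ S, |f n s|) (hyperfilter ℕ : Filter ℕ)
        (nhds (∑ s ∈ S, |F s|)) := tendsto_finsetSum _ fun s _ => (hF s).abs
    have := ge_of_tendsto t (Filter.Eventually.of_forall hsum)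
    simp [h0] at this
    linarith

end Harmonic

section Entropy
open scoped Pointwise Classical

variable {G : Type*} [Group G] {S : Finset G}

theorem summable_of_pow_support {n : ℕ} {h : G → ℝ} (hh : ∀ y ∉ (S : Set G) ^ n, h y = 0) :
    Summable h :=
  summable_of_hasFiniteSupport ((finite_set_pow S.finite_toSet n).subset
    (fun y hy => by by_contra hc; exact hy (hh y hc)))

theorem walk_shift_eq_zero {n : ℕ} {s y : G} (hs : s ∈ S) (hy : y ∉ (S : Set G) ^ (n + 1)) :
    walk S n (s⁻¹ * y) = 0 := by
  apply walk_eq_zero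
  intro hcon
  apply hy
  rw [pow_succ']
  exact ⟨s, hs, _, hcon, by simp⟩

/-- The entropy of the random walk at time `n`. -/
noncomputable def walkEntropy (S : Finset G) (n : ℕ) : ℝ := ∑' y, Real.negMulLog (walk S n y)

theorem mul_log_sub_ge {a b : ℝ} (ha : 0 ≤ a) (hb : 0 ≤ b) (hab : b = 0 → a = 0) :
    (√a - √b) ^ 2 ≤ a * Real.log a - a * Real.log b - a + b := by
  rcases ha.eq_or_lt with rfl | ha
  · simp [Real.sq_sqrt hb]
  have hb' : 0 < b := lt_of_le_of_ne hb (fun h => ha.ne' (hab h.symm))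
  have h1 := Real.log_le_sub_one_of_pos (x := √b / √a) (by positivity)
  rw [Real.log_div (by positivity) (by positivity), Real.log_sqrt hb, Real.log_sqrt ha.le] at h1
  have h2 : a * (√b / √a - 1) = √a * √b - a := by
    have : a = √a * √a := (Real.mul_self_sqrt ha.le).symm
    have h3 : √a ≠ 0 := by positivity
    nth_rewrite 1 [this]
    field_simp
    linear_combination this
  have h3 := mul_le_mul_of_nonneg_left h1 ha.le
  rw [h2] at h3
  have : (√a - √b) ^ 2 = a - 2 * (√a * √b) + b := by
    rw [sub_sq, Real.sq_sqrt ha.le, Real.sq_sqrt hb]; ring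
  rw [this]
  linarith

theorem walkEntropy_le (hS : S.Nonempty) (n : ℕ) (B : Finset G)
    (hB : (B : Set G) = (S : Set G) ^ n) : walkEntropy S n ≤ Real.log B.card := by
  have hz : ∀ y ∉ B, walk S n y = 0 := fun y hy => walk_eq_zero n y (by rw [← hB]; exact hy)
  have h1 : ∑ y ∈ B, walk S n y = 1 := by
    rw [← walk_tsum_one hS n, tsum_eq_sum hz]
  have hBne : B.Nonempty := by
    rw [Finset.nonempty_iff_ne_empty]; rintro rfl; simp at h1
  have hc : (0 : ℝ) < B.card := by exact_mod_cast hBne.card_pos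
  rw [walkEntropy, tsum_eq_sum (s := B) (fun y hy => by rw [hz y hy]; simp)]
  have h2 : ∀ y ∈ B, Real.negMulLog (walk S n y) ≤
      walk S n y * Real.log B.card + ((B.card : ℝ)⁻¹ - walk S n y) := by
    intro y _
    have := mul_log_sub_ge (walk_nonneg (S := S) n y) (inv_nonneg.2 hc.le)
      (fun h => absurd h (inv_ne_zero hc.ne'))
    rw [Real.log_inv] at this
    rw [Real.negMulLog]
    nlinarith [sq_nonneg (√(walk S n y) - √(B.card : ℝ)⁻¹)]
  refine (Finset.sum_le_sum h2).trans ?_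
  rw [Finset.sum_add_distrib, ← Finset.sum_mul, h1, Finset.sum_sub_distrib, h1, Finset.sum_const,
    nsmul_eq_mul, mul_inv_cancel₀ hc.ne']
  simp

theorem walk_succ_eq_zero {n : ℕ} {s y : G} (hs : s ∈ S) (h : walk S (n + 1) y = 0) :
    walk S n (s⁻¹ * y) = 0 := by
  have hq : (0 : ℝ) < S.card := by exact_mod_cast Finset.card_pos.2 ⟨s, hs⟩
  simp only [walk, mul_eq_zero, inv_eq_zero, hq.ne', false_or] at h
  exact (Finset.sum_eq_zero_iff_of_nonneg (fun s _ => walk_nonneg n _)).1 h s hs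

/-- The Hellinger distance of the shifted laws is controlled by the entropy increment. -/
theorem hellinger_le_entropy (hS : S.Nonempty) (n : ℕ) :
    ∑ s ∈ S, ∑' y, (√(walk S n (s⁻¹ * y)) - √(walk S (n + 1) y)) ^ 2 ≤
      S.card * (walkEntropy S (n + 1) - walkEntropy S n) := by
  have hq : (0 : ℝ) < S.card := by exact_mod_cast hS.card_pos
  set a : G → G → ℝ := fun s y => walk S n (s⁻¹ * y) with ha
  set b : G → ℝ := fun y => walk S (n + 1) y with hb
  have ha0 : ∀ s ∈ S, ∀ y ∉ (S : Set G) ^ (n + 1), a s y = 0 := fun s hs y hy =>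
    walk_shift_eq_zero hs hy
  have hb0 : ∀ y ∉ (S : Set G) ^ (n + 1), b y = 0 := fun y hy => walk_eq_zero _ y hy
  have hterm : ∀ s ∈ S, ∑' y, (√(a s y) - √(b y)) ^ 2 ≤
      ∑' y, -(a s y * Real.log (b y)) - walkEntropy S n := by
    intro s hs
    have e1 : walkEntropy S n = ∑' y, -(a s y * Real.log (a s y)) := by
      rw [walkEntropy, ← Equiv.tsum_eq (Equiv.mulLeft s⁻¹)]
      simp [ha, Real.negMulLog]
    have s1 : Summable fun y => -(a s y * Real.log (a s y)) :=
      summable_of_pow_support (S := S) (n := n + 1) (fun y hy => by simp [ha0 s hs y hy])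
    have s2 : Summable fun y => -(a s y * Real.log (b y)) :=
      summable_of_pow_support (S := S) (n := n + 1) (fun y hy => by simp [ha0 s hs y hy])
    have s3 : Summable (a s) := summable_of_pow_support (S := S) (n := n + 1) (ha0 s hs)
    have s4 : Summable b := summable_of_pow_support (S := S) (n := n + 1) hb0
    have s5 : Summable fun y => (√(a s y) - √(b y)) ^ 2 :=
      summable_of_pow_support (S := S) (n := n + 1)
        (fun y hy => by simp [ha0 s hs y hy, hb0 y hy])
    have ea : ∑' y, a s y = 1 := by
      rw [← walk_tsum_one hS n, ← Equiv.tsum_eq (Equiv.mulLeft s⁻¹) (walk S n)]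
      rfl
    have eb : ∑' y, b y = 1 := walk_tsum_one hS (n + 1)
    have h1 : ∑' y, (√(a s y) - √(b y)) ^ 2 ≤
        ∑' y, (((-(a s y * Real.log (b y))) - (-(a s y * Real.log (a s y)))) + (b y - a s y)) := by
      refine Summable.tsum_le_tsum (fun y => ?_) s5 ((s2.sub s1).add (s4.sub s3))
      have := mul_log_sub_ge (a := a s y) (b := b y) (walk_nonneg n _) (walk_nonneg _ y)
        (fun h => walk_succ_eq_zero hs h)
      linarith
    rw [(s2.sub s1).tsum_add (s4.sub s3), s2.tsum_sub s1, s4.tsum_sub s3, ea, eb, ← e1] at h1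
    linarith
  refine (Finset.sum_le_sum hterm).trans ?_
  rw [Finset.sum_sub_distrib, Finset.sum_const, nsmul_eq_mul, mul_sub]
  refine sub_le_sub_right (le_of_eq ?_) _
  rw [← Summable.tsum_finsetSum (fun s hs => summable_of_pow_support (S := S) (n := n + 1)
    (fun y hy => by simp [ha0 s hs y hy])), walkEntropy, ← tsum_mul_left]
  congr 1
  ext y
  rw [Real.negMulLog, Finset.sum_neg_distrib, ← Finset.sum_mul]
  have : b y = (S.card : ℝ)⁻¹ * ∑ s ∈ S, a s y := rfl
  change _ = _ * (-b y * Real.log (b y))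
  have h2 : ∑ s ∈ S, a s y = S.card * b y := by rw [this]; field_simp
  rw [h2]; ring

theorem walkEntropy_nonneg (hS : S.Nonempty) (n : ℕ) : 0 ≤ walkEntropy S n := by
  refine tsum_nonneg fun y => Real.negMulLog_nonneg (walk_nonneg n y) ?_
  rw [← walk_tsum_one hS n]
  have : Summable (walk S n) := summable_of_pow_support (S := S) (n := n) (walk_eq_zero n)
  exact this.le_tsum y (fun _ _ => walk_nonneg n _)

theorem exists_small_entropy_increment {d : ℕ} (hG : GrowthLE G d) (hS : S.Nonempty) (N : ℕ) :
    ∃ n ≥ N, walkEntropy S (n + 1) - walkEntropy S n ≤ (d + 1) / ((n : ℝ) + 1) := by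
  by_contra hcon
  push Not at hcon
  obtain ⟨C, hC⟩ := hG S S.finite_toSet
  have hup : ∀ n ≥ 1, walkEntropy S n ≤ Real.log C + d * Real.log (n + 1) := by
    intro n hn
    set B := (finite_set_pow S.finite_toSet n).toFinset with hB
    have hB' : (B : Set G) = (S : Set G) ^ n := by simp [hB]
    have h1 := walkEntropy_le hS n B hB'
    have h2 := hC n hn B hB'.subset
    have hBc : 0 < B.card := by
      obtain ⟨s, hs⟩ := hS
      refine Finset.card_pos.2 ⟨s ^ n, ?_⟩
      rw [← Finset.mem_coe, hB']
      exact Set.pow_mem_pow hs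
    have hCpos : 0 < C := by
      rcases Nat.eq_zero_or_pos C with h | h
      · rw [h] at h2; omega
      · exact h
    refine h1.trans ?_
    have h3 : Real.log B.card ≤ Real.log (C * ((n : ℝ) + 1) ^ d) := by
      refine Real.log_le_log (by exact_mod_cast hBc) ?_
      calc (B.card : ℝ) ≤ C * (n : ℝ) ^ d := by exact_mod_cast h2
        _ ≤ _ := by gcongr; linarith
    rwa [Real.log_mul (by positivity) (by positivity), Real.log_pow] at h3
  have hlow : ∀ k, (d + 1) * (Real.log ((N + k : ℕ) + 1) - Real.log (N + 1)) ≤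
      walkEntropy S (N + k) := by
    intro k
    induction k with
    | zero => simpa using walkEntropy_nonneg hS N
    | succ k ih =>
      have h1 := hcon (N + k) (by omega)
      have hp : (0 : ℝ) < (N + k : ℕ) + 1 := by positivity
      have h2 : Real.log ((N + (k + 1) : ℕ) + 1) - Real.log ((N + k : ℕ) + 1) ≤
          1 / ((N + k : ℕ) + 1) := by
        rw [← Real.log_div (by positivity) hp.ne']
        refine (Real.log_le_sub_one_of_pos (by positivity)).trans (le_of_eq ?_)
        field_simp
        push_cast
        ring
      have h3 : (d + 1) / (((N + k : ℕ) : ℝ) + 1) = (d + 1) * (1 / ((N + k : ℕ) + 1)) := by ring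
      rw [h3] at h1
      have h4 := mul_le_mul_of_nonneg_left h2 (by positivity : (0 : ℝ) ≤ d + 1)
      rw [← add_assoc] at *
      linarith
  have hlim : Tendsto (fun k : ℕ => Real.log ((N + k : ℕ) + 1)) atTop atTop := by
    refine Real.tendsto_log_atTop.comp ?_
    refine tendsto_atTop_add_const_right _ _ ?_
    refine tendsto_natCast_atTop_atTop.comp ?_
    exact tendsto_atTop_mono (fun k => Nat.le_add_left k N) tendsto_id
  obtain ⟨k, hk, hk1⟩ := ((hlim.eventually_gt_atTop
    (Real.log C + (d + 1) * Real.log (N + 1))).and (eventually_ge_atTop 1)).exists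
  have h1 := hup (N + k) (by omega)
  have h2 := hlow k
  nlinarith

theorem rAvg_nonneg {F : G → ℝ} (hF : ∀ x, 0 ≤ F x) (n : ℕ) (x : G) : 0 ≤ (rAvg S)^[n] F x := by
  rw [rAvg_iterate_eq]
  exact tsum_nonneg fun y => mul_nonneg (walk_nonneg n y) (hF _)

theorem rAvg_key {n : ℕ} {s : G} (hs : s ∈ S) (hS : S.Nonempty) (F : G → ℝ) (x : G) :
    ((rAvg S)^[n] F (x * s) - (rAvg S)^[n + 1] F x) ^ 2 ≤
      (S.card * (walkEntropy S (n + 1) - walkEntropy S n)) *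
        (2 * (S.card + 1) * (rAvg S)^[n + 1] (fun y => F y ^ 2) x) := by
  have hq : (0 : ℝ) < S.card := by exact_mod_cast hS.card_pos
  set a : G → ℝ := fun y => walk S n (s⁻¹ * y) with ha
  set b : G → ℝ := fun y => walk S (n + 1) y with hb
  set B := (finite_set_pow S.finite_toSet (n + 1)).toFinset with hB
  have hBm : ∀ y ∉ B, y ∉ (S : Set G) ^ (n + 1) := by intro y hy; simpa [hB] using hy
  have ha0 : ∀ y ∉ B, a y = 0 := fun y hy => walk_shift_eq_zero hs (hBm y hy)
  have hb0 : ∀ y ∉ B, b y = 0 := fun y hy => walk_eq_zero _ y (hBm y hy)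
  have han : ∀ y, 0 ≤ a y := fun y => walk_nonneg _ _
  have hbn : ∀ y, 0 ≤ b y := fun y => walk_nonneg _ _
  have e1 : ∀ F : G → ℝ, (rAvg S)^[n] F (x * s) = ∑ y ∈ B, a y * F (x * y) := by
    intro F
    rw [rAvg_iterate_eq, ← walk_tsum_shift, tsum_eq_sum]
    intro y hy
    rw [show walk S n (s⁻¹ * y) = 0 from ha0 y hy, zero_mul]
  have e2 : ∀ F : G → ℝ, (rAvg S)^[n + 1] F x = ∑ y ∈ B, b y * F (x * y) := by
    intro F
    rw [rAvg_iterate_eq, tsum_eq_sum]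
    intro y hy
    rw [show walk S (n + 1) y = 0 from hb0 y hy, zero_mul]
  have hcs := Finset.sum_mul_sq_le_sq_mul_sq B (fun y => √(a y) - √(b y))
    (fun y => (√(a y) + √(b y)) * F (x * y))
  have e3 : ∑ y ∈ B, (√(a y) - √(b y)) * ((√(a y) + √(b y)) * F (x * y)) =
      (rAvg S)^[n] F (x * s) - (rAvg S)^[n + 1] F x := by
    rw [e1, e2, ← Finset.sum_sub_distrib]
    refine Finset.sum_congr rfl fun y _ => ?_
    have h1 := Real.mul_self_sqrt (han y)
    have h2 := Real.mul_self_sqrt (hbn y)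
    linear_combination (h1 - h2) * F (x * y)
  rw [e3] at hcs
  refine hcs.trans ?_
  have h1 : ∑ y ∈ B, (√(a y) - √(b y)) ^ 2 ≤
      S.card * (walkEntropy S (n + 1) - walkEntropy S n) := by
    refine le_trans ?_ (hellinger_le_entropy hS n)
    have e4 : ∑ y ∈ B, (√(a y) - √(b y)) ^ 2 = ∑' y, (√(a y) - √(b y)) ^ 2 := by
      rw [tsum_eq_sum (s := B)]
      intro y hy
      rw [ha0 y hy, hb0 y hy]; simp
    rw [e4]
    exact Finset.single_le_sum
      (f := fun s => ∑' y, (√(walk S n (s⁻¹ * y)) - √(walk S (n + 1) y)) ^ 2)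
      (fun _ _ => tsum_nonneg fun _ => sq_nonneg _) hs
  have h2 : ∑ y ∈ B, ((√(a y) + √(b y)) * F (x * y)) ^ 2 ≤
      2 * (S.card + 1) * (rAvg S)^[n + 1] (fun y => F y ^ 2) x := by
    have h3 : ∑ y ∈ B, ((√(a y) + √(b y)) * F (x * y)) ^ 2 ≤
        2 * ((rAvg S)^[n] (fun y => F y ^ 2) (x * s) + (rAvg S)^[n + 1] (fun y => F y ^ 2) x) := by
      rw [e1, e2, ← Finset.sum_add_distrib, Finset.mul_sum]
      refine Finset.sum_le_sum fun y _ => ?_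
      rw [mul_pow]
      have h4 : (√(a y) + √(b y)) ^ 2 ≤ 2 * (a y + b y) := by
        have h5 := Real.sq_sqrt (han y)
        have h6 := Real.sq_sqrt (hbn y)
        nlinarith [sq_nonneg (√(a y) - √(b y))]
      nlinarith [sq_nonneg (F (x * y))]
    have h5 : (rAvg S)^[n] (fun y => F y ^ 2) (x * s) ≤
        S.card * (rAvg S)^[n + 1] (fun y => F y ^ 2) x := by
      rw [Function.iterate_succ_apply', rAvg, mul_inv_cancel_left₀ hq.ne']
      exact Finset.single_le_sum (f := fun s => (rAvg S)^[n] (fun y => F y ^ 2) (x * s))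
        (fun _ _ => rAvg_nonneg (fun _ => sq_nonneg _) _ _) hs
    linarith
  exact mul_le_mul h1 h2 (Finset.sum_nonneg fun _ _ => sq_nonneg _)
    ((Finset.sum_nonneg fun _ _ => sq_nonneg _).trans h1)

/-- A regularity estimate for the random walk along a sequence of good times. -/
theorem exists_good_times {d : ℕ} (hG : GrowthLE G d) (hS : S.Nonempty) :
    ∃ (A : ℝ) (τ : ℕ → ℕ), 0 < A ∧ (∀ j, j ≤ τ j) ∧ ∀ (j : ℕ) (F : G → ℝ) (x : G), ∀ s ∈ S,
      ((rAvg S)^[τ j] F (x * s) - (rAvg S)^[τ j + 1] F x) ^ 2 ≤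
        A * ((rAvg S)^[τ j + 1] (fun y => F y ^ 2) x / ((τ j : ℝ) + 1)) := by
  have hq : (0 : ℝ) < S.card := by exact_mod_cast hS.card_pos
  choose τ hτ hτ' using exists_small_entropy_increment hG hS
  refine ⟨S.card * (d + 1) * (2 * (S.card + 1)), τ, by positivity, hτ, fun j F x s hs => ?_⟩
  refine (rAvg_key hs hS F x).trans ?_
  have h0 := rAvg_nonneg (S := S) (F := fun y => F y ^ 2) (fun _ => sq_nonneg _) (τ j + 1) x
  calc _ ≤ (S.card * ((d + 1) / ((τ j : ℝ) + 1))) *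
        (2 * (S.card + 1) * (rAvg S)^[τ j + 1] (fun y => F y ^ 2) x) := by
        have := hτ' j
        gcongr
    _ = _ := by ring

end Entropy

section Carre
open scoped Pointwise Classical

variable {G : Type*} [Group G] {S : Finset G}

/-- The averaging operator as a linear map. -/
noncomputable def rAvgLin (S : Finset G) : (G → ℝ) →ₗ[ℝ] (G → ℝ) where
  toFun := rAvg S
  map_add' f g := by
    ext x; simp only [rAvg, Pi.add_apply, Finset.sum_add_distrib, mul_add]
  map_smul' c f := by
    ext x
    simp only [rAvg, Pi.smul_apply, smul_eq_mul, ← Finset.mul_sum, RingHom.id_apply]; ring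

theorem rAvgLin_pow (n : ℕ) (f : G → ℝ) : (rAvgLin S ^ n) f = (rAvg S)^[n] f := by
  rw [Module.End.pow_apply]; rfl

theorem rAvg_iterate_add (n : ℕ) (f g : G → ℝ) :
    (rAvg S)^[n] (f + g) = (rAvg S)^[n] f + (rAvg S)^[n] g := by
  simp only [← rAvgLin_pow, map_add]

theorem rAvg_iterate_sub (n : ℕ) (f g : G → ℝ) :
    (rAvg S)^[n] (f - g) = (rAvg S)^[n] f - (rAvg S)^[n] g := by
  simp only [← rAvgLin_pow, map_sub]

theorem rAvg_iterate_smul (n : ℕ) (c : ℝ) (f : G → ℝ) :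
    (rAvg S)^[n] (c • f) = c • (rAvg S)^[n] f := by
  simp only [← rAvgLin_pow, map_smul]

theorem rAvg_iterate_mono (n : ℕ) {f g : G → ℝ} (h : ∀ x, f x ≤ g x) (x : G) :
    (rAvg S)^[n] f x ≤ (rAvg S)^[n] g x := by
  have := rAvg_nonneg (S := S) (F := g - f) (fun y => by simp [h y]) n x
  rw [rAvg_iterate_sub] at this
  simpa using this

theorem rAvg_iterate_abs_le (hS : S.Nonempty) (n : ℕ) {f : G → ℝ} {M : ℝ} (h : ∀ x, |f x| ≤ M)
    (x : G) : |(rAvg S)^[n] f x| ≤ M := by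
  rw [abs_le]
  constructor
  · have := rAvg_iterate_mono (S := S) n (f := fun _ => -M) (g := f) (fun x => (abs_le.1 (h x)).1) x
    rwa [rAvg_iterate_const hS] at this
  · have := rAvg_iterate_mono (S := S) n (f := f) (g := fun _ => M) (fun x => (abs_le.1 (h x)).2) x
    rwa [rAvg_iterate_const hS] at this

theorem rAvg_iterate_translate (n : ℕ) (g : G) (f : G → ℝ) (x : G) :
    (rAvg S)^[n] (fun y => f (g * y)) x = (rAvg S)^[n] f (g * x) := by
  simp only [rAvg_iterate_eq, mul_assoc]

theorem rAvg_lipHarm (hS : S.Nonempty) {f : G → ℝ} (hf : f ∈ lipHarm S) : rAvg S f = f := by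
  have hq : (0 : ℝ) < S.card := by exact_mod_cast hS.card_pos
  ext x
  have := hf.2.2 x
  rw [Finset.sum_sub_distrib, Finset.sum_const, nsmul_eq_mul, sub_eq_zero] at this
  rw [rAvg, this, inv_mul_cancel_left₀ hq.ne']

theorem rAvg_iterate_fixed {f : G → ℝ} (h : rAvg S f = f) (n : ℕ) : (rAvg S)^[n] f = f :=
  Function.iterate_fixed h n

/-- The energy form averaged up to time `n`. -/
noncomputable def carre (S : Finset G) (n : ℕ) (f g : G → ℝ) (x : G) : ℝ :=
  ((rAvg S)^[n] (f * g) x - f x * g x) / n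

theorem carre_comm (n : ℕ) (f g : G → ℝ) : carre S n f g = carre S n g f := by
  ext x; simp only [carre, mul_comm]

theorem carre_add (n : ℕ) (f f' g : G → ℝ) :
    carre S n (f + f') g = carre S n f g + carre S n f' g := by
  ext x
  simp only [carre, add_mul, rAvg_iterate_add, Pi.add_apply]
  ring

theorem carre_smul (n : ℕ) (c : ℝ) (f g : G → ℝ) :
    carre S n (c • f) g = c • carre S n f g := by
  ext x
  simp only [carre, smul_mul_assoc, rAvg_iterate_smul, Pi.smul_apply, smul_eq_mul]
  ring

theorem carre_translate (n : ℕ) (a : G) (f g : G → ℝ) (x : G) :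
    carre S n (fun y => f (a * y)) (fun y => g (a * y)) x = carre S n f g (a * x) := by
  simp only [carre]
  rw [← rAvg_iterate_translate n a (f * g)]
  rfl

theorem carre_add_const (hS : S.Nonempty) {f g : G → ℝ} (hf : rAvg S f = f) (hg : rAvg S g = g)
    (n : ℕ) (c c' : ℝ) :
    carre S n (fun y => f y + c) (fun y => g y + c') = carre S n f g := by
  ext x
  simp only [carre]
  have : ((fun y => f y + c) * (fun y => g y + c')) =
      f * g + (c' • f + (c • g + fun _ => c * c')) := by
    ext y; simp; ring
  rw [this, rAvg_iterate_add, rAvg_iterate_add, rAvg_iterate_add, rAvg_iterate_smul,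
    rAvg_iterate_smul, rAvg_iterate_fixed hf, rAvg_iterate_fixed hg, rAvg_iterate_const hS]
  simp only [Pi.add_apply, Pi.smul_apply, smul_eq_mul]
  ring

/-- The infinitesimal energy form. -/
noncomputable def gam (S : Finset G) (f g : G → ℝ) (x : G) : ℝ :=
  (S.card : ℝ)⁻¹ * ∑ s ∈ S, (f (x * s) - f x) * (g (x * s) - g x)

theorem gam_eq (hS : S.Nonempty) {f g : G → ℝ} (hf : rAvg S f = f) (hg : rAvg S g = g) :
    gam S f g = rAvg S (f * g) - f * g := by
  have hq : (0 : ℝ) < S.card := by exact_mod_cast hS.card_pos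
  ext x
  have h1 : ∑ s ∈ S, f (x * s) = S.card * f x := by
    conv_rhs => rw [← hf, rAvg, mul_inv_cancel_left₀ hq.ne']
  have h2 : ∑ s ∈ S, g (x * s) = S.card * g x := by
    conv_rhs => rw [← hg, rAvg, mul_inv_cancel_left₀ hq.ne']
  simp only [gam, rAvg, Pi.sub_apply, Pi.mul_apply]
  have : ∑ s ∈ S, (f (x * s) - f x) * (g (x * s) - g x) =
      ∑ s ∈ S, f (x * s) * g (x * s) - (∑ s ∈ S, f (x * s)) * g x - f x * (∑ s ∈ S, g (x * s)) +
        S.card * (f x * g x) := by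
    rw [Finset.sum_mul, Finset.mul_sum, ← Finset.sum_sub_distrib, ← Finset.sum_sub_distrib,
      ← nsmul_eq_mul, ← Finset.sum_const, ← Finset.sum_add_distrib]
    exact Finset.sum_congr rfl fun s _ => by ring
  rw [this, h1, h2]
  field_simp
  ring

theorem gam_abs_le (hS : S.Nonempty) {f g : G → ℝ} {C D : ℝ}
    (hf : ∀ x, ∀ s ∈ S, |f (x * s) - f x| ≤ C) (hg : ∀ x, ∀ s ∈ S, |g (x * s) - g x| ≤ D) (x : G) :
    |gam S f g x| ≤ C * D := by
  have hq : (0 : ℝ) < S.card := by exact_mod_cast hS.card_pos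
  rw [gam, abs_mul, abs_of_pos (inv_pos.2 hq), inv_mul_le_iff₀ hq, ← nsmul_eq_mul,
    ← Finset.sum_const]
  refine (Finset.abs_sum_le_sum_abs _ _).trans (Finset.sum_le_sum fun s hs => ?_)
  rw [abs_mul]
  have := abs_nonneg (f (x * s) - f x)
  exact mul_le_mul (hf x s hs) (hg x s hs) (abs_nonneg _) (this.trans (hf x s hs))

theorem rAvg_iterate_sub_eq_sum (n : ℕ) (h : G → ℝ) :
    (rAvg S)^[n] h - h = ∑ k ∈ Finset.range n, (rAvg S)^[k] (rAvg S h - h) := by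
  induction n with
  | zero => simp
  | succ n ih =>
    rw [Finset.sum_range_succ, ← ih, rAvg_iterate_sub, ← Function.iterate_succ_apply]
    abel

theorem carre_eq_sum (hS : S.Nonempty) {f g : G → ℝ} (hf : rAvg S f = f) (hg : rAvg S g = g)
    (n : ℕ) (x : G) :
    carre S n f g x = (∑ k ∈ Finset.range n, (rAvg S)^[k] (gam S f g) x) / n := by
  rw [carre, gam_eq hS hf hg, ← Finset.sum_apply, ← rAvg_iterate_sub_eq_sum]
  rfl

theorem carre_abs_le (hS : S.Nonempty) {f g : G → ℝ} (hf : rAvg S f = f) (hg : rAvg S g = g)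
    {M : ℝ} (hM : ∀ x, |gam S f g x| ≤ M) {n : ℕ} (hn : 0 < n) (x : G) : |carre S n f g x| ≤ M := by
  have hn' : (0 : ℝ) < n := by exact_mod_cast hn
  rw [carre_eq_sum hS hf hg, abs_div, abs_of_pos hn', div_le_iff₀ hn']
  refine (Finset.abs_sum_le_sum_abs _ _).trans ?_
  refine (Finset.sum_le_sum fun k _ => rAvg_iterate_abs_le hS k hM x).trans ?_
  simp [mul_comm]

theorem carre_self_le (hS : S.Nonempty) {ι : Type*} (I : Finset ι) {f : ι → G → ℝ}
    (hf : ∀ i ∈ I, rAvg S (f i) = f i) {M : ℝ} (hM : ∀ x, ∑ i ∈ I, gam S (f i) (f i) x ≤ M)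
    {n : ℕ} (hn : 0 < n) (x : G) : ∑ i ∈ I, carre S n (f i) (f i) x ≤ M := by
  have hn' : (0 : ℝ) < n := by exact_mod_cast hn
  rw [Finset.sum_congr rfl fun i hi => carre_eq_sum hS (hf i hi) (hf i hi) n x, ← Finset.sum_div,
    div_le_iff₀ hn', Finset.sum_comm]
  have : ∀ k ∈ Finset.range n, ∑ i ∈ I, (rAvg S)^[k] (gam S (f i) (f i)) x ≤ M := by
    intro k _
    have h1 : ∑ i ∈ I, (rAvg S)^[k] (gam S (f i) (f i)) x =
        (rAvg S)^[k] (∑ i ∈ I, gam S (f i) (f i)) x := by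
      simp only [← rAvgLin_pow, map_sum, Finset.sum_apply]
    rw [h1]
    have h2 := rAvg_iterate_mono (S := S) k (f := ∑ i ∈ I, gam S (f i) (f i)) (g := fun _ => M)
      (fun x => by simpa using hM x) x
    rwa [rAvg_iterate_const hS] at h2
  refine (Finset.sum_le_sum this).trans ?_
  simp [mul_comm]

theorem rAvg_carre_sub (hS : S.Nonempty) {f g : G → ℝ} (hf : rAvg S f = f) (hg : rAvg S g = g)
    {M : ℝ} (hM : ∀ x, |gam S f g x| ≤ M) {n : ℕ} (hn : 0 < n) (x : G) :
    |rAvg S (carre S n f g) x - carre S n f g x| ≤ 2 * M / n := by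
  have hn' : (0 : ℝ) < n := by exact_mod_cast hn
  have h1 : carre S n f g = (n : ℝ)⁻¹ • ((rAvg S)^[n] (f * g) - f * g) := by
    ext x; simp [carre, div_eq_inv_mul]
  have h2 : rAvg S (carre S n f g) x - carre S n f g x =
      ((rAvg S)^[n] (gam S f g) x - gam S f g x) / n := by
    have h3 : rAvg S (carre S n f g) =
        (n : ℝ)⁻¹ • ((rAvg S)^[n] (rAvg S (f * g)) - rAvg S (f * g)) := by
      rw [h1]
      have := rAvg_iterate_smul (S := S) 1 (n : ℝ)⁻¹ ((rAvg S)^[n] (f * g) - f * g)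
      rw [rAvg_iterate_sub] at this
      simp only [Function.iterate_one] at this
      rw [this, ← Function.iterate_succ_apply' (rAvg S), Function.iterate_succ_apply]
    rw [h3, h1, gam_eq hS hf hg, rAvg_iterate_sub]
    simp only [Pi.smul_apply, Pi.sub_apply, smul_eq_mul]
    field_simp
    ring
  rw [h2, abs_div, abs_of_pos hn', div_le_div_iff_of_pos_right hn']
  have h4 := rAvg_iterate_abs_le hS n hM x
  have h5 := abs_sub ((rAvg S)^[n] (gam S f g) x) (gam S f g x)
  linarith [hM x]

theorem carre_self_eq (hS : S.Nonempty) {f : G → ℝ} (hf : rAvg S f = f) (n : ℕ) (x : G) :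
    carre S n f f x = (rAvg S)^[n] (fun y => (f y - f x) ^ 2) x / n := by
  have : (fun y => (f y - f x) ^ 2) = f * f + ((-2 * f x) • f + fun _ => f x ^ 2) := by
    ext y; simp; ring
  rw [this, rAvg_iterate_add, rAvg_iterate_add, rAvg_iterate_smul, rAvg_iterate_fixed hf,
    rAvg_iterate_const hS, carre]
  simp only [Pi.add_apply, Pi.smul_apply, smul_eq_mul]
  congr 1; ring

/-- The limit of the energy forms along the times `τ j + 1`. -/
noncomputable def limForm (S : Finset G) (τ : ℕ → ℕ) (f g : G → ℝ) (x : G) : ℝ :=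
  limUnder (hyperfilter ℕ : Filter ℕ) (fun j => carre S (τ j + 1) f g x)

theorem exists_gam_bound (hS : S.Nonempty) {f g : G → ℝ} (hf : f ∈ lipHarm S)
    (hg : g ∈ lipHarm S) : ∃ M, 0 ≤ M ∧ ∀ x, |gam S f g x| ≤ M := by
  obtain ⟨C, hC⟩ := hf.2.1
  obtain ⟨D, hD⟩ := hg.2.1
  exact ⟨C * D, (abs_nonneg _).trans (gam_abs_le hS hC hD 1), gam_abs_le hS hC hD⟩

variable {τ : ℕ → ℕ}

theorem tendsto_limForm (hS : S.Nonempty) {f g : G → ℝ} (hf : f ∈ lipHarm S)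
    (hg : g ∈ lipHarm S) (x : G) :
    Tendsto (fun j => carre S (τ j + 1) f g x) (hyperfilter ℕ : Filter ℕ)
      (nhds (limForm S τ f g x)) := by
  obtain ⟨M, _, hM⟩ := exists_gam_bound hS hf hg
  exact tendsto_nhds_limUnder (exists_tendsto_hyperfilter _ M fun j =>
    carre_abs_le hS (rAvg_lipHarm hS hf) (rAvg_lipHarm hS hg) hM (Nat.succ_pos _) x)

/-- The property of the good times provided by the entropy argument. -/
def GoodTimes (S : Finset G) (A : ℝ) (τ : ℕ → ℕ) : Prop :=
  0 < A ∧ (∀ j, j ≤ τ j) ∧ ∀ (j : ℕ) (F : G → ℝ) (x : G), ∀ s ∈ S,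
      ((rAvg S)^[τ j] F (x * s) - (rAvg S)^[τ j + 1] F x) ^ 2 ≤
        A * ((rAvg S)^[τ j + 1] (fun y => F y ^ 2) x / ((τ j : ℝ) + 1))

theorem tendsto_div_times {A : ℝ} (h : GoodTimes S A τ) (c : ℝ) :
    Tendsto (fun j => c / ((τ j : ℝ) + 1)) (hyperfilter ℕ : Filter ℕ) (nhds 0) := by
  refine tendsto_hyperfilter_of_atTop ?_
  refine Tendsto.div_atTop tendsto_const_nhds (tendsto_atTop_add_const_right _ _ ?_)
  exact tendsto_natCast_atTop_atTop.comp (tendsto_atTop_mono h.2.1 tendsto_id)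

theorem eq_of_right_mul_eq (hS : IsSymGen (S : Set G)) {F : G → ℝ}
    (h : ∀ x, ∀ s ∈ S, F (x * s) = F x) (x : G) : F x = F 1 := by
  obtain ⟨n, hn⟩ := hS.exists_mem_pow x
  have := lipschitz_pow (S := S) (f := F) (C := 0) (fun x s hs => by rw [h x s hs]; simp) n 1 x hn
  rw [mul_zero, one_mul] at this
  exact sub_eq_zero.1 (abs_nonpos_iff.1 this)

theorem bounded_harmonic_const {A : ℝ} (h : GoodTimes S A τ) (hS : IsSymGen (S : Set G))
    {F : G → ℝ} (hF : rAvg S F = F) {M : ℝ} (hM : ∀ x, |F x| ≤ M) (x : G) : F x = F 1 := by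
  have hne : S.Nonempty := ⟨1, hS.one_mem⟩
  refine eq_of_right_mul_eq hS (fun x s hs => ?_) x
  have h1 : ∀ j, (F (x * s) - F x) ^ 2 ≤ (A * M ^ 2) / ((τ j : ℝ) + 1) := by
    intro j
    have := h.2.2 j F x s hs
    rw [rAvg_iterate_fixed hF, rAvg_iterate_fixed hF] at this
    refine this.trans ?_
    rw [mul_div_assoc]
    have h2 := rAvg_iterate_mono (S := S) (τ j + 1) (f := fun y => F y ^ 2) (g := fun _ => M ^ 2)
      (fun y => sq_le_sq' (abs_le.1 (hM y)).1 (abs_le.1 (hM y)).2) x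
    rw [rAvg_iterate_const hne] at h2
    have := h.1
    gcongr
  have h3 := ge_of_tendsto (tendsto_div_times h (A * M ^ 2)) (Filter.Eventually.of_forall h1)
  have h4 : (F (x * s) - F x) ^ 2 = 0 := le_antisymm h3 (sq_nonneg _)
  exact sub_eq_zero.1 (pow_eq_zero_iff (two_ne_zero) |>.1 h4)

theorem limForm_const {A : ℝ} (h : GoodTimes S A τ) (hS : IsSymGen (S : Set G)) {f g : G → ℝ}
    (hf : f ∈ lipHarm S) (hg : g ∈ lipHarm S) (x : G) : limForm S τ f g x = limForm S τ f g 1 := by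
  have hne : S.Nonempty := ⟨1, hS.one_mem⟩
  have hf' := rAvg_lipHarm hne hf
  have hg' := rAvg_lipHarm hne hg
  obtain ⟨M, hM0, hM⟩ := exists_gam_bound hne hf hg
  have hlim := fun x => tendsto_limForm (τ := τ) hne hf hg x
  refine bounded_harmonic_const h hS (F := limForm S τ f g) (M := M) ?_ (fun x => ?_) x
  · ext x
    have t1 : Tendsto (fun j => rAvg S (carre S (τ j + 1) f g) x) (hyperfilter ℕ : Filter ℕ)
        (nhds (rAvg S (limForm S τ f g) x)) :=
      (tendsto_finsetSum _ fun s _ => hlim (x * s)).const_mul _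
    have t2 := t1.sub (hlim x)
    have t3 : Tendsto (fun j => rAvg S (carre S (τ j + 1) f g) x - carre S (τ j + 1) f g x)
        (hyperfilter ℕ : Filter ℕ) (nhds 0) := by
      refine squeeze_zero_norm (fun j => ?_) (tendsto_div_times h (2 * M))
      have := rAvg_carre_sub hne hf' hg' hM (Nat.succ_pos (τ j)) x
      simpa using this
    exact sub_eq_zero.1 (tendsto_nhds_unique t2 t3)
  · exact le_of_tendsto (hlim x).abs (Filter.Eventually.of_forall fun j =>
      carre_abs_le hne hf' hg' hM (Nat.succ_pos _) x)

theorem sq_sub_le_limForm {A : ℝ} (h : GoodTimes S A τ) (hS : IsSymGen (S : Set G)) {f : G → ℝ}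
    (hf : f ∈ lipHarm S) (x : G) {s : G} (hs : s ∈ S) :
    (f (x * s) - f x) ^ 2 ≤ A * limForm S τ f f 1 := by
  have hne : S.Nonempty := ⟨1, hS.one_mem⟩
  have hf' := rAvg_lipHarm hne hf
  rw [← limForm_const h hS hf hf x]
  refine ge_of_tendsto ((tendsto_limForm (τ := τ) hne hf hf x).const_mul A)
    (Filter.Eventually.of_forall fun j => ?_)
  have h1 := h.2.2 j (fun y => f y - f x) x s hs
  have h2 : rAvg S (fun y => f y - f x) = fun y => f y - f x := by
    have := rAvg_iterate_sub (S := S) 1 f (fun _ => f x)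
    simp only [Function.iterate_one] at this
    rw [hf', rAvg_const hne] at this
    exact this
  rw [rAvg_iterate_fixed h2, rAvg_iterate_fixed h2] at h1
  beta_reduce at h1
  rw [sub_self, sub_zero] at h1
  rw [carre_self_eq hne hf']
  push_cast
  exact h1

/-- The action of the group on the Lipschitz harmonic functions. -/
def harmAct (S : Finset G) (a : G) : lipHarm S →ₗ[ℝ] lipHarm S where
  toFun f := ⟨fun y => (f : G → ℝ) (a⁻¹ * y) + -(f : G → ℝ) a⁻¹, by
    refine ⟨by simp, ?_, fun x => ?_⟩
    · obtain ⟨C, hC⟩ := f.2.2.1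
      refine ⟨C, fun x s hs => ?_⟩
      have := hC (a⁻¹ * x) s hs
      rw [mul_assoc] at this
      simpa using this
    · have := f.2.2.2 (a⁻¹ * x)
      simpa [mul_assoc] using this⟩
  map_add' f g := by ext y; simp; ring
  map_smul' c f := by ext y; simp; ring

theorem limForm_harmAct {A : ℝ} (h : GoodTimes S A τ) (hS : IsSymGen (S : Set G)) (a : G)
    (f g : lipHarm S) :
    limForm S τ (harmAct S a f : lipHarm S) (harmAct S a g : lipHarm S) 1 =
      limForm S τ f g 1 := by
  have hne : S.Nonempty := ⟨1, hS.one_mem⟩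
  rw [← limForm_const h hS f.2 g.2 (a⁻¹ * 1)]
  simp only [limForm]
  congr 1
  ext j
  rw [← carre_translate]
  refine congrFun (carre_add_const hne ?_ ?_ _ _ _) 1
  · ext x
    have := rAvg_iterate_translate (S := S) 1 a⁻¹ f x
    rw [Function.iterate_one, rAvg_lipHarm hne f.2] at this
    exact this
  · ext x
    have := rAvg_iterate_translate (S := S) 1 a⁻¹ g x
    rw [Function.iterate_one, rAvg_lipHarm hne g.2] at this
    exact this

/-- The limit form as an inner product on the Lipschitz harmonic functions. -/
@[reducible]
noncomputable def harmCore {A : ℝ} (h : GoodTimes S A τ) (hS : IsSymGen (S : Set G)) :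
    InnerProductSpace.Core ℝ (lipHarm S) where
  inner f g := limForm S τ f g 1
  conj_inner_symm f g := by
    simp only [limForm, carre_comm _ (g : G → ℝ) f]
    rfl
  re_inner_nonneg f := by
    have h1 := sq_sub_le_limForm h hS f.2 1 hS.one_mem
    have h2 := h.1
    have : 0 ≤ A * limForm S τ f f 1 := (sq_nonneg _).trans h1
    exact nonneg_of_mul_nonneg_right this h2
  add_left f g k := by
    have hne : S.Nonempty := ⟨1, hS.one_mem⟩
    have h1 := (tendsto_limForm (τ := τ) hne f.2 k.2 1).add (tendsto_limForm (τ := τ) hne g.2 k.2 1)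
    refine tendsto_nhds_unique (tendsto_limForm (τ := τ) hne (f + g).2 k.2 1) ?_
    refine h1.congr fun j => ?_
    rw [Submodule.coe_add, carre_add, Pi.add_apply]
  smul_left f g r := by
    have hne : S.Nonempty := ⟨1, hS.one_mem⟩
    have h1 := (tendsto_limForm (τ := τ) hne f.2 g.2 1).const_mul r
    refine tendsto_nhds_unique (tendsto_limForm (τ := τ) hne (r • f).2 g.2 1) ?_
    refine h1.congr fun j => ?_
    rw [Submodule.coe_smul, carre_smul, Pi.smul_apply, smul_eq_mul]
  definite f hf := by
    ext x
    have h1 : ∀ x, ∀ s ∈ S, (f : G → ℝ) (x * s) = (f : G → ℝ) x := by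
      intro x s hs
      have := sq_sub_le_limForm h hS f.2 x hs
      rw [show limForm S τ f f 1 = 0 from hf, mul_zero] at this
      exact sub_eq_zero.1 (pow_eq_zero_iff (two_ne_zero) |>.1 (le_antisymm this (sq_nonneg _)))
    rw [eq_of_right_mul_eq hS h1 x, f.2.1]
    rfl

end Carre

section FinDim
open scoped Pointwise Classical

variable {G : Type*} [Group G] {S : Finset G} {τ : ℕ → ℕ}

theorem card_le_of_orthonormal {A : ℝ} (h : GoodTimes S A τ) (hS : IsSymGen (S : Set G)) {m : ℕ}
    (f : Fin m → lipHarm S)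
    (hf : ∀ i j, limForm S τ (f i) (f j) 1 = if i = j then 1 else 0) : (m : ℝ) ≤ A := by
  have hne : S.Nonempty := ⟨1, hS.one_mem⟩
  have hq : (0 : ℝ) < S.card := by exact_mod_cast hne.card_pos
  have hA := h.1
  have key : ∀ x, ∀ s ∈ S, ∑ i, ((f i : G → ℝ) (x * s) - (f i : G → ℝ) x) ^ 2 ≤ A := by
    intro x s hs
    set c : Fin m → ℝ := fun i => (f i : G → ℝ) (x * s) - (f i : G → ℝ) x with hc
    have h1 := sq_sub_le_limForm h hS (∑ i, c i • f i).2 x hs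
    have h2 : limForm S τ (∑ i, c i • f i : lipHarm S) (∑ i, c i • f i : lipHarm S) 1 =
        ∑ i, c i ^ 2 := by
      let := (harmCore h hS).toNormedAddCommGroup
      let : InnerProductSpace ℝ (lipHarm S) := InnerProductSpace.ofCore (harmCore h hS).toCore
      have h3 : Orthonormal ℝ f := by
        rw [orthonormal_iff_ite]
        exact hf
      have h4 := h3.inner_sum c c Finset.univ
      calc _ = inner ℝ (∑ i, c i • f i) (∑ i, c i • f i) := rfl
        _ = _ := h4
        _ = _ := by simp [sq]
    have h3 : ((∑ i, c i • f i : lipHarm S) : G → ℝ) (x * s) -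
        ((∑ i, c i • f i : lipHarm S) : G → ℝ) x = ∑ i, c i ^ 2 := by
      simp only [AddSubmonoidClass.coe_finsetSum, Submodule.coe_smul, Finset.sum_apply,
        Pi.smul_apply, smul_eq_mul, ← Finset.sum_sub_distrib]
      refine Finset.sum_congr rfl fun i _ => ?_
      simp only [hc]; ring
    rw [h2, h3] at h1
    by_contra hlt
    push Not at hlt
    change A < ∑ i, c i ^ 2 at hlt
    nlinarith
  have hgam : ∀ x, ∑ i, gam S (f i) (f i) x ≤ A := by
    intro x
    simp only [gam, ← Finset.mul_sum]
    rw [Finset.sum_comm, inv_mul_le_iff₀ hq]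
    calc _ ≤ ∑ s ∈ S, A := Finset.sum_le_sum fun s hs => by
          simpa only [sq] using key x s hs
      _ = _ := by simp
  have hlim : Tendsto (fun j => ∑ i, carre S (τ j + 1) (f i) (f i) 1)
      (hyperfilter ℕ : Filter ℕ) (nhds (∑ i, limForm S τ (f i) (f i) 1)) :=
    tendsto_finsetSum _ fun i _ => tendsto_limForm hne (f i).2 (f i).2 1
  have := le_of_tendsto hlim (Filter.Eventually.of_forall fun j =>
    carre_self_le hne Finset.univ (fun i _ => rAvg_lipHarm hne (f i).2) hgam (Nat.succ_pos _) 1)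
  simpa [hf] using this

theorem finiteDimensional_lipHarm {A : ℝ} (h : GoodTimes S A τ) (hS : IsSymGen (S : Set G)) :
    FiniteDimensional ℝ (lipHarm S) := by
  let := (harmCore h hS).toNormedAddCommGroup
  let : InnerProductSpace ℝ (lipHarm S) := InnerProductSpace.ofCore (harmCore h hS).toCore
  have : Module.rank ℝ (lipHarm S) ≤ (⌊A⌋₊ : ℕ) := by
    refine rank_le fun T hT => Nat.le_floor ?_
    have e := T.equivFin
    have hT' := hT.comp e.symm e.symm.injective
    have ho := InnerProductSpace.gramSchmidtNormed_orthonormal hT'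
    rw [orthonormal_iff_ite] at ho
    exact card_le_of_orthonormal h hS _ ho
  exact Module.rank_lt_aleph0_iff.1 (this.trans_lt (Cardinal.natCast_lt_aleph0))

theorem harmAct_mul (a b : G) (f : lipHarm S) : harmAct S (a * b) f = harmAct S a (harmAct S b f) := by
  ext y
  simp [harmAct, mul_assoc]

theorem harmAct_one (f : lipHarm S) : harmAct S 1 f = f := by
  ext y
  have := f.2.1
  simp [harmAct, this]

theorem infinite_range_of_lipHarm (hS : IsSymGen (S : Set G)) {f : G → ℝ} (hf : f ∈ lipHarm S)
    (h0 : f ≠ 0) : (Set.range f).Infinite := by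
  intro hfin
  have hne : S.Nonempty := ⟨1, hS.one_mem⟩
  obtain ⟨_, ⟨x, rfl⟩, hx⟩ := hfin.exists_maximalFor id _ (Set.range_nonempty f)
  have hmax : ∀ y, f y ≤ f x := fun y => by
    by_contra hlt
    push Not at hlt
    exact absurd (hx ⟨y, rfl⟩ hlt.le) (not_le.2 hlt)
  have h1 : ∀ y, f y = f x → ∀ s ∈ S, f (y * s) = f x := by
    intro y hy s hs
    have h2 := hf.2.2 y
    rw [Finset.sum_eq_zero_iff_of_nonpos (fun s _ => by linarith [hmax (y * s)])] at h2
    linarith [h2 s hs]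
  have h2 : ∀ n : ℕ, ∀ y ∈ (S : Set G) ^ n, f (x * y) = f x := by
    intro n
    induction n with
    | zero => intro y hy; rw [pow_zero, Set.mem_one] at hy; simp [hy]
    | succ n ih =>
      intro y hy
      rw [pow_succ] at hy
      obtain ⟨u, hu, s, hs, rfl⟩ := hy
      rw [← mul_assoc]
      exact h1 _ (ih u hu) s hs
  have h3 : ∀ y, f y = f x := fun y => by
    obtain ⟨n, hn⟩ := hS.exists_mem_pow (x⁻¹ * y)
    simpa using h2 n _ hn
  apply h0
  ext y
  rw [h3 y, ← h3 1, hf.1]; rfl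

/-- An infinite finitely generated group of polynomial growth has an orthogonal representation on
a finite-dimensional space together with an unbounded affine cocycle structure. -/
theorem GrowthLE.exists_rep [Infinite G] [Group.FG G] {d : ℕ} (hG : GrowthLE G d) :
    ∃ (n : ℕ) (ρ : G →* (EuclideanSpace ℝ (Fin n) ≃ₗᵢ[ℝ] EuclideanSpace ℝ (Fin n)))
      (ev : EuclideanSpace ℝ (Fin n) →ₗ[ℝ] (G → ℝ)), (∃ v, (Set.range (ev v)).Infinite) ∧
      ∀ v x y, ev v (x * y) = ev v x + ev (ρ x⁻¹ v) y := by
  obtain ⟨S', hS'⟩ := exists_isSymGen G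
  obtain ⟨S, rfl⟩ : ∃ S : Finset G, (S : Set G) = S' := ⟨hS'.finite.toFinset, by simp⟩
  have hne : S.Nonempty := ⟨1, hS'.one_mem⟩
  obtain ⟨A, τ, h1, h2, h3⟩ := exists_good_times hG hne
  have h : GoodTimes S A τ := ⟨h1, h2, h3⟩
  have hfd := finiteDimensional_lipHarm h hS'
  obtain ⟨f, hf, hf0⟩ := exists_lipHarm_ne_zero hG hS'
  let := (harmCore h hS').toNormedAddCommGroup
  let : InnerProductSpace ℝ (lipHarm S) := InnerProductSpace.ofCore (harmCore h hS').toCore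
  let e := (stdOrthonormalBasis ℝ (lipHarm S)).repr
  let r : G → (lipHarm S ≃ₗᵢ[ℝ] lipHarm S) := fun a =>
    { toLinearEquiv := LinearEquiv.ofLinearMap (harmAct S a) (harmAct S a⁻¹)
        (by ext1 f; simp [← harmAct_mul, harmAct_one]) (by ext1 f; simp [← harmAct_mul, harmAct_one])
      norm_map' := fun f => by
        have h4 : inner ℝ (harmAct S a f) (harmAct S a f) = inner ℝ f f :=
          limForm_harmAct h hS' a f f
        rw [real_inner_self_eq_norm_sq, real_inner_self_eq_norm_sq] at h4
        exact (sq_eq_sq₀ (norm_nonneg _) (norm_nonneg _)).1 h4 }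
  have hr : ∀ a f, r a f = harmAct S a f := fun a f => rfl
  refine ⟨Module.finrank ℝ (lipHarm S),
    { toFun := fun a => (e.symm.trans (r a)).trans e
      map_one' := ?_
      map_mul' := ?_ },
    (lipHarm S).subtype ∘ₗ e.symm.toLinearEquiv.toLinearMap, ⟨e ⟨f, hf⟩, ?_⟩, ?_⟩
  · ext1 v
    simp [hr, harmAct_one]
  · intro a b
    ext1 v
    simp [hr, harmAct_mul]
  · simpa using infinite_range_of_lipHarm hS' hf hf0
  · intro v x y
    simp [hr, harmAct]

end FinDim

section IsomDisp
open scoped commutatorElement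

variable {V : Type*} [NormedAddCommGroup V] [InnerProductSpace ℝ V]

/-- A linear isometry as a continuous linear map. -/
noncomputable def isomCLM (a : V ≃ₗᵢ[ℝ] V) : V →L[ℝ] V := a.toLinearIsometry.toContinuousLinearMap

theorem isomCLM_apply (a : V ≃ₗᵢ[ℝ] V) (v : V) : isomCLM a v = a v := rfl

theorem isomCLM_mul (a b : V ≃ₗᵢ[ℝ] V) : isomCLM (a * b) = isomCLM a * isomCLM b := rfl

theorem isomCLM_one : isomCLM (1 : V ≃ₗᵢ[ℝ] V) = 1 := rfl

theorem norm_isomCLM_le (a : V ≃ₗᵢ[ℝ] V) : ‖isomCLM a‖ ≤ 1 :=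
  a.toLinearIsometry.norm_toContinuousLinearMap_le

theorem isomCLM_mul_inv (a : V ≃ₗᵢ[ℝ] V) : isomCLM a * isomCLM a⁻¹ = 1 := by
  rw [← isomCLM_mul, mul_inv_cancel, isomCLM_one]

theorem norm_isomCLM_mul_le (a : V ≃ₗᵢ[ℝ] V) (T : V →L[ℝ] V) : ‖isomCLM a * T‖ ≤ ‖T‖ :=
  (norm_mul_le _ _).trans (by nlinarith [norm_isomCLM_le a, norm_nonneg T])

theorem norm_mul_isomCLM_le (a : V ≃ₗᵢ[ℝ] V) (T : V →L[ℝ] V) : ‖T * isomCLM a‖ ≤ ‖T‖ :=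
  (norm_mul_le _ _).trans (by nlinarith [norm_isomCLM_le a, norm_nonneg T])

/-- The operator-norm distance from a linear isometry to the identity. -/
noncomputable def opDisp (a : V ≃ₗᵢ[ℝ] V) : ℝ := ‖isomCLM a - 1‖

theorem opDisp_nonneg (a : V ≃ₗᵢ[ℝ] V) : 0 ≤ opDisp a := norm_nonneg _

theorem opDisp_one : opDisp (1 : V ≃ₗᵢ[ℝ] V) = 0 := by simp [opDisp, isomCLM_one]

theorem eq_one_of_opDisp {a : V ≃ₗᵢ[ℝ] V} (h : opDisp a = 0) : a = 1 := by
  have h1 := sub_eq_zero.1 (norm_eq_zero.1 h)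
  ext v
  rw [← isomCLM_apply, h1]; rfl

theorem opDisp_le_two (a : V ≃ₗᵢ[ℝ] V) : opDisp a ≤ 2 := by
  have h1 := norm_sub_le (isomCLM a) (isomCLM (1 : V ≃ₗᵢ[ℝ] V))
  have h2 := norm_isomCLM_le a
  have h3 := norm_isomCLM_le (1 : V ≃ₗᵢ[ℝ] V)
  rw [isomCLM_one] at h1 h3
  unfold opDisp
  linarith

theorem opDisp_mul_inv_le (a b : V ≃ₗᵢ[ℝ] V) : opDisp (a * b⁻¹) ≤ ‖isomCLM a - isomCLM b‖ := by
  have : isomCLM (a * b⁻¹) - 1 = (isomCLM a - isomCLM b) * isomCLM b⁻¹ := by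
    rw [sub_mul, isomCLM_mul_inv, isomCLM_mul]
  rw [opDisp, this]
  exact norm_mul_isomCLM_le _ _

theorem opDisp_inv_le (a : V ≃ₗᵢ[ℝ] V) : opDisp a⁻¹ ≤ opDisp a := by
  have := opDisp_mul_inv_le 1 a
  rwa [one_mul, isomCLM_one, norm_sub_rev] at this

theorem opDisp_mul_le (a b : V ≃ₗᵢ[ℝ] V) : opDisp (a * b) ≤ opDisp a + opDisp b := by
  have : isomCLM (a * b) - 1 = isomCLM a * (isomCLM b - 1) + (isomCLM a - 1) := by
    rw [isomCLM_mul]; noncomm_ring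
  rw [opDisp, this, add_comm (opDisp a)]
  exact (norm_add_le _ _).trans (add_le_add_left (norm_isomCLM_mul_le _ _) _)

theorem opDisp_pow_le (a : V ≃ₗᵢ[ℝ] V) (n : ℕ) : opDisp (a ^ n) ≤ n * opDisp a := by
  induction n with
  | zero => simp [opDisp_one]
  | succ n ih =>
    rw [pow_succ]
    have := opDisp_mul_le (a ^ n) a
    push_cast
    linarith

theorem opDisp_commutator_le (a b : V ≃ₗᵢ[ℝ] V) : opDisp ⁅a, b⁆ ≤ 2 * (opDisp a * opDisp b) := by
  have h1 : ⁅a, b⁆ = (a * b) * (b * a)⁻¹ := by simp [commutatorElement_def, mul_assoc]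
  rw [h1]
  refine (opDisp_mul_inv_le _ _).trans ?_
  have h2 : isomCLM (a * b) - isomCLM (b * a) = (isomCLM a - 1) * (isomCLM b - 1) -
      (isomCLM b - 1) * (isomCLM a - 1) := by
    rw [isomCLM_mul, isomCLM_mul]; noncomm_ring
  rw [h2]
  have h3 := norm_sub_le ((isomCLM a - 1) * (isomCLM b - 1)) ((isomCLM b - 1) * (isomCLM a - 1))
  have h4 := norm_mul_le (isomCLM a - 1) (isomCLM b - 1)
  have h5 := norm_mul_le (isomCLM b - 1) (isomCLM a - 1)
  unfold opDisp
  nlinarith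

theorem opDisp_pow_ge (a : V ≃ₗᵢ[ℝ] V) (n : ℕ) :
    n * opDisp a - n ^ 2 * opDisp a ^ 2 ≤ opDisp (a ^ n) := by
  have h1 : ‖isomCLM (a ^ n) - 1 - (n : ℝ) • (isomCLM a - 1)‖ ≤ n ^ 2 * opDisp a ^ 2 := by
    induction n with
    | zero => simp [isomCLM_one]
    | succ n ih =>
      have h2 : isomCLM (a ^ (n + 1)) - 1 - ((n + 1 : ℕ) : ℝ) • (isomCLM a - 1) =
          (isomCLM (a ^ n) - 1 - (n : ℝ) • (isomCLM a - 1)) +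
            (isomCLM (a ^ n) - 1) * (isomCLM a - 1) := by
        rw [pow_succ, isomCLM_mul]; push_cast; rw [add_smul, one_smul]; noncomm_ring
      rw [h2]
      have h3 : ‖(isomCLM (a ^ n) - 1) * (isomCLM a - 1)‖ ≤ n * opDisp a * opDisp a :=
        (norm_mul_le _ _).trans (mul_le_mul_of_nonneg_right (opDisp_pow_le a n) (opDisp_nonneg a))
      refine (norm_add_le _ _).trans ((add_le_add ih h3).trans ?_)
      push_cast
      nlinarith [sq_nonneg (opDisp a), (Nat.cast_nonneg n : (0 : ℝ) ≤ n),
        mul_nonneg (Nat.cast_nonneg n : (0 : ℝ) ≤ n) (sq_nonneg (opDisp a))]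
  have h2 := norm_sub_norm_le ((n : ℝ) • (isomCLM a - 1)) (isomCLM (a ^ n) - 1)
  rw [norm_sub_rev ((n : ℝ) • (isomCLM a - 1)), norm_smul, Real.norm_natCast] at h2
  unfold opDisp at *
  linarith

theorem eq_one_of_opDisp_pow {a : V ≃ₗᵢ[ℝ] V} (h : ∀ n : ℕ, opDisp (a ^ n) ≤ 1 / 8) : a = 1 := by
  apply eq_one_of_opDisp
  by_contra h0
  have hpos : 0 < opDisp a := lt_of_le_of_ne (opDisp_nonneg a) (Ne.symm h0)
  have h1 : ∀ k : ℕ, (3 / 2 : ℝ) ^ k * opDisp a ≤ opDisp (a ^ 2 ^ k) := by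
    intro k
    induction k with
    | zero => simp
    | succ k ih =>
      have h2 := opDisp_pow_ge (a ^ 2 ^ k) 2
      rw [← pow_mul, ← pow_succ] at h2
      have h3 := h (2 ^ k)
      have h4 := opDisp_nonneg (a ^ 2 ^ k)
      rw [pow_succ]
      push_cast at h2
      nlinarith
  obtain ⟨k, hk⟩ := pow_unbounded_of_one_lt (1 / opDisp a) (by norm_num : (1 : ℝ) < 3 / 2)
  rw [div_lt_iff₀ hpos] at hk
  linarith [h1 k, h (2 ^ k)]

theorem eq_one_of_commutator_commute {a b : V ≃ₗᵢ[ℝ] V} (ha : opDisp a ≤ 1 / 32)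
    (h : Commute ⁅a, b⁆ b) : ⁅a, b⁆ = 1 := by
  refine eq_one_of_opDisp_pow fun n => ?_
  have h1 : ⁅a, b⁆ ^ n = ⁅a, b ^ n⁆ := by
    have h2 : a * b * a⁻¹ = ⁅a, b⁆ * b := by simp [commutatorElement_def]
    have h3 : (⁅a, b⁆ * b) ^ n = a * b ^ n * a⁻¹ := by rw [← h2, conj_pow]
    rw [h.mul_pow] at h3
    rw [commutatorElement_def a (b ^ n), ← h3]; group
  rw [h1]
  have h2 := opDisp_commutator_le a (b ^ n)
  have h3 := opDisp_le_two (b ^ n)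
  have h4 := opDisp_nonneg a
  nlinarith

theorem exists_finite_approx [FiniteDimensional ℝ V] {G : Type*} [Group G]
    (ρ : G →* (V ≃ₗᵢ[ℝ] V)) {ε : ℝ} (hε : 0 < ε) :
    ∃ T : Set G, T.Finite ∧ ∀ g, ∃ h ∈ T, opDisp (ρ (g * h⁻¹)) < ε := by
  have h1 : TotallyBounded (Set.range fun g => isomCLM (ρ g)) := by
    refine TotallyBounded.subset ?_
      (isCompact_closedBall (0 : V →L[ℝ] V) 1).totallyBounded
    rintro _ ⟨g, rfl⟩
    simpa using norm_isomCLM_le (ρ g)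
  obtain ⟨t, ht, hfin, hcov⟩ := Metric.finite_approx_of_totallyBounded h1 ε hε
  have ht' : ∀ y ∈ t, ∃ g, isomCLM (ρ g) = y := fun y hy => ht hy
  choose! f hf using ht'
  refine ⟨f '' t, hfin.image f, fun g => ?_⟩
  have := hcov ⟨g, rfl⟩
  simp only [Set.mem_iUnion, mem_ball] at this
  obtain ⟨y, hy, hd⟩ := this
  refine ⟨f y, ⟨y, hy, rfl⟩, ?_⟩
  rw [map_mul, map_inv]
  refine (opDisp_mul_inv_le _ _).trans_lt ?_
  rw [hf y hy, ← dist_eq_norm]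
  exact hd

theorem Subgroup.finiteIndex_of_finite_cover {G : Type*} [Group G] (H : Subgroup G) {T : Set G}
    (hT : T.Finite) (h : ∀ g, ∃ t ∈ T, g * t⁻¹ ∈ H) : H.FiniteIndex := by
  have : Finite T := hT
  have : Finite (G ⧸ H) := by
    refine Finite.of_surjective (fun t : T => (QuotientGroup.mk (t : G)⁻¹ : G ⧸ H)) fun q => ?_
    induction q using QuotientGroup.induction_on with
    | H g =>
      obtain ⟨t, ht, h2⟩ := h g⁻¹
      refine ⟨⟨t, ht⟩, ?_⟩
      have h3 := H.inv_mem h2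
      rw [QuotientGroup.eq]
      simpa using h3
  exact Subgroup.finiteIndex_of_finite_quotient

end IsomDisp

section SmallCommute
open scoped Pointwise commutatorElement

variable {G : Type*} [Group G] {V : Type*} [NormedAddCommGroup V] [InnerProductSpace ℝ V]

/-- Iterated commutators `[..[[g, s], s].., s]`. -/
def iterComm (g s : G) : ℕ → G
  | 0 => g
  | n + 1 => ⁅iterComm g s n, s⁆

/-- The product `g_k ^ i_k * g_{k+1} ^ i_{k+1} * ... ` of `m` powers of iterated commutators. -/
def commWord (g s : G) (i : ℕ → ℕ) : ℕ → ℕ → G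
  | _, 0 => 1
  | k, m + 1 => iterComm g s k ^ i k * commWord g s i (k + 1) m

theorem iterComm_mem {S : Set G} (hS : IsSymGen S) {g s : G} (hg : g ∈ S) (hs : s ∈ S) (k : ℕ) :
    iterComm g s k ∈ S ^ 4 ^ k := by
  induction k with
  | zero => simpa [iterComm] using hg
  | succ k ih =>
    have h1 : iterComm g s (k + 1) ∈ S ^ (4 ^ k + 1 + 4 ^ k + 1) := by
      rw [iterComm, commutatorElement_def]
      simp only [pow_add, pow_one]
      exact Set.mul_mem_mul (Set.mul_mem_mul (Set.mul_mem_mul ih hs)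
        (hS.inv_pow_mem _ _ ih)) (hS.inv_mem _ hs)
    refine pow_mem_pow_of_le hS.one_mem ?_ h1
    have := Nat.one_le_pow k 4 (by norm_num)
    rw [pow_succ]; omega

theorem commWord_mem {S : Set G} (hS : IsSymGen S) {g s : G} (hg : g ∈ S) (hs : s ∈ S) {M : ℕ}
    {i : ℕ → ℕ} (hi : ∀ k, i k ≤ M) (m k : ℕ) : commWord g s i k m ∈ S ^ (m * (M * 4 ^ (k + m))) := by
  induction m generalizing k with
  | zero => simp [commWord]
  | succ m ih =>
    have h1 : commWord g s i k (m + 1) ∈ S ^ (4 ^ k * i k + m * (M * 4 ^ (k + 1 + m))) := by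
      rw [commWord, pow_add, pow_mul]
      exact Set.mul_mem_mul (Set.pow_mem_pow (iterComm_mem hS hg hs k)) (ih (k + 1))
    refine pow_mem_pow_of_le hS.one_mem ?_ h1
    have h2 : 4 ^ k * i k ≤ M * 4 ^ (k + 1 + m) := by
      rw [mul_comm]
      exact Nat.mul_le_mul (hi k) (Nat.pow_le_pow_right (by norm_num) (by omega))
    rw [show k + (m + 1) = k + 1 + m by ring]
    nlinarith

theorem opDisp_iterComm (ρ : G →* (V ≃ₗᵢ[ℝ] V)) {ε : ℝ} {g s : G} (hs : opDisp (ρ s) ≤ ε) (k : ℕ) :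
    opDisp (ρ (iterComm g s (k + 1))) ≤ 2 * ε * opDisp (ρ (iterComm g s k)) := by
  rw [iterComm, map_commutatorElement]
  have h1 := opDisp_commutator_le (ρ (iterComm g s k)) (ρ s)
  have h2 := opDisp_nonneg (ρ (iterComm g s k))
  nlinarith

theorem opDisp_commWord (ρ : G →* (V ≃ₗᵢ[ℝ] V)) {M : ℕ} {g s : G}
    (hs : opDisp (ρ s) ≤ 1 / (32 * M)) (hM : 0 < M)
    {i : ℕ → ℕ} (hi : ∀ k, i k ≤ M) (m k : ℕ) :
    opDisp (ρ (commWord g s i k m)) ≤ 2 * M * opDisp (ρ (iterComm g s k)) := by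
  have hM' : (1 : ℝ) ≤ M := by exact_mod_cast hM
  have hε : 1 / (32 * (M : ℝ)) ≤ 1 / 32 := by
    apply one_div_le_one_div_of_le <;> linarith
  induction m generalizing k with
  | zero =>
    rw [commWord, map_one, opDisp_one]
    have := opDisp_nonneg (ρ (iterComm g s k))
    positivity
  | succ m ih =>
    rw [commWord, map_mul, map_pow]
    have h1 := opDisp_mul_le (ρ (iterComm g s k) ^ i k) (ρ (commWord g s i (k + 1) m))
    have h2 := opDisp_pow_le (ρ (iterComm g s k)) (i k)
    have h3 : (i k : ℝ) ≤ M := by exact_mod_cast hi k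
    have h4 := opDisp_nonneg (ρ (iterComm g s k))
    have h5 := opDisp_iterComm ρ hs (g := g) k
    have h6 := ih (k + 1)
    have h7 : opDisp (ρ (iterComm g s (k + 1))) ≤ 1 / 2 * opDisp (ρ (iterComm g s k)) := by
      nlinarith
    have h8 : (i k : ℝ) * opDisp (ρ (iterComm g s k)) ≤ M * opDisp (ρ (iterComm g s k)) :=
      mul_le_mul_of_nonneg_right h3 h4
    nlinarith

theorem commWord_inj_aux (ρ : G →* (V ≃ₗᵢ[ℝ] V)) {M : ℕ} {g s : G}
    (hs : opDisp (ρ s) ≤ 1 / (32 * M)) (hM : 0 < M) {k : ℕ}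
    (hk : 0 < opDisp (ρ (iterComm g s k))) (hk' : opDisp (ρ (iterComm g s k)) ≤ 1 / (32 * M))
    {i j : ℕ → ℕ} (hi : ∀ k, i k ≤ M) (hj : ∀ k, j k ≤ M) {m : ℕ}
    (h : commWord g s i k (m + 1) = commWord g s j k (m + 1)) : ¬ i k < j k := by
  intro hlt
  have hM' : (1 : ℝ) ≤ M := by exact_mod_cast hM
  obtain ⟨a, ha⟩ := Nat.exists_eq_add_of_lt hlt
  have h1 : iterComm g s k ^ (a + 1) =
      commWord g s i (k + 1) m * (commWord g s j (k + 1) m)⁻¹ := by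
    rw [commWord, commWord, ha, add_assoc, pow_add, mul_assoc] at h
    exact eq_mul_inv_of_mul_eq (mul_left_cancel h).symm
  have h2 := opDisp_pow_ge (ρ (iterComm g s k)) (a + 1)
  rw [← map_pow, h1, map_mul, map_inv] at h2
  have h3 := opDisp_mul_le (ρ (commWord g s i (k + 1) m)) (ρ (commWord g s j (k + 1) m))⁻¹
  have h4 := opDisp_inv_le (ρ (commWord g s j (k + 1) m))
  have h5 := opDisp_commWord ρ hs hM hi m (k + 1) (g := g)
  have h6 := opDisp_commWord ρ hs hM hj m (k + 1) (g := g)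
  have h7 := opDisp_iterComm ρ hs (g := g) k
  have h8 : 2 * M * opDisp (ρ (iterComm g s (k + 1))) ≤ 1 / 8 * opDisp (ρ (iterComm g s k)) := by
    have : 2 * (M : ℝ) * (2 * (1 / (32 * M)) * opDisp (ρ (iterComm g s k))) =
        1 / 8 * opDisp (ρ (iterComm g s k)) := by field_simp; norm_num
    rw [← this]
    exact mul_le_mul_of_nonneg_left h7 (by positivity)
  have ha' : ((a + 1 : ℕ) : ℝ) ≤ M := by
    have := hj k
    exact_mod_cast (by omega : a + 1 ≤ M)
  have ha1 : (1 : ℝ) ≤ ((a + 1 : ℕ) : ℝ) := by exact_mod_cast Nat.succ_pos a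
  have h9 : ((a + 1 : ℕ) : ℝ) * opDisp (ρ (iterComm g s k)) ≤ 1 / 32 := by
    rw [le_div_iff₀ (by positivity)] at hk'
    nlinarith
  nlinarith [mul_le_mul_of_nonneg_right ha1 hk.le]

theorem commWord_inj (ρ : G →* (V ≃ₗᵢ[ℝ] V)) {M : ℕ} {g s : G}
    (hs : opDisp (ρ s) ≤ 1 / (32 * M)) (hM : 0 < M)
    (hk : ∀ k, 0 < opDisp (ρ (iterComm g s k)))
    (hk' : ∀ k, opDisp (ρ (iterComm g s k)) ≤ 1 / (32 * M))
    {i j : ℕ → ℕ} (hi : ∀ k, i k ≤ M) (hj : ∀ k, j k ≤ M) {m k : ℕ}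
    (h : commWord g s i k m = commWord g s j k m) : ∀ l, k ≤ l → l < k + m → i l = j l := by
  induction m generalizing k with
  | zero => intro l h1 h2; omega
  | succ m ih =>
    have h1 : i k = j k := by
      rcases lt_trichotomy (i k) (j k) with h2 | h2 | h2
      · exact absurd h2 (commWord_inj_aux ρ hs hM (hk k) (hk' k) hi hj h)
      · exact h2
      · exact absurd h2 (commWord_inj_aux ρ hs hM (hk k) (hk' k) hj hi h.symm)
    intro l hl1 hl2
    rcases hl1.eq_or_lt with rfl | hl1
    · exact h1
    · rw [commWord, commWord, h1] at h
      exact ih (mul_left_cancel h) l hl1 (by omega)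

end SmallCommute

section VirtualHom
open scoped Pointwise commutatorElement Classical

theorem IsSymGen.union_pair {G : Type*} [Group G] {S : Set G} (hS : IsSymGen S) (g s : G) :
    IsSymGen (S ∪ {g, g⁻¹, s, s⁻¹}) where
  finite := hS.finite.union (by simp)
  one_mem := Or.inl hS.one_mem
  inv_mem x hx := by
    rcases hx with hx | hx
    · exact Or.inl (hS.inv_mem x hx)
    · right
      simp only [Set.mem_insert_iff, Set.mem_singleton_iff] at hx ⊢
      rcases hx with rfl | rfl | rfl | rfl <;> simp
  closure_eq := by
    rw [eq_top_iff, ← hS.closure_eq]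
    exact Subgroup.closure_mono Set.subset_union_left

variable {G : Type*} [Group G] {V : Type*} [NormedAddCommGroup V] [InnerProductSpace ℝ V]

theorem GrowthLE.exists_iterComm_eq_one [Group.FG G] {d : ℕ} (hG : GrowthLE G d)
    (ρ : G →* (V ≃ₗᵢ[ℝ] V)) {g s : G} (hg : opDisp (ρ g) ≤ 1 / (32 * (4 ^ (d + 1) : ℕ)))
    (hs : opDisp (ρ s) ≤ 1 / (32 * (4 ^ (d + 1) : ℕ))) : ∃ k, ρ (iterComm g s k) = 1 := by
  by_contra hcon
  push Not at hcon
  set M : ℕ := 4 ^ (d + 1) with hM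
  have hM0 : 0 < M := by positivity
  have hM1 : (1 : ℝ) ≤ M := by exact_mod_cast hM0
  have hpos : ∀ k, 0 < opDisp (ρ (iterComm g s k)) := fun k =>
    lt_of_le_of_ne (opDisp_nonneg _) fun h => hcon k (eq_one_of_opDisp h.symm)
  have hε : 1 / (32 * (M : ℝ)) ≤ 1 / 32 := by
    apply one_div_le_one_div_of_le <;> linarith
  have hsmall : ∀ k, opDisp (ρ (iterComm g s k)) ≤ 1 / (32 * M) := by
    intro k
    induction k with
    | zero => exact hg
    | succ k ih =>
      have := opDisp_iterComm ρ hs (g := g) k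
      nlinarith [hpos k]
  obtain ⟨S0, hS0⟩ := exists_isSymGen G
  have hS := hS0.union_pair g s
  set S := S0 ∪ {g, g⁻¹, s, s⁻¹} with hSdef
  have hgS : g ∈ S := by right; simp
  have hsS : s ∈ S := by right; simp
  obtain ⟨C, hC⟩ := hG S hS.finite
  obtain ⟨m, hm1, hm⟩ := exists_pow_lt_two_pow (C * M ^ d) d
  let ex : (Fin m → Fin M) → ℕ → ℕ := fun i k => if h : k < m then i ⟨k, h⟩ else 0
  have hex : ∀ i k, ex i k ≤ M := by
    intro i k
    simp only [ex]
    split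
    · exact (i _).2.le
    · omega
  have h1 := hC (m * (M * 4 ^ m)) (Nat.mul_pos hm1 (by positivity))
    (Finset.univ.image fun i : Fin m → Fin M => commWord g s (ex i) 0 m) (by
      intro x hx
      simp only [Finset.coe_image, Finset.coe_univ, Set.image_univ, Set.mem_range] at hx
      obtain ⟨i, rfl⟩ := hx
      have := commWord_mem hS hgS hsS (hex i) m 0
      rwa [zero_add] at this)
  rw [Finset.card_image_of_injective] at h1
  · rw [Finset.card_univ, Fintype.card_fun, Fintype.card_fin, Fintype.card_fin] at h1
    have h2 : M ^ m = 4 ^ m * (4 ^ m) ^ d := by rw [hM, ← pow_mul, ← pow_mul, ← pow_add]; ring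
    have h3 : C * (m * (M * 4 ^ m)) ^ d = (C * M ^ d * m ^ d) * (4 ^ m) ^ d := by
      rw [mul_pow, mul_pow]; ring
    rw [h2, h3] at h1
    have h4 : 2 ^ m ≤ 4 ^ m := Nat.pow_le_pow_left (by norm_num) m
    have h5 := Nat.le_of_mul_le_mul_right h1 (by positivity)
    omega
  · intro i j hij
    have := commWord_inj ρ hs hM0 hpos hsmall (hex i) (hex j) hij
    ext k
    have h2 := this k (Nat.zero_le _) (by simp)
    simpa [ex] using h2

theorem GrowthLE.commute_of_opDisp [Group.FG G] {d : ℕ} (hG : GrowthLE G d)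
    (ρ : G →* (V ≃ₗᵢ[ℝ] V)) {g s : G} (hg : opDisp (ρ g) ≤ 1 / (32 * (4 ^ (d + 1) : ℕ)))
    (hs : opDisp (ρ s) ≤ 1 / (32 * (4 ^ (d + 1) : ℕ))) : Commute (ρ g) (ρ s) := by
  have hM1 : (1 : ℝ) ≤ (4 ^ (d + 1) : ℕ) := by exact_mod_cast Nat.one_le_pow _ _ (by norm_num)
  have hε : 1 / (32 * ((4 ^ (d + 1) : ℕ) : ℝ)) ≤ 1 / 32 := by
    apply one_div_le_one_div_of_le <;> linarith
  have hsmall : ∀ k, opDisp (ρ (iterComm g s k)) ≤ 1 / 32 := by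
    intro k
    induction k with
    | zero => exact hg.trans hε
    | succ k ih =>
      have := opDisp_iterComm ρ hs (g := g) k
      nlinarith [opDisp_nonneg (ρ (iterComm g s k))]
  have hex := hG.exists_iterComm_eq_one ρ hg hs
  have hf := Nat.find_spec hex
  have hmin := fun m => Nat.find_min hex (m := m)
  rcases hk : Nat.find hex with _ | _ | k
  · rw [hk] at hf
    rw [show ρ g = 1 from hf]
    exact Commute.one_left _
  · rw [hk] at hf
    rw [iterComm, iterComm, map_commutatorElement, commutatorElement_eq_one_iff_commute] at hf
    exact hf
  · exfalso
    rw [hk] at hf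
    refine hmin (k + 1) (by omega) ?_
    rw [iterComm, map_commutatorElement, commutatorElement_eq_one_iff_commute, iterComm,
      map_commutatorElement] at hf
    rw [iterComm, map_commutatorElement]
    exact eq_one_of_commutator_commute (hsmall k) hf

theorem exists_surjective_int {A : Type*} [Group A] [Group.FG G] (φ : G →* A)
    (hc : ∀ x y, Commute (φ x) (φ y)) (hinf : (Set.range φ).Infinite) :
    ∃ ψ : G →* Multiplicative ℤ, Function.Surjective ψ := by
  let _ : CommGroup φ.range :=
    { (inferInstance : Group φ.range) with
      mul_comm := by
        rintro ⟨_, x, rfl⟩ ⟨_, y, rfl⟩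
        exact Subtype.ext (hc x y) }
  have : Group.FG φ.range := Group.fg_of_surjective φ.rangeRestrict_surjective
  obtain ⟨ι, j, _, _, p, hp, e, ⟨f⟩⟩ := CommGroup.equiv_free_prod_prod_multiplicative_zmod φ.range
  rcases isEmpty_or_nonempty j with hj | ⟨⟨k⟩⟩
  · exfalso
    have : ∀ i, NeZero (p i ^ e i) := fun i => ⟨pow_ne_zero _ (hp i).ne_zero⟩
    have : ∀ i, Finite (Multiplicative (ZMod (p i ^ e i))) := fun i =>
      inferInstanceAs (Finite (ZMod (p i ^ e i)))
    have : Finite φ.range := Finite.of_equiv _ f.symm.toEquiv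
    exact hinf (Set.toFinite (φ.range : Set A))
  · refine ⟨(Pi.evalMonoidHom _ k).comp ((MonoidHom.fst _ _).comp
      (f.toMonoidHom.comp φ.rangeRestrict)), fun z => ?_⟩
    obtain ⟨x, hx⟩ := φ.rangeRestrict_surjective (f.symm (fun _ => z, 1))
    exact ⟨x, by simp [hx]⟩

theorem exists_cover_of_finiteIndex (H : Subgroup G) [H.FiniteIndex] :
    ∃ T : Set G, T.Finite ∧ ∀ g, ∃ t ∈ T, g * t⁻¹ ∈ H := by
  refine ⟨Set.range fun q : G ⧸ H => (Quotient.out q)⁻¹, Set.finite_range _, fun g => ?_⟩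
  refine ⟨_, ⟨(g⁻¹ : G), rfl⟩, ?_⟩
  have h := QuotientGroup.out_eq' (s := H) ((g⁻¹ : G) : G ⧸ H)
  have h1 := QuotientGroup.eq.1 h.symm
  simpa using h1

/-- Over a finite-index subgroup, an infinite group of polynomial growth maps onto `ℤ`. -/
theorem GrowthLE.exists_virtual_hom [Infinite G] [Group.FG G] {d : ℕ} (hG : GrowthLE G d) :
    ∃ H : Subgroup G, H.FiniteIndex ∧ ∃ ψ : H →* Multiplicative ℤ, Function.Surjective ψ := by
  obtain ⟨n, ρ, ev, ⟨v, hv⟩, hev⟩ := hG.exists_rep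
  have hev1 : ∀ w, ev w 1 = 0 := fun w => by
    have := hev w 1 1
    simp at this
    exact this
  by_cases hfin : (Set.range ρ).Finite
  · have : Finite ρ.range := hfin
    have hfi : ρ.ker.FiniteIndex := inferInstance
    refine ⟨ρ.ker, hfi, ?_⟩
    have : Group.FG ρ.ker := Subgroup.fg_of_index_ne_zero _
    have hadd : ∀ x ∈ ρ.ker, ∀ y, ev v (x * y) = ev v x + ev v y := by
      intro x hx y
      rw [hev, map_inv, MonoidHom.mem_ker.1 hx]
      simp
    let φ : ρ.ker →* Multiplicative ℝ :=
      { toFun := fun x => Multiplicative.ofAdd (ev v x)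
        map_one' := by simp [hev1]
        map_mul' := fun x y => by
          rw [Subgroup.coe_mul, hadd x x.2 y]; rfl }
    refine exists_surjective_int φ (fun x y => Commute.all _ _) fun hφ => hv ?_
    obtain ⟨T, hT, hcov⟩ := exists_cover_of_finiteIndex ρ.ker
    refine ((hφ.image Multiplicative.toAdd).add (hT.image (ev v))).subset ?_
    rintro _ ⟨g, rfl⟩
    obtain ⟨t, ht, hgt⟩ := hcov g
    refine ⟨ev v (g * t⁻¹), ⟨_, ⟨⟨_, hgt⟩, rfl⟩, rfl⟩, ev v t, ⟨t, ht, rfl⟩, ?_⟩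
    have := hadd _ hgt t
    simp only at this ⊢
    rw [← this]; simp
  · set ε : ℝ := 1 / (32 * (4 ^ (d + 1) : ℕ)) with hε
    have hε0 : 0 < ε := by positivity
    let H := Subgroup.closure {g : G | opDisp (ρ g) < ε}
    obtain ⟨T, hT, hcov⟩ := exists_finite_approx ρ hε0
    have hcov' : ∀ g, ∃ t ∈ T, g * t⁻¹ ∈ H := fun g => by
      obtain ⟨t, ht, h⟩ := hcov g
      exact ⟨t, ht, Subgroup.subset_closure h⟩
    have hfi : H.FiniteIndex := H.finiteIndex_of_finite_cover hT hcov'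
    refine ⟨H, hfi, ?_⟩
    have : Group.FG H := Subgroup.fg_of_index_ne_zero _
    refine exists_surjective_int (ρ.comp H.subtype) ?_ ?_
    · have hcomm : ∀ x ∈ H, ∀ y ∈ H, Commute (ρ x) (ρ y) := by
        intro x hx y hy
        induction hx, hy using Subgroup.closure_induction₂ with
        | mem x y hx hy => exact hG.commute_of_opDisp ρ (le_of_lt hx) (le_of_lt hy)
        | one_left x hx => simp
        | one_right x hx => simp
        | mul_left x y z _ _ _ h1 h2 => rw [map_mul]; exact h1.mul_left h2
        | mul_right y z x _ _ _ h1 h2 => rw [map_mul]; exact h1.mul_right h2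
        | inv_left x y _ _ h => rw [map_inv]; exact h.inv_left
        | inv_right x y _ _ h => rw [map_inv]; exact h.inv_right
      exact fun x y => hcomm x x.2 y y.2
    · intro hφ
      refine hfin ((hφ.mul (hT.image ρ)).subset ?_)
      rintro _ ⟨g, rfl⟩
      obtain ⟨t, ht, hgt⟩ := hcov' g
      refine ⟨_, ⟨⟨_, hgt⟩, rfl⟩, _, ⟨t, ht, rfl⟩, ?_⟩
      simp

end VirtualHom

section Kronecker
open Polynomial

theorem exists_map_eq_C_mul (p : ℚ[X]) :
    ∃ (N : ℤ) (P : ℤ[X]), N ≠ 0 ∧ P.map (Int.castRingHom ℚ) = C (N : ℚ) * p := by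
  obtain ⟨b, hb0, hb⟩ := IsLocalization.integerNormalization_spec (nonZeroDivisors ℤ) p
  refine ⟨b, IsLocalization.integerNormalization (nonZeroDivisors ℤ) p,
    nonZeroDivisors.ne_zero hb0, ?_⟩
  rw [show Int.castRingHom ℚ = algebraMap ℤ ℚ from rfl, hb]
  rw [← smul_eq_C_mul]
  exact (Int.cast_smul_eq_zsmul ℚ _ _).symm

theorem map_C_int (n : ℤ) : (C n).map (Int.castRingHom ℚ) = C (n : ℚ) := map_C _

theorem map_int_injective : Function.Injective (Polynomial.map (Int.castRingHom ℚ)) :=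
  Polynomial.map_injective _ (RingHom.injective_int _)

variable {M : Type*} [AddCommGroup M] {α : Module.End ℤ M} {a : M}

/-- An integer polynomial of minimal degree killing `a` divides, over `ℚ`, every integer polynomial
killing `a`. -/
theorem dvd_of_minimal {P : ℤ[X]} (hP0 : P ≠ 0) (hPa : aeval α P a = 0)
    (hmin : ∀ R : ℤ[X], aeval α R a = 0 → R.degree < P.degree → R = 0) {F : ℤ[X]}
    (hF : aeval α F a = 0) : P.map (Int.castRingHom ℚ) ∣ F.map (Int.castRingHom ℚ) := by
  set p := P.map (Int.castRingHom ℚ) with hp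
  set f := F.map (Int.castRingHom ℚ) with hf
  have hp0 : p ≠ 0 := by
    rw [hp, Ne, Polynomial.map_eq_zero_iff (RingHom.injective_int _)]; exact hP0
  obtain ⟨N1, Q, hN1, hQ⟩ := exists_map_eq_C_mul (f / p)
  obtain ⟨N2, R, hN2, hR⟩ := exists_map_eq_C_mul (f % p)
  have h1 : C N1 * C N2 * F = C N2 * Q * P + C N1 * R := by
    apply map_int_injective
    simp only [Polynomial.map_mul, Polynomial.map_add, map_C_int, hQ, hR, ← hp, ← hf]
    conv_lhs => rw [← EuclideanDomain.div_add_mod f p]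
    ring
  have h2 : aeval α (C N1 * R) a = 0 := by
    have h3 : C N1 * R = C N1 * C N2 * F - C N2 * Q * P := by rw [h1]; ring
    rw [h3, map_sub, map_mul, map_mul _ (C N2 * Q), LinearMap.sub_apply, Module.End.mul_apply, hF,
      Module.End.mul_apply, hPa, map_zero, map_zero, sub_zero]
  have h4 : (C N1 * R).degree < P.degree := by
    have h5 : (C N1 * R).degree = R.degree := degree_C_mul hN1
    have h6 : R.degree = (f % p).degree := by
      rw [← degree_map_eq_of_injective (RingHom.injective_int (Int.castRingHom ℚ)) R, hR,
        degree_C_mul (by exact_mod_cast hN2)]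
    have h7 : P.degree = p.degree :=
      (degree_map_eq_of_injective (RingHom.injective_int (Int.castRingHom ℚ)) P).symm
    rw [h5, h6, h7]
    exact EuclideanDomain.mod_lt f hp0
  have h8 := hmin _ h2 h4
  have h9 : R = 0 := by
    rcases mul_eq_zero.1 h8 with h | h
    · exact absurd (C_eq_zero.1 h) hN1
    · exact h
  rw [h9, Polynomial.map_zero] at hR
  have h10 : f % p = 0 := by
    rcases mul_eq_zero.1 hR.symm with h | h
    · exact absurd (C_eq_zero.1 h) (by exact_mod_cast hN2)
    · exact h
  exact (EuclideanDomain.mod_eq_zero).1 h10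

/-- The polynomial `X ^ m + ∑ c_i X ^ i` with small coefficients. -/
noncomputable def smallPoly (m : ℕ) (c : ℕ → ℤ) : ℤ[X] :=
  X ^ m + ∑ i ∈ Finset.range m, C (c i) * X ^ i

theorem smallPoly_monic (m : ℕ) (c : ℕ → ℤ) : (smallPoly m c).Monic := by
  refine monic_X_pow_add ?_
  refine (degree_sum_le _ _).trans_lt ?_
  rw [Finset.sup_lt_iff (by exact_mod_cast WithBot.bot_lt_coe m)]
  intro i hi
  refine (degree_C_mul_X_pow_le i (c i)).trans_lt ?_
  exact_mod_cast Finset.mem_range.1 hi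

theorem norm_lt_two_of_smallPoly {m : ℕ} {c : ℕ → ℤ} (hc : ∀ i, |c i| ≤ 1) {z : ℂ}
    (h : aeval z (smallPoly m c) = 0) : ‖z‖ < 2 := by
  by_contra hlt
  push Not at hlt
  have h1 : z ^ m = - ∑ i ∈ Finset.range m, (c i : ℂ) * z ^ i := by
    rw [smallPoly] at h
    simp only [map_add, map_pow, aeval_X, map_sum, map_mul, eq_intCast, map_intCast] at h
    exact eq_neg_of_add_eq_zero_left h
  have h2 : ‖z‖ ^ m ≤ ∑ i ∈ Finset.range m, ‖z‖ ^ i := by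
    rw [← norm_pow, h1, norm_neg]
    refine (norm_sum_le _ _).trans (Finset.sum_le_sum fun i _ => ?_)
    rw [norm_mul, norm_pow]
    have : ‖(c i : ℂ)‖ ≤ 1 := by
      rw [Complex.norm_intCast]
      exact_mod_cast hc i
    nlinarith [pow_nonneg (norm_nonneg z) i]
  have h3 : (∑ i ∈ Finset.range m, ‖z‖ ^ i) * (‖z‖ - 1) = ‖z‖ ^ m - 1 := geom_sum_mul _ _
  have h4 : 0 ≤ ∑ i ∈ Finset.range m, ‖z‖ ^ i :=
    Finset.sum_nonneg fun i _ => pow_nonneg (norm_nonneg z) i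
  nlinarith

theorem exists_fixed_of_small_relations (hα : Function.Injective α)
    (ha : ∀ n : ℤ, n ≠ 0 → n • a ≠ 0)
    (hrel : ∀ k : ℕ, 1 ≤ k → ∃ (m : ℕ) (c : ℕ → ℤ), (∀ i, |c i| ≤ 1) ∧
      aeval (α ^ k) (smallPoly m c) a = 0) :
    ∃ u : M, (∀ n : ℤ, n ≠ 0 → n • u ≠ 0) ∧ ∃ m : ℕ, 1 ≤ m ∧ (α ^ m) u = u := by
  have hrel' : ∀ k : ℕ, 1 ≤ k → ∃ (m : ℕ) (c : ℕ → ℤ), (∀ i, |c i| ≤ 1) ∧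
      aeval α ((smallPoly m c).comp (X ^ k)) a = 0 := by
    intro k hk
    obtain ⟨m, c, hc, h⟩ := hrel k hk
    refine ⟨m, c, hc, ?_⟩
    rw [aeval_comp]; simpa using h
  obtain ⟨m1, c1, hc1, h1⟩ := hrel 1 le_rfl
  rw [pow_one] at h1
  have hne : ∃ n : ℕ, ∃ P : ℤ[X], P ≠ 0 ∧ aeval α P a = 0 ∧ P.natDegree = n :=
    ⟨_, smallPoly m1 c1, (smallPoly_monic _ _).ne_zero, h1, rfl⟩
  classical
  obtain ⟨P, hP0, hPa, hPd⟩ := Nat.find_spec hne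
  have hmin : ∀ R : ℤ[X], aeval α R a = 0 → R.degree < P.degree → R = 0 := by
    intro R hR hd
    by_contra hR0
    have h2 := natDegree_lt_natDegree hR0 hd
    rw [hPd] at h2
    exact Nat.find_min hne h2 ⟨R, hR0, hR, rfl⟩
  have hdvd := fun {F : ℤ[X]} (hF : aeval α F a = 0) => dvd_of_minimal hP0 hPa hmin hF
  have hroot : ∀ {F : ℤ[X]}, aeval α F a = 0 → ∀ z : ℂ, aeval z P = 0 → aeval z F = 0 := by
    intro F hF z hz
    obtain ⟨w, hw⟩ := hdvd hF
    have h2 : aeval z (F.map (Int.castRingHom ℚ)) = 0 := by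
      rw [hw, map_mul]
      have : aeval z (P.map (Int.castRingHom ℚ)) = 0 := by
        rw [← hz]; exact aeval_map_algebraMap ℚ z P
      rw [this, zero_mul]
    rw [← h2]; exact (aeval_map_algebraMap ℚ z F).symm
  have hPdeg : 0 < P.degree := by
    by_contra hd
    push Not at hd
    rw [eq_C_of_degree_le_zero hd] at hPa hP0
    refine ha (P.coeff 0) (fun h => hP0 (by rw [h, C_0])) ?_
    simpa using hPa
  obtain ⟨z, hz⟩ : ∃ z : ℂ, aeval z P = 0 :=
    IsAlgClosed.exists_aeval_eq_zero_of_injective ℂ (RingHom.injective_int _) P hPdeg.ne'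
  have hle : ∀ w : ℂ, aeval w P = 0 → ‖w‖ ≤ 1 := by
    intro w hw
    by_contra hlt
    push Not at hlt
    obtain ⟨k, hk⟩ := pow_unbounded_of_one_lt 2 hlt
    have hk1 : 1 ≤ k := by
      rcases k with _ | k
      · norm_num at hk
      · omega
    obtain ⟨m, c, hc, h2⟩ := hrel' k hk1
    have h3 := hroot h2 w hw
    rw [aeval_comp] at h3
    have h4 := norm_lt_two_of_smallPoly hc h3
    simp only [map_pow, aeval_X, norm_pow] at h4
    linarith
  have hz0 : z ≠ 0 := by
    rintro rfl
    have h2 : X ∣ P := by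
      rw [X_dvd_iff]
      have h3 : aeval (0 : ℂ) P = (P.coeff 0 : ℂ) := by
        rw [← coeff_zero_eq_aeval_zero']; simp
      rw [hz] at h3
      exact_mod_cast h3.symm
    obtain ⟨P', rfl⟩ := h2
    have h3 : aeval α P' a = 0 := by
      apply hα
      rw [map_mul, aeval_X, Module.End.mul_apply] at hPa
      rw [hPa, map_zero]
    have hP'0 : P' ≠ 0 := right_ne_zero_of_mul hP0
    refine hP'0 (hmin P' h3 ?_)
    rw [mul_comm]
    exact degree_lt_degree_mul_X hP'0
  have hzi : IsIntegral ℤ z := ⟨smallPoly m1 c1, smallPoly_monic _ _, hroot h1 z hz⟩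
  have hziQ : IsIntegral ℚ z := hzi.tower_top
  -- the root is a root of unity
  obtain ⟨m, hm, hzm⟩ : ∃ m : ℕ, 0 < m ∧ z ^ m = 1 := by
    let K := IntermediateField.adjoin ℚ {z}
    have : FiniteDimensional ℚ K := IntermediateField.adjoin.finiteDimensional hziQ
    have : NumberField K := { to_charZero := inferInstance, to_finiteDimensional := inferInstance }
    let y : K := IntermediateField.AdjoinSimple.gen ℚ z
    have hy : (algebraMap K ℂ) y = z := IntermediateField.AdjoinSimple.algebraMap_gen ℚ z
    have hyP : aeval y P = 0 := by
      apply (algebraMap K ℂ).injective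
      rw [map_zero, ← aeval_algebraMap_apply, hy, hz]
    obtain ⟨m, hm, h⟩ := NumberField.Embeddings.pow_eq_one_of_norm_le_one K ℂ (x := y)
      (by intro h; rw [h, map_zero] at hy; exact hz0 hy.symm)
      ((isIntegral_algebraMap_iff (algebraMap K ℂ).injective).1 (by rw [hy]; exact hzi))
      (fun φ => hle _ (by
        have h2 : φ (aeval y P) = 0 := by rw [hyP, map_zero]
        rw [← h2]
        exact aeval_algHom_apply φ.toIntAlgHom y P))
    refine ⟨m, hm, ?_⟩
    rw [← hy, ← map_pow, h, map_one]
  obtain ⟨q, hq⟩ : minpoly ℚ z ∣ P.map (Int.castRingHom ℚ) := by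
    apply minpoly.dvd
    rw [← hz]; exact aeval_map_algebraMap ℚ z P
  obtain ⟨ν, hν⟩ : minpoly ℚ z ∣ X ^ m - 1 := by
    apply minpoly.dvd
    simp [hzm]
  obtain ⟨D, Q, hD, hQ⟩ := exists_map_eq_C_mul q
  obtain ⟨N, W, hN, hW⟩ := exists_map_eq_C_mul (C (D : ℚ) * ν)
  have hq0 : q ≠ 0 := by
    rintro rfl
    rw [mul_zero, Polynomial.map_eq_zero_iff (RingHom.injective_int _)] at hq
    exact hP0 hq
  have hdegQ : Q.degree < P.degree := by
    have h2 : Q.degree = q.degree := by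
      rw [← degree_map_eq_of_injective (RingHom.injective_int (Int.castRingHom ℚ)) Q, hQ,
        degree_C_mul (by exact_mod_cast hD)]
    have h3 : P.degree = (minpoly ℚ z * q).degree := by
      rw [← hq, degree_map_eq_of_injective (RingHom.injective_int (Int.castRingHom ℚ)) P]
    rw [h2, h3, degree_mul]
    have h4 := minpoly.degree_pos hziQ
    rw [degree_eq_natDegree hq0, degree_eq_natDegree (minpoly.ne_zero hziQ)] at *
    have h5 : 0 < (minpoly ℚ z).natDegree := by exact_mod_cast h4
    exact_mod_cast (by omega : q.natDegree < (minpoly ℚ z).natDegree + q.natDegree)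
  have hQ0 : Q ≠ 0 := by
    rintro rfl
    rw [Polynomial.map_zero] at hQ
    rcases mul_eq_zero.1 hQ.symm with h | h
    · exact hD (by exact_mod_cast C_eq_zero.1 h)
    · exact hq0 h
  have hQinf : ∀ n : ℤ, n ≠ 0 → n • aeval α Q a ≠ 0 := by
    intro n hn h
    have h2 : aeval α (C n * Q) a = 0 := by
      rw [map_mul, aeval_C, Module.End.mul_apply]
      simpa using h
    have h3 := hmin _ h2 (by rw [degree_C_mul hn]; exact hdegQ)
    rcases mul_eq_zero.1 h3 with h | h
    · exact hn (C_eq_zero.1 h)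
    · exact hQ0 h
  have hrelN : C N * (X ^ m - 1) * Q = W * P := by
    apply map_int_injective
    simp only [Polynomial.map_mul, Polynomial.map_sub, Polynomial.map_pow, map_X,
      Polynomial.map_one, map_C_int, hQ, hW, hν, hq]
    ring
  refine ⟨N • aeval α Q a, fun n hn h => ?_, m, hm, ?_⟩
  · rw [smul_smul] at h
    exact hQinf _ (mul_ne_zero hn hN) h
  · have h2 := congrArg (fun F : ℤ[X] => aeval α F a) hrelN
    simp only [map_mul, Module.End.mul_apply, hPa, map_zero, map_sub, map_pow, aeval_X, map_one,
      aeval_C, LinearMap.sub_apply, Module.End.one_apply] at h2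
    rw [map_zsmul]
    have h3 : N • ((α ^ m) (aeval α Q a) - aeval α Q a) = 0 := by
      simpa [smul_sub] using h2
    rw [smul_sub] at h3
    exact sub_eq_zero.1 h3

end Kronecker

section CentralElement
open scoped Pointwise Classical

variable {G : Type*} [Group G]

theorem milnorWord_eq_sum {B : Type*} [CommGroup B] (v : B →* G)
    (β : Module.End ℤ (Additive B)) (T : G)
    (hβ : ∀ x : Additive B, v (β x).toMul = T * v x.toMul * T⁻¹) (e : Additive B) (ε : ℕ → Bool)
    (n : ℕ) : milnorWord T (v e.toMul) ε n * (T ^ n)⁻¹ =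
      v (∑ i ∈ Finset.range n, (if ε i then 1 else 0 : ℤ) • (β ^ i) e).toMul := by
  have hpow : ∀ (i : ℕ) (x : Additive B), v ((β ^ i) x).toMul = T ^ i * v x.toMul * (T ^ i)⁻¹ := by
    intro i
    induction i with
    | zero => simp
    | succ i ih =>
      intro x
      rw [pow_succ, Module.End.mul_apply, ih, hβ, pow_succ]
      group
  induction n with
  | zero => simp [milnorWord]
  | succ n ih =>
    rw [Finset.sum_range_succ, toMul_add, map_mul, ← ih, milnorWord]
    split_ifs with h
    · rw [one_smul, hpow, pow_succ]; group
    · rw [zero_smul, toMul_zero, map_one, pow_succ]; group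

/-- In a group of polynomial growth, an element normalizing an abelian subgroup with an element of
infinite order has a power centralizing some element of infinite order of that subgroup. -/
theorem GrowthLE.exists_fixed {d : ℕ} (hG : GrowthLE G d) (B : Subgroup G)
    (hB : ∀ x ∈ B, ∀ y ∈ B, x * y = y * x) (t : G) (ht : ∀ x ∈ B, t * x * t⁻¹ ∈ B) {a : G}
    (ha : a ∈ B) (hinf : ¬ IsOfFinOrder a) :
    ∃ u ∈ B, ¬ IsOfFinOrder u ∧ ∃ m : ℕ, 1 ≤ m ∧ t ^ m * u * (t ^ m)⁻¹ = u := by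
  let _ : CommGroup B :=
    { (inferInstance : Group B) with
      mul_comm := by
        rintro ⟨x, hx⟩ ⟨y, hy⟩
        exact Subtype.ext (hB x hx y hy) }
  let v : B →* G := B.subtype
  have hv : Function.Injective v := B.subtype_injective
  let f : B →* B := ((MulAut.conj t).toMonoidHom.comp v).codRestrict B (fun x => ht x x.2)
  let α : Module.End ℤ (Additive B) := (MonoidHom.toAdditive f).toIntLinearMap
  have hα : ∀ x : Additive B, v (α x).toMul = t * v x.toMul * t⁻¹ := fun x => rfl
  have hpow : ∀ (i : ℕ) (x : Additive B), v ((α ^ i) x).toMul = t ^ i * v x.toMul * (t ^ i)⁻¹ := by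
    intro i
    induction i with
    | zero => simp
    | succ i ih =>
      intro x
      rw [pow_succ, Module.End.mul_apply, ih, hα, pow_succ]
      group
  have hfin : ∀ x : Additive B, ¬ IsOfFinOrder (v x.toMul) ↔ ∀ n : ℤ, n ≠ 0 → n • x ≠ 0 := by
    intro x
    rw [isOfFinOrder_iff_zpow_eq_one]
    push Not
    refine forall_congr' fun n => imp_congr_right fun _ => not_congr ?_
    rw [← map_zpow, ← map_one v, hv.eq_iff]
    rfl
  obtain ⟨u, hu, m, hm, hfix⟩ := exists_fixed_of_small_relations (α := α)
    (a := Additive.ofMul (⟨a, ha⟩ : B)) (fun x y hxy => by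
      have h1 := hα x
      have h2 := hα y
      rw [hxy, h2] at h1
      have h3 : v y.toMul = v x.toMul := by simpa using h1
      exact (hv h3).symm) ((hfin _).1 hinf) (fun k hk => by
      obtain ⟨m, ε, ε', h⟩ := hG.exists_coincidence (t ^ k) a
      have h1 := milnorWord_eq_sum v (α ^ k) (t ^ k) (hpow k) (Additive.ofMul (⟨a, ha⟩ : B)) ε m
      have h2 := milnorWord_eq_sum v (α ^ k) (t ^ k) (hpow k) (Additive.ofMul (⟨a, ha⟩ : B)) ε' m
      change milnorWord (t ^ k) a ε m * _ = _ at h1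
      change milnorWord (t ^ k) a ε' m * _ = _ at h2
      refine ⟨m, fun i => (if ε i then 1 else 0) - (if ε' i then 1 else 0), fun i => ?_, ?_⟩
      · show |((if ε i then 1 else 0) - (if ε' i then 1 else 0) : ℤ)| ≤ 1
        split_ifs <;> simp
      · set e : Additive B := Additive.ofMul (⟨a, ha⟩ : B)
        have h3 : v (((α ^ k) ^ m) e).toMul = (t ^ k) ^ m * a * ((t ^ k) ^ m)⁻¹ := by
          rw [← pow_mul, hpow, ← pow_mul]; rfl
        have h4 : v ((∑ i ∈ Finset.range m, (if ε i then 1 else 0 : ℤ) • ((α ^ k) ^ i) e) +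
            ((α ^ k) ^ m) e).toMul =
            v (∑ i ∈ Finset.range m, (if ε' i then 1 else 0 : ℤ) • ((α ^ k) ^ i) e).toMul := by
          rw [toMul_add, map_mul, ← h1, ← h2, h3, ← h]; group
        have h5 := Additive.toMul.injective (hv h4)
        rw [smallPoly, map_add, map_pow, Polynomial.aeval_X, map_sum, LinearMap.add_apply,
          LinearMap.sum_apply]
        simp only [map_mul, Polynomial.aeval_C, map_pow, Polynomial.aeval_X, Module.End.mul_apply,
          Module.algebraMap_end_apply, sub_smul, Finset.sum_sub_distrib]
        rw [← h5]; abel)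
  refine ⟨v u.toMul, u.toMul.2, (hfin u).2 hu, m, hm, ?_⟩
  rw [← hpow, hfix]

theorem finite_hom_of_fg (K P : Type*) [Group K] [Group.FG K] [Group P] [Finite P] :
    Finite (K →* P) := by
  obtain ⟨S, hS⟩ := exists_isSymGen K
  have : Finite S := hS.finite
  refine Finite.of_injective (fun (f : K →* P) (s : S) => f s) fun f g h => ?_
  refine MonoidHom.eq_of_eqOn_dense hS.closure_eq fun s hs => ?_
  exact congrFun h ⟨s, hs⟩

/-- A finite-index subgroup of a finitely generated group contains a finite-index subgroup invariant
under all automorphisms. -/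
theorem exists_invariant_le (K : Type*) [Group K] [Group.FG K] (N : Subgroup K) [N.FiniteIndex] :
    ∃ K0 : Subgroup K, K0.FiniteIndex ∧ K0 ≤ N ∧ ∀ c : MulAut K, ∀ x ∈ K0, c x ∈ K0 := by
  have := finite_hom_of_fg K (Equiv.Perm (K ⧸ N))
  refine ⟨⨅ f : K →* Equiv.Perm (K ⧸ N), f.ker, Subgroup.finiteIndex_iInf fun f => inferInstance,
    ?_, fun c x hx => ?_⟩
  · refine (iInf_le _ (MulAction.toPermHom K (K ⧸ N))).trans ?_
    rw [← Subgroup.normalCore_eq_ker]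
    exact N.normalCore_le
  · rw [Subgroup.mem_iInf] at hx ⊢
    exact fun f => hx (f.comp c.toMonoidHom)

theorem exists_central_of_ker_finite (φ : G →* Multiplicative ℤ) (t : G) [Finite φ.ker] :
    ∃ m : ℕ, 1 ≤ m ∧ ∀ k ∈ φ.ker, t ^ m * k = k * t ^ m := by
  have : Finite (MulAut φ.ker) := Finite.of_injective _ (MulEquiv.toEquiv_injective)
  let c : MulAut φ.ker := MulAut.conjNormal t
  refine ⟨orderOf c, orderOf_pos c, fun k hk => ?_⟩
  have h1 : MulAut.conjNormal (t ^ orderOf c) = (1 : MulAut φ.ker) := by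
    rw [map_pow, pow_orderOf_eq_one]
  have h2 := congrArg (fun e : MulAut φ.ker => ((e ⟨k, hk⟩ : φ.ker) : G)) h1
  simp only [MulAut.conjNormal_apply, MulAut.one_apply] at h2
  exact mul_inv_eq_iff_eq_mul.1 h2

theorem exists_decomp {φ : G →* Multiplicative ℤ} {t : G}
    (ht : φ t = Multiplicative.ofAdd 1) (g : G) : ∃ n : ℤ, ∃ k ∈ φ.ker, g = t ^ n * k := by
  refine ⟨(φ g).toAdd, (t ^ (φ g).toAdd)⁻¹ * g, ?_, by simp⟩
  rw [MonoidHom.mem_ker, map_mul, map_inv, map_zpow, ht, ← ofAdd_zsmul]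
  simp

theorem finiteIndex_of_ker {φ : G →* Multiplicative ℤ} {t : G}
    (ht : φ t = Multiplicative.ofAdd 1) {H : Subgroup G} {m : ℕ} (hm : 1 ≤ m) (hmH : t ^ m ∈ H)
    (K0 : Subgroup φ.ker) [K0.FiniteIndex] (hK0 : ∀ x ∈ K0, (x : G) ∈ H) : H.FiniteIndex := by
  obtain ⟨T, hT, hcov⟩ := exists_cover_of_finiteIndex K0
  refine H.finiteIndex_of_finite_cover (T := ((fun x : φ.ker => (x : G)) '' T) *
    ((fun n : ℕ => t ^ n) '' Set.Iio m)) ((hT.image _).mul ((Set.finite_Iio m).image _)) fun g => ?_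
  obtain ⟨n, k, hk, rfl⟩ := exists_decomp ht g
  have hm0 : (0 : ℤ) < m := by exact_mod_cast hm
  obtain ⟨r, hr⟩ := Int.eq_ofNat_of_zero_le (Int.emod_nonneg n hm0.ne')
  have hrm : r < m := by
    have := Int.emod_lt_of_pos n hm0
    rw [hr] at this; exact_mod_cast this
  have hn : t ^ n = (t ^ m) ^ (n / m) * t ^ r := by
    rw [← zpow_natCast t r, ← zpow_natCast t m, ← zpow_mul, ← zpow_add]
    congr 1
    have := Int.mul_ediv_add_emod n m
    rw [hr] at this
    exact this.symm
  have hk' : t ^ r * k * (t ^ r)⁻¹ ∈ φ.ker := φ.normal_ker.conj_mem k hk _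
  obtain ⟨τ, hτ, hτ'⟩ := hcov ⟨_, hk'⟩
  refine ⟨_, ⟨_, ⟨τ, hτ, rfl⟩, _, ⟨r, hrm, rfl⟩, rfl⟩, ?_⟩
  have h1 : t ^ n * k * ((τ : G) * t ^ r)⁻¹ =
      (t ^ m) ^ (n / m) * ((t ^ r * k * (t ^ r)⁻¹) * (τ : G)⁻¹) := by
    rw [hn]; group
  simp only
  rw [h1]
  exact H.mul_mem (H.zpow_mem hmH _) (hK0 _ hτ')

theorem not_isOfFinOrder_of_map {A : Type*} [Group A] (f : G →* A) {x : G}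
    (h : ¬ IsOfFinOrder (f x)) : ¬ IsOfFinOrder x := fun hx => h (f.isOfFinOrder hx)

theorem not_isOfFinOrder_ofAdd {n : ℤ} (hn : n ≠ 0) :
    ¬ IsOfFinOrder (Multiplicative.ofAdd n) := by
  rw [isOfFinOrder_iff_pow_eq_one]
  rintro ⟨k, hk, h⟩
  rw [← ofAdd_nsmul] at h
  have : k • n = 0 := h
  simp at this
  omega

/-- A subgroup of finite index with a central element of infinite order. -/
def HasVirtualCenter (G : Type*) [Group G] : Prop :=
  ∃ H : Subgroup G, H.FiniteIndex ∧ ∃ z ∈ H, ¬ IsOfFinOrder z ∧ ∀ h ∈ H, h * z = z * h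

theorem HasVirtualCenter.of_subgroup {G1 : Subgroup G} [G1.FiniteIndex]
    (h : HasVirtualCenter G1) : HasVirtualCenter G := by
  obtain ⟨H, hfi, z, hz, hzi, hc⟩ := h
  refine ⟨H.map G1.subtype, ⟨?_⟩, z, ⟨z, hz, rfl⟩, ?_, ?_⟩
  · rw [Subgroup.index_map_subtype]
    exact mul_ne_zero hfi.index_ne_zero Subgroup.FiniteIndex.index_ne_zero
  · rwa [← G1.subtype_injective.isOfFinOrder_iff] at hzi
  · rintro _ ⟨y, hy, rfl⟩
    exact congrArg Subtype.val (hc y hy)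

theorem GrowthLE.hasVirtualCenter (d : ℕ) : ∀ (G : Type u) [Group G] [Group.FG G] [Infinite G],
    GrowthLE G d → HasVirtualCenter G := by
  induction d with
  | zero => intro G _ _ _ hG; exact absurd hG.finite_of_zero (not_finite_iff_infinite.2 inferInstance)
  | succ d ih =>
    intro G _ _ _ hG0
    obtain ⟨G1, hfi, φ, hφ⟩ := hG0.exists_virtual_hom
    have hG := hG0.subgroup G1
    have : Group.FG G1 := Subgroup.fg_of_index_ne_zero _
    refine HasVirtualCenter.of_subgroup (G1 := G1) ?_
    obtain ⟨t, ht⟩ := hφ (Multiplicative.ofAdd 1)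
    have htinf : ¬ IsOfFinOrder (φ t) := by rw [ht]; exact not_isOfFinOrder_ofAdd one_ne_zero
    rcases finite_or_infinite φ.ker with hfin | hinf
    · obtain ⟨m, hm, hc⟩ := exists_central_of_ker_finite φ t
      refine ⟨⊤, inferInstance, t ^ m, trivial, ?_, fun h _ => ?_⟩
      · rw [isOfFinOrder_pow]
        rintro (h | h)
        · exact not_isOfFinOrder_of_map φ htinf h
        · omega
      · obtain ⟨n, k, hk, rfl⟩ := exists_decomp ht h
        rw [mul_assoc, ← hc k hk, ← mul_assoc, ← mul_assoc]
        congr 1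
        exact ((Commute.refl t).zpow_left n).pow_right m
    · have hKfg : Group.FG φ.ker := hG.fg_ker φ t ht
      have hK : GrowthLE φ.ker d := hG.kernel_step φ.ker.subtype φ.ker.subtype_injective φ
        (fun k => k.2) t htinf
      obtain ⟨N, hN, z, hz, hzi, hzc⟩ := ih φ.ker hK
      obtain ⟨K0, hK0, hK0N, hinv⟩ := exists_invariant_le φ.ker N
      obtain ⟨j, hj, _, hzj⟩ := Subgroup.exists_pow_mem_of_index_ne_zero hK0.index_ne_zero z
      let Z : Subgroup φ.ker := K0 ⊓ Subgroup.centralizer K0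
      let B : Subgroup G1 := Z.map φ.ker.subtype
      obtain ⟨u, hu, hui, m, hm, hum⟩ := hG.exists_fixed B (by
          rintro _ ⟨x, hx, rfl⟩ _ ⟨y, hy, rfl⟩
          have := Subgroup.mem_centralizer_iff.1 hy.2 x hx.1
          exact congrArg Subtype.val this) t (by
          rintro _ ⟨x, hx, rfl⟩
          refine ⟨MulAut.conjNormal t x, ⟨hinv _ x hx.1, ?_⟩, by simp⟩
          refine Subgroup.mem_centralizer_iff.2 fun y hy => ?_
          have h1 := hinv (MulAut.conjNormal t)⁻¹ y hy
          have h2 := Subgroup.mem_centralizer_iff.1 hx.2 _ h1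
          have h3 := congrArg (MulAut.conjNormal t : MulAut φ.ker) h2
          rw [map_mul, map_mul, MulAut.apply_inv_self] at h3
          exact h3) (a := ((z ^ j : φ.ker) : G1)) ⟨z ^ j, ⟨hzj, by
            refine Subgroup.mem_centralizer_iff.2 fun y hy => ?_
            exact ((show Commute y z from hzc y (hK0N hy)).pow_right j)⟩, rfl⟩ (by
          rw [show ((z ^ j : φ.ker) : G1) = φ.ker.subtype (z ^ j) from rfl,
            φ.ker.subtype_injective.isOfFinOrder_iff, isOfFinOrder_pow]
          rintro (h | h)
          · exact hzi h
          · omega)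
      refine ⟨Subgroup.centralizer {u}, ?_, u, ?_, hui, fun h hh => ?_⟩
      · refine finiteIndex_of_ker ht hm ?_ K0 fun x hx => ?_
        · refine Subgroup.mem_centralizer_iff.2 fun y hy => ?_
          rw [Set.mem_singleton_iff.1 hy]
          exact (mul_inv_eq_iff_eq_mul.1 hum).symm
        · refine Subgroup.mem_centralizer_iff.2 fun y hy => ?_
          rw [Set.mem_singleton_iff.1 hy]
          obtain ⟨w, hw, rfl⟩ := hu
          exact (congrArg Subtype.val (Subgroup.mem_centralizer_iff.1 hw.2 x hx)).symm
      · exact Subgroup.mem_centralizer_iff.2 fun y hy => by rw [Set.mem_singleton_iff.1 hy]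
      · exact (Subgroup.mem_centralizer_iff.1 hh u rfl).symm

theorem IsVirtuallyNilpotent.of_finiteIndex {H : Subgroup G} [H.FiniteIndex]
    (h : IsVirtuallyNilpotent H) : IsVirtuallyNilpotent G := by
  obtain ⟨N, hN, hnil⟩ := h
  refine ⟨N.map H.subtype, ⟨?_⟩, ?_⟩
  · rw [Subgroup.index_map_subtype]
    exact mul_ne_zero hN.index_ne_zero Subgroup.FiniteIndex.index_ne_zero
  · exact Group.nilpotent_of_mulEquiv (N.equivMapOfInjective H.subtype H.subtype_injective)

theorem IsVirtuallyNilpotent.of_ker_le_center {Q : Type*} [Group Q] (q : G →* Q)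
    (hker : q.ker ≤ Subgroup.center G) (h : IsVirtuallyNilpotent Q) : IsVirtuallyNilpotent G := by
  obtain ⟨N, hN, hnil⟩ := h
  refine ⟨N.comap q, ⟨?_⟩, ?_⟩
  · rw [Subgroup.index_comap]
    exact fun h => hN.index_ne_zero (Subgroup.index_eq_zero_of_relIndex_eq_zero h)
  refine Subgroup.isNilpotent_of_ker_le_center (q.subgroupComap N) fun x hx => ?_
  have h1 : (x : G) ∈ q.ker := congrArg Subtype.val hx
  refine Subgroup.mem_center_iff.2 fun y => Subtype.ext ?_
  exact Subgroup.mem_center_iff.1 (hker h1) y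

theorem IsVirtuallyNilpotent.of_finite [Finite G] : IsVirtuallyNilpotent G :=
  ⟨⊥, inferInstance, inferInstance⟩

/-- **Gromov's theorem** on groups of polynomial growth. -/
theorem GrowthLE.isVirtuallyNilpotent (d : ℕ) : ∀ (G : Type u) [Group G] [Group.FG G],
    GrowthLE G d → IsVirtuallyNilpotent G := by
  induction d with
  | zero =>
    intro G _ _ hG
    have := hG.finite_of_zero
    exact IsVirtuallyNilpotent.of_finite
  | succ d ih =>
    intro G _ _ hG
    rcases finite_or_infinite G with hfin | hinf
    · exact IsVirtuallyNilpotent.of_finite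
    obtain ⟨H, hfi, z, hz, hzi, hc⟩ := GrowthLE.hasVirtualCenter (d + 1) G hG
    refine IsVirtuallyNilpotent.of_finiteIndex (H := H) ?_
    have hZ : Subgroup.zpowers (⟨z, hz⟩ : H) ≤ Subgroup.center H := by
      rw [Subgroup.zpowers_le]
      exact Subgroup.mem_center_iff.2 fun y => Subtype.ext (hc y y.2)
    have : (Subgroup.zpowers (⟨z, hz⟩ : H)).Normal :=
      ⟨fun n hn g => by
        rw [Subgroup.mem_center_iff.1 (hZ hn) g, mul_inv_cancel_right]
        exact hn⟩
    have : Group.FG H := Subgroup.fg_of_index_ne_zero _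
    refine IsVirtuallyNilpotent.of_ker_le_center
      (QuotientGroup.mk' (Subgroup.zpowers (⟨z, hz⟩ : H))) (by rwa [QuotientGroup.ker_mk']) ?_
    refine ih _ ((hG.subgroup H).quotient_step _ (QuotientGroup.mk'_surjective _) ⟨z, hz⟩ ?_ ?_)
    · rw [← H.subtype_injective.isOfFinOrder_iff]; exact hzi
    · rw [QuotientGroup.mk'_apply, QuotientGroup.eq_one_iff]
      exact Subgroup.mem_zpowers _

end CentralElement

section Covering

/-- `A` is covered by at most `n` closed balls of radius `ρ`. -/
def CoverLE {Y : Type*} [PseudoMetricSpace Y] (A : Set Y) (ρ : ℝ) (n : ℕ) : Prop :=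
  ∃ S : Finset Y, S.card ≤ n ∧ ∀ y ∈ A, ∃ z ∈ S, dist y z ≤ ρ

theorem CoverLE.mono {Y : Type*} [PseudoMetricSpace Y] {A B : Set Y} {ρ : ℝ} {n : ℕ}
    (h : CoverLE B ρ n) (hAB : A ⊆ B) : CoverLE A ρ n := by
  obtain ⟨S, hS, hc⟩ := h
  exact ⟨S, hS, fun y hy => hc y (hAB hy)⟩

open scoped Classical in
theorem CoverLE.trans {Y : Type*} [PseudoMetricSpace Y] {A : Set Y} {ρ ρ' : ℝ} {n m : ℕ}
    (h : CoverLE A ρ n) (h' : ∀ z : Y, CoverLE (closedBall z ρ) ρ' m) : CoverLE A ρ' (n * m) := by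
  obtain ⟨S, hS, hc⟩ := h
  choose T hT hTc using h'
  refine ⟨S.biUnion T, ?_, fun y hy => ?_⟩
  · exact (Finset.card_biUnion_le_card_mul _ _ _ fun z _ => hT z).trans (Nat.mul_le_mul_right _ hS)
  · obtain ⟨z, hz, hyz⟩ := hc y hy
    obtain ⟨w, hw, hyw⟩ := hTc z y hyz
    exact ⟨w, Finset.mem_biUnion.2 ⟨z, hz, hw⟩, hyw⟩

theorem CoverLE.prod {Y Z : Type*} [PseudoMetricSpace Y] [PseudoMetricSpace Z] {A : Set Y}
    {B : Set Z} {ρ : ℝ} {n m : ℕ} (hA : CoverLE A ρ n) (hB : CoverLE B ρ m) :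
    CoverLE (A ×ˢ B) ρ (n * m) := by
  obtain ⟨S, hS, hc⟩ := hA
  obtain ⟨T, hT, hd⟩ := hB
  refine ⟨S ×ˢ T, ?_, fun y hy => ?_⟩
  · rw [Finset.card_product]
    exact Nat.mul_le_mul hS hT
  · obtain ⟨z, hz, hyz⟩ := hc y.1 hy.1
    obtain ⟨w, hw, hyw⟩ := hd y.2 hy.2
    exact ⟨(z, w), Finset.mem_product.2 ⟨hz, hw⟩, max_le hyz hyw⟩

theorem CoverLE.exists_dist_le {Y : Type*} [PseudoMetricSpace Y] {A : Set Y} {ρ : ℝ} {n : ℕ}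
    (h : CoverLE A ρ n) (f : ℕ → Y) (hf : ∀ j ≤ n, f j ∈ A) :
    ∃ i j, i < j ∧ j ≤ n ∧ dist (f i) (f j) ≤ 2 * ρ := by
  obtain ⟨S, hS, hc⟩ := h
  choose! c hcS hcd using hc
  obtain ⟨i, hi, j, hj, hij, he⟩ := Finset.exists_ne_map_eq_of_card_lt_of_maps_to
    (s := Finset.range (n + 1)) (t := S) (f := fun j => c (f j)) (by simp; omega)
    (fun j hj => hcS _ (hf j (by simpa [Nat.lt_succ_iff] using hj)))
  rw [Finset.mem_range] at hi hj
  have key : ∀ i j, i ≤ n → j ≤ n → c (f i) = c (f j) → dist (f i) (f j) ≤ 2 * ρ := by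
    intro i j hi hj he
    have h1 := hcd _ (hf i hi)
    have h2 := hcd _ (hf j hj)
    rw [he] at h1
    linarith [dist_triangle_right (f i) (f j) (c (f j))]
  rcases lt_or_gt_of_ne hij with h | h
  · exact ⟨i, j, h, by omega, key i j (by omega) (by omega) he⟩
  · exact ⟨j, i, h, by omega, key j i (by omega) (by omega) he.symm⟩

variable {X : Type*} [MetricSpace X] {σ : X → X → ℝ → X} {P r₀ : ℝ}

open scoped Classical in
theorem IsPacked.coverLE (h : IsPacked X P r₀) (hr : 0 < r₀) (x : X) :
    CoverLE (closedBall x (3 * r₀)) (2 * r₀) ⌊P⌋₊ := by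
  set Q : Set ℕ := {n | ∃ S : Finset X, (S : Set X) ⊆ closedBall x (3 * r₀) ∧
    (∀ a ∈ S, ∀ b ∈ S, a ≠ b → 2 * r₀ < dist a b) ∧ S.card = n} with hQ
  have hbdd : ∀ n ∈ Q, n ≤ ⌊P⌋₊ := by
    rintro n ⟨S, h1, h2, rfl⟩
    exact Nat.le_floor (h x S h1 h2)
  have hmem : sSup Q ∈ Q := Nat.sSup_mem ⟨0, ∅, by simp, by simp, rfl⟩ ⟨_, hbdd⟩
  obtain ⟨S, h1, h2, h3⟩ := hmem
  refine ⟨S, Nat.le_floor (h x S h1 h2), fun y hy => ?_⟩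
  by_contra! hcon
  have hyS : y ∉ S := fun hyS => by
    have := hcon y hyS
    rw [dist_self] at this
    linarith
  have hin : (insert y S).card ∈ Q := by
    refine ⟨insert y S, ?_, ?_, rfl⟩
    · rw [Finset.coe_insert]
      exact Set.insert_subset hy h1
    · intro a ha b hb hab
      rw [Finset.mem_insert] at ha hb
      rcases ha with rfl | ha <;> rcases hb with rfl | hb
      · exact absurd rfl hab
      · exact hcon b hb
      · rw [dist_comm]; exact hcon a ha
      · exact h2 a ha b hb hab
  have := le_csSup (⟨_, hbdd⟩ : BddAbove Q) hin
  rw [Finset.card_insert_of_notMem hyS] at this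
  omega

theorem IsGCB.dist_source (hσ : IsGCB σ) (x y : X) {t : ℝ} (ht : t ∈ Set.Icc (0 : ℝ) 1) :
    dist x (σ x y t) = t * dist x y := by
  have := hσ.geodesic x y 0 ⟨le_rfl, zero_le_one⟩ t ht
  rwa [hσ.source, zero_sub, abs_neg, abs_of_nonneg ht.1] at this

theorem IsGCB.dist_target (hσ : IsGCB σ) (x y : X) {t : ℝ} (ht : t ∈ Set.Icc (0 : ℝ) 1) :
    dist (σ x y t) y = (1 - t) * dist x y := by
  have := hσ.geodesic x y t ht 1 ⟨zero_le_one, le_rfl⟩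
  rwa [hσ.target, abs_sub_comm, abs_of_nonneg (by linarith [ht.2])] at this

/-- In a GCB-space, packing at a scale propagates to all smaller scales. -/
theorem IsPacked.of_le (hσ : IsGCB σ) (h : IsPacked X P r₀) {r : ℝ} (hr : 0 < r) (hrr : r ≤ r₀) :
    IsPacked X P r := by
  classical
  intro x S hS hsep
  have hk : 1 ≤ r₀ / r := (one_le_div hr).2 hrr
  have hk0 : 0 < r₀ / r := by linarith
  have hext : ∀ a : X, ∃ a' : X, dist x a' = r₀ / r * dist x a ∧ σ x a' (r / r₀) = a := by
    intro a
    obtain ⟨γ, hγ, hγσ, hγx⟩ := hσ.geodComplete x a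
    have h0 : γ 0 = x := by
      rw [← hσ.source x a, hγx 0 ⟨le_rfl, zero_le_one⟩, zero_mul]
    have h1 : γ (dist x a) = a := by
      have := hγx 1 ⟨zero_le_one, le_rfl⟩
      rw [one_mul] at this
      rw [← this, hσ.target]
    have hnn : 0 ≤ r₀ / r * dist x a := by positivity
    refine ⟨γ (r₀ / r * dist x a), ?_, ?_⟩
    · rw [← h0, hγ.dist_eq, h0, Real.dist_eq, zero_sub, abs_neg, abs_of_nonneg hnn]
    · have hr0 : 0 < r₀ := hr.trans_le hrr
      have := hγσ 0 (r₀ / r * dist x a) hnn (r / r₀) ⟨by positivity, (div_le_one hr0).2 hrr⟩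
      rw [h0] at this
      rw [this, show 0 + r / r₀ * (r₀ / r * dist x a - 0) = dist x a by field_simp; ring, h1]
  choose e he1 he2 using hext
  have hinv : r / r₀ = (r₀ / r)⁻¹ := by rw [inv_div]
  have hdist : ∀ a b : X, r₀ / r * dist a b ≤ dist (e a) (e b) := by
    intro a b
    have hr0 : 0 < r₀ := hr.trans_le hrr
    have hl1 : r / r₀ ≤ 1 := (div_le_one hr0).2 hrr
    have hc := (hσ.convex x (e a) x (e b)).2 (Set.left_mem_Icc.2 zero_le_one)
      (Set.right_mem_Icc.2 zero_le_one) (show 0 ≤ 1 - r / r₀ by linarith)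
      (show 0 ≤ r / r₀ by positivity) (by ring)
    simp only [smul_eq_mul, mul_zero, mul_one, zero_add, he2, hσ.source, hσ.target, dist_self] at hc
    rw [hinv] at hc
    exact (le_inv_mul_iff₀ hk0).1 hc
  have hinj : Set.InjOn e S := by
    intro a _ b _ hab
    have := hdist a b
    rw [hab, dist_self] at this
    have h2 : dist a b ≤ 0 := by
      by_contra! hcon
      nlinarith
    exact dist_le_zero.1 h2
  have := h x (S.image e) (by
    rintro _ hy
    obtain ⟨a, ha, rfl⟩ := Finset.mem_image.1 (Finset.mem_coe.1 hy)
    have h1 := hS ha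
    rw [mem_closedBall, dist_comm] at h1 ⊢
    rw [he1]
    calc r₀ / r * dist x a ≤ r₀ / r * (3 * r) := by gcongr
      _ = 3 * r₀ := by field_simp) (by
    intro a' ha b' hb hab
    obtain ⟨a, ha', rfl⟩ := Finset.mem_image.1 ha
    obtain ⟨b, hb', rfl⟩ := Finset.mem_image.1 hb
    refine lt_of_lt_of_le ?_ (hdist a b)
    have := hsep a ha' b hb' (fun h => hab (by rw [h]))
    calc 2 * r₀ = r₀ / r * (2 * r) := by field_simp
      _ < _ := by gcongr)
  rwa [Finset.card_image_of_injOn hinj] at this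

theorem IsPacked.coverLE_closedBall_add (hσ : IsGCB σ) (h : IsPacked X P r₀) (hr : 0 < r₀) (x : X)
    (n : ℕ) : CoverLE (closedBall x ((n + 2) * r₀)) (2 * r₀) (⌊P⌋₊ ^ n) := by
  induction n with
  | zero =>
    refine ⟨{x}, by simp, fun y hy => ⟨x, by simp, ?_⟩⟩
    simpa using hy
  | succ n ih =>
    classical
    obtain ⟨S, hS, hc⟩ := ih
    choose T hT hTc using h.coverLE hr
    refine ⟨S.biUnion T, ?_, fun y hy => ?_⟩
    · rw [pow_succ]
      exact (Finset.card_biUnion_le_card_mul _ _ _ fun z _ => hT z).trans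
        (Nat.mul_le_mul_right _ hS)
    · rw [mem_closedBall, dist_comm] at hy
      push_cast at hy
      have hn : (0 : ℝ) < n + 3 := by positivity
      have ht : ((n : ℝ) + 2) / (n + 3) ∈ Set.Icc (0 : ℝ) 1 :=
        ⟨by positivity, (div_le_one hn).2 (by linarith)⟩
      obtain ⟨z, hz, hyz⟩ := hc (σ x y ((n + 2) / (n + 3))) (by
        rw [mem_closedBall, dist_comm, hσ.dist_source x y ht, div_mul_eq_mul_div, div_le_iff₀ hn]
        nlinarith)
      have h2 := hσ.dist_target x y ht
      have h3 : dist (σ x y ((n + 2) / (n + 3))) y ≤ r₀ := by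
        rw [h2, show 1 - ((n : ℝ) + 2) / (n + 3) = 1 / (n + 3) by field_simp; ring,
          div_mul_eq_mul_div, div_le_iff₀ hn]
        nlinarith
      obtain ⟨w, hw, hyw⟩ := hTc z y (by
        rw [mem_closedBall]
        linarith [dist_triangle_left y z (σ x y ((n + 2) / (n + 3)))])
      exact ⟨w, Finset.mem_biUnion.2 ⟨z, hz, hw⟩, hyw⟩

theorem IsPacked.coverLE_closedBall (hσ : IsGCB σ) (h : IsPacked X P r₀) (hr : 0 < r₀) (x : X)
    {ρ : ℝ} {n : ℕ} (hn : ρ ≤ n * r₀) : CoverLE (closedBall x ρ) (2 * r₀) (⌊P⌋₊ ^ n) :=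
  (h.coverLE_closedBall_add hσ hr x n).mono (closedBall_subset_closedBall (by linarith))

theorem IsPacked.properSpace [CompleteSpace X] (hσ : IsGCB σ) (h : IsPacked X P r₀)
    (hr : 0 < r₀) : ProperSpace X := by
  refine ⟨fun x ρ => TotallyBounded.isCompact_of_isClosed ?_ isClosed_closedBall⟩
  obtain ⟨n, hn⟩ := exists_nat_gt (ρ / r₀)
  have h0 := h.coverLE_closedBall hσ hr x ((div_lt_iff₀ hr).1 hn).le
  have h1 : ∀ k : ℕ, ∃ m, CoverLE (closedBall x ρ) (2 * r₀ * (2 / 3) ^ k) m := by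
    intro k
    induction k with
    | zero => exact ⟨_, by simpa using h0⟩
    | succ k ih =>
      obtain ⟨m, hm⟩ := ih
      have hk : 0 < r₀ * (2 / 3) ^ (k + 1) := by positivity
      have hp := (h.of_le hσ hk (mul_le_of_le_one_right hr.le
        (pow_le_one₀ (by norm_num) (by norm_num)))).coverLE hk
      refine ⟨_, hm.trans (m := ⌊P⌋₊) fun z => ?_⟩
      have := hp z
      rwa [show 3 * (r₀ * (2 / 3) ^ (k + 1)) = 2 * r₀ * (2 / 3) ^ k by ring, ← mul_assoc] at this
  rw [Metric.totallyBounded_iff]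
  intro ε hε
  obtain ⟨k, hk⟩ := exists_pow_lt_of_lt_one (show 0 < ε / (2 * r₀) by positivity)
    (show (2 / 3 : ℝ) < 1 by norm_num)
  obtain ⟨m, S, hS, hc⟩ := h1 k
  refine ⟨S, S.finite_toSet, fun y hy => ?_⟩
  obtain ⟨z, hz, hyz⟩ := hc y hy
  refine Set.mem_iUnion₂.2 ⟨z, hz, hyz.trans_lt ?_⟩
  rw [lt_div_iff₀ (by positivity)] at hk
  linarith

end Covering

section RaySection

open scoped Topology

variable {X : Type*} [MetricSpace X] {σ : X → X → ℝ → X} {Γ : Subgroup (X ≃ᵢ X)}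

theorem IsDiscreteSubgroup.card_le (hΓ : IsDiscreteSubgroup Γ) {x : X} {ρ ρ' : ℝ} {n : ℕ}
    (h : CoverLE (closedBall x ρ) ρ' n) (T : Finset (X ≃ᵢ X)) (hT : ∀ γ ∈ T, γ ∈ Γ)
    (hTd : ∀ γ ∈ T, dist x (γ x) ≤ ρ) : T.card ≤ (hΓ x (2 * ρ')).toFinset.card * n := by
  classical
  obtain ⟨S, hS, hc⟩ := h
  choose! c hcS hcd using hc
  have hmem : ∀ γ ∈ T, γ x ∈ closedBall x ρ := fun γ hγ => by
    rw [mem_closedBall, dist_comm]; exact hTd γ hγ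
  refine (Finset.card_le_mul_card_image_of_maps_to (f := fun γ : X ≃ᵢ X => c (γ x)) (t := S)
    (fun γ hγ => hcS _ (hmem γ hγ)) (hΓ x (2 * ρ')).toFinset.card fun z hz => ?_).trans
    (Nat.mul_le_mul_left _ hS)
  rcases (T.filter fun γ : X ≃ᵢ X => c (γ x) = z).eq_empty_or_nonempty with he | ⟨γ₀, hγ₀⟩
  · rw [he]; simp
  · rw [Finset.mem_filter] at hγ₀
    refine Finset.card_le_card_of_injOn (fun γ => γ₀⁻¹ * γ) (fun γ hγ => ?_)
      (fun _ _ _ _ h => mul_left_cancel h)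
    have hγ := Finset.mem_filter.1 (Finset.mem_coe.1 hγ)
    rw [Finset.mem_coe, Set.Finite.mem_toFinset]
    refine ⟨Γ.mul_mem (Γ.inv_mem (hT _ hγ₀.1)) (hT _ hγ.1), ?_⟩
    have h1 := hcd _ (hmem γ hγ.1)
    have h2 := hcd _ (hmem γ₀ hγ₀.1)
    rw [hγ.2] at h1
    rw [hγ₀.2] at h2
    rw [← γ₀.dist_eq, IsometryEquiv.mul_apply, IsometryEquiv.apply_inv_self]
    linarith [dist_triangle_right (γ₀ x) (γ x) z]

/-- A geodesic ray along which all displacement functions of `Γ` are convex. -/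
structure IsConvexRay (Γ : Subgroup (X ≃ᵢ X)) (r : ℝ → X) : Prop where
  dist_eq : ∀ s t, 0 ≤ s → 0 ≤ t → dist (r s) (r t) = |s - t|
  convexOn : ∀ b ∈ Γ, ConvexOn ℝ (Set.Ici 0) fun t => dist (r t) (b (r t))

theorem IsDiscreteSubgroup.tendsto_dist_pow (hΓ : IsDiscreteSubgroup Γ) {g : X ≃ᵢ X} (hg : g ∈ Γ)
    (hinf : ¬ IsOfFinOrder g) (x : X) : Tendsto (fun n : ℕ => dist x ((g ^ n) x)) atTop atTop := by
  rw [Filter.tendsto_atTop]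
  intro R
  have hinj : Function.Injective fun n : ℕ => g ^ n := injective_pow_iff_not_isOfFinOrder.2 hinf
  have hfin : {n : ℕ | dist x ((g ^ n) x) ≤ R}.Finite :=
    ((hΓ x R).preimage hinj.injOn).subset fun n hn => ⟨Γ.pow_mem hg n, hn⟩
  rw [← Nat.cofinite_eq_atTop]
  filter_upwards [hfin.compl_mem_cofinite] with n hn
  exact (not_le.1 (show ¬ dist x ((g ^ n) x) ≤ R from hn)).le

theorem IsGCB.convexOn_dist_apply (hσ : IsGCB σ) {b : X ≃ᵢ X} (hb : IsSigmaIsometry σ b) {x y : X}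
    (hd : 0 < dist x y) :
    ConvexOn ℝ (Set.Icc 0 (dist x y)) fun t => dist (σ x y (t / dist x y))
      (b (σ x y (t / dist x y))) := by
  have hmem : ∀ t ∈ Set.Icc 0 (dist x y), t / dist x y ∈ Set.Icc (0 : ℝ) 1 := fun t ht =>
    ⟨div_nonneg ht.1 hd.le, (div_le_one hd).2 ht.2⟩
  refine ⟨convex_Icc _ _, fun s hs t ht a c ha hc hac => ?_⟩
  have hst := convex_Icc 0 (dist x y) hs ht ha hc hac
  have h := (hσ.convex x y (b x) (b y)).2 (hmem s hs) (hmem t ht) ha hc hac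
  simp only [smul_eq_mul] at h hst ⊢
  rw [hb _ _ _ (hmem s hs), hb _ _ _ (hmem t ht), hb _ _ _ (hmem _ hst), add_div, mul_div_assoc,
    mul_div_assoc]
  exact h

theorem exists_isConvexRay [ProperSpace X] (hσ : IsGCB σ) (hΓσ : ∀ g ∈ Γ, IsSigmaIsometry σ g)
    (hΓ : IsDiscreteSubgroup Γ) {g : X ≃ᵢ X} (hg : g ∈ Γ) (hinf : ¬ IsOfFinOrder g) (x : X) :
    ∃ r : ℝ → X, IsConvexRay Γ r ∧ r 0 = x ∧
      ∀ t, 0 ≤ t → dist (r t) (g (r t)) ≤ dist x (g x) := by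
  set d : ℕ → ℝ := fun n => dist x ((g ^ n) x) with hd
  have hdlim : Tendsto d atTop atTop := hΓ.tendsto_dist_pow hg hinf x
  set c : ℕ → ℝ → X := fun n t => σ x ((g ^ n) x) (t / d n) with hc
  set ω : Ultrafilter ℕ := hyperfilter ℕ with hω
  have hωle : (ω : Filter ℕ) ≤ atTop := by
    rw [← Nat.cofinite_eq_atTop]; exact hyperfilter_le_cofinite
  have hev : ∀ t : ℝ, ∀ᶠ n in (ω : Filter ℕ), t ≤ d n ∧ 0 < d n := fun t =>
    hωle ((hdlim.eventually_ge_atTop t).and (hdlim.eventually_gt_atTop 0))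
  have hmem : ∀ n t, 0 ≤ t → t ≤ d n → 0 < d n → t / d n ∈ Set.Icc (0 : ℝ) 1 :=
    fun n t h0 h1 h2 => ⟨div_nonneg h0 h2.le, (div_le_one h2).2 h1⟩
  have hlim : ∀ t : ℝ, ∃ z : X, 0 ≤ t → Tendsto (fun n => c n t) ω (𝓝 z) := by
    intro t
    by_cases ht : 0 ≤ t
    · have hcpt := isCompact_closedBall x t
      have hle : ((ω.map fun n => c n t : Ultrafilter X) : Filter X) ≤ 𝓟 (closedBall x t) := by
        rw [le_principal_iff, Ultrafilter.coe_map, mem_map]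
        filter_upwards [hev t] with n hn
        rw [Set.mem_preimage, mem_closedBall, dist_comm,
          hσ.dist_source _ _ (hmem n t ht hn.1 hn.2), div_mul_cancel₀ _ hn.2.ne']
      obtain ⟨z, _, hz⟩ := hcpt.ultrafilter_le_nhds _ hle
      exact ⟨z, fun _ => hz⟩
    · exact ⟨x, fun h => absurd h ht⟩
  choose r hr using hlim
  refine ⟨r, ⟨fun s t hs ht => ?_, fun b hb => ⟨convex_Ici 0, fun s hs t ht a e ha he hae => ?_⟩⟩,
    ?_, fun t ht => ?_⟩
  · refine tendsto_nhds_unique ((hr s hs).dist (hr t ht)) (tendsto_const_nhds.congr' ?_)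
    filter_upwards [hev s, hev t] with n hn hn'
    rw [hσ.geodesic _ _ _ (hmem n s hs hn.1 hn.2) _ (hmem n t ht hn'.1 hn.2), ← sub_div, abs_div,
      abs_of_pos hn.2, div_mul_cancel₀ _ hn.2.ne']
  · have hst := convex_Ici (0 : ℝ) hs ht ha he hae
    have hT : ∀ t, 0 ≤ t → Tendsto (fun n => dist (c n t) (b (c n t))) ω
        (𝓝 (dist (r t) (b (r t)))) := fun t ht =>
      (hr t ht).dist ((b.continuous.tendsto _).comp (hr t ht))
    refine le_of_tendsto_of_tendsto (hT _ hst) (((hT s hs).const_mul a).add ((hT t ht).const_mul e))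
      ?_
    filter_upwards [hev s, hev t] with n hn hn'
    exact (hσ.convexOn_dist_apply (hΓσ b hb) hn.2).2 ⟨hs, hn.1⟩ ⟨ht, hn'.1⟩ ha he hae
  · refine tendsto_nhds_unique (hr 0 le_rfl) (tendsto_const_nhds.congr fun n => ?_)
    rw [hc]
    simp only [zero_div, hσ.source]
  · refine le_of_tendsto ((hr t ht).dist ((g.continuous.tendsto _).comp (hr t ht))) ?_
    filter_upwards [hev t] with n hn
    have h := (hσ.convexOn_dist_apply (hΓσ g hg) hn.2).le_max_of_mem_Icc
      (Set.left_mem_Icc.2 hn.2.le) (Set.right_mem_Icc.2 hn.2.le) ⟨ht, hn.1⟩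
    refine h.trans (max_le ?_ ?_)
    · rw [zero_div, hσ.source]
    · rw [div_self hn.2.ne', hσ.target, ← IsometryEquiv.mul_apply, ← pow_succ', pow_succ,
        IsometryEquiv.mul_apply, IsometryEquiv.dist_eq]


end RaySection

section RayStabilizer

variable {X : Type*} [MetricSpace X] {Γ : Subgroup (X ≃ᵢ X)} {r : ℝ → X}

theorem dist_mul_apply_le (a b : X ≃ᵢ X) (y : X) :
    dist y ((a * b) y) ≤ dist y (a y) + dist y (b y) := by
  rw [IsometryEquiv.mul_apply]
  have := dist_triangle y (a y) (a (b y))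
  rwa [a.dist_eq] at this

theorem dist_inv_apply (a : X ≃ᵢ X) (y : X) : dist y (a⁻¹ y) = dist y (a y) := by
  rw [← a.dist_eq, IsometryEquiv.apply_inv_self, dist_comm]

theorem dist_conj_apply (a b : X ≃ᵢ X) (y : X) :
    dist y ((b * a * b⁻¹) y) = dist (b⁻¹ y) (a (b⁻¹ y)) := by
  rw [← b.dist_eq (b⁻¹ y), IsometryEquiv.apply_inv_self, IsometryEquiv.mul_apply,
    IsometryEquiv.mul_apply]

theorem dist_pow_pow_apply (a : X ≃ᵢ X) {i j : ℕ} (hij : i ≤ j) (y : X) :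
    dist ((a ^ i) y) ((a ^ j) y) = dist y ((a ^ (j - i)) y) := by
  obtain ⟨k, rfl⟩ := exists_add_of_le hij
  rw [pow_add, IsometryEquiv.mul_apply, IsometryEquiv.dist_eq, Nat.add_sub_cancel_left]

theorem dist_pow_apply_le (a : X ≃ᵢ X) (n : ℕ) (y : X) :
    dist y ((a ^ n) y) ≤ n * dist y (a y) := by
  induction n with
  | zero => simp
  | succ n ih =>
    rw [pow_succ]
    refine (dist_mul_apply_le _ _ _).trans ?_
    push_cast
    linarith

/-- The elements of `Γ` fixing the endpoint of the ray `r`. -/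
def rayStab (Γ : Subgroup (X ≃ᵢ X)) (r : ℝ → X) : Subgroup (X ≃ᵢ X) where
  carrier := {b | b ∈ Γ ∧ ∃ B, ∀ t, 0 ≤ t → dist (r t) (b (r t)) ≤ B}
  one_mem' := ⟨Γ.one_mem, 0, fun t _ => by simp⟩
  mul_mem' := by
    rintro a b ⟨ha, A, hA⟩ ⟨hb, B, hB⟩
    exact ⟨Γ.mul_mem ha hb, A + B, fun t ht =>
      (dist_mul_apply_le a b _).trans (add_le_add (hA t ht) (hB t ht))⟩
  inv_mem' := by
    rintro a ⟨ha, A, hA⟩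
    exact ⟨Γ.inv_mem ha, A, fun t ht => by rw [dist_inv_apply]; exact hA t ht⟩

theorem IsConvexRay.mem_rayStab (hr : IsConvexRay Γ r) {b : X ≃ᵢ X} (hb : b ∈ Γ) (B : ℝ)
    (h : ∀ T : ℝ, 0 ≤ T → ∃ t, T ≤ t ∧ dist (r t) (b (r t)) ≤ B) : b ∈ rayStab Γ r := by
  refine ⟨hb, max (dist (r 0) (b (r 0))) B, fun s hs => ?_⟩
  obtain ⟨t, hst, ht⟩ := h s hs
  exact ((hr.convexOn b hb).le_max_of_mem_Icc (Set.mem_Ici.2 le_rfl) (Set.mem_Ici.2 (hs.trans hst))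
    ⟨hs, hst⟩).trans (max_le_max le_rfl ht)

theorem IsConvexRay.antitone (hr : IsConvexRay Γ r) {b : X ≃ᵢ X} (hb : b ∈ rayStab Γ r) {s t : ℝ}
    (hs : 0 ≤ s) (hst : s ≤ t) : dist (r t) (b (r t)) ≤ dist (r s) (b (r s)) := by
  obtain ⟨hbΓ, B, hB⟩ := hb
  by_contra! hlt
  set e := dist (r t) (b (r t)) - dist (r s) (b (r s)) with he
  have he0 : 0 < e := sub_pos.2 hlt
  obtain ⟨m, hm⟩ := exists_nat_gt ((B - dist (r s) (b (r s))) / e)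
  rw [div_lt_iff₀ he0] at hm
  have hm' : (0 : ℝ) < m + 1 := by positivity
  have hu : 0 ≤ s + (m + 1) * (t - s) := by
    have := mul_nonneg hm'.le (sub_nonneg.2 hst)
    linarith
  have h := (hr.convexOn b hbΓ).2 (Set.mem_Ici.2 hs) (Set.mem_Ici.2 hu)
    (show (0 : ℝ) ≤ 1 - 1 / (m + 1) by
      rw [sub_nonneg, div_le_one hm']; linarith [(Nat.cast_nonneg m : (0 : ℝ) ≤ m)])
    (show (0 : ℝ) ≤ 1 / (m + 1) by positivity) (by ring)
  simp only [smul_eq_mul] at h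
  rw [show (1 - 1 / (m + 1 : ℝ)) * s + 1 / (m + 1 : ℝ) * (s + (m + 1) * (t - s)) = t by
    field_simp; ring] at h
  have h2 := hB _ hu
  have h3 : (m + 1 : ℝ) * dist (r t) (b (r t)) ≤ m * dist (r s) (b (r s)) +
      dist (r (s + (m + 1) * (t - s))) (b (r (s + (m + 1) * (t - s)))) := by
    calc _ ≤ (m + 1 : ℝ) * _ := mul_le_mul_of_nonneg_left h hm'.le
      _ = _ := by field_simp; ring
  nlinarith

/-- Elements with small displacement at the origin of the ray lie in any set `E` containing the
stabilizer of the endpoint and stable under conjugation roots relative to `g`. -/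
theorem IsConvexRay.mem_of_dist_le (hr : IsConvexRay Γ r) (hΓ : IsDiscreteSubgroup Γ)
    {E : Set (X ≃ᵢ X)} (hE : ∀ b ∈ rayStab Γ r, b ∈ E) {g : X ≃ᵢ X} (hg : g ∈ Γ)
    (hconj : ∀ b ∈ Γ, ∀ i : ℕ, 1 ≤ i → b * g ^ i * b⁻¹ ∈ E → b ∈ E) {ε r₀ : ℝ}
    (hgε : ∀ t, 0 ≤ t → dist (r t) (g (r t)) ≤ ε) {n : ℕ}
    (hcov : ∀ y : X, CoverLE (closedBall y (4 * r₀ + 2)) (2 * r₀) n) (hε : (n * n : ℕ) * ε ≤ 1)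
    {b : X ≃ᵢ X} (hb : b ∈ Γ) (hbd : dist (r 0) (b (r 0)) ≤ 4 * r₀) : b ∈ E := by
  by_contra hbE
  have hε0 : 0 ≤ ε := dist_nonneg.trans (hgε 0 le_rfl)
  set F : Set (X ≃ᵢ X) := {b | (b ∈ Γ ∧ dist (r 0) (b (r 0)) ≤ 4 * r₀) ∧ b ∉ E} with hF
  have hFfin : F.Finite := (hΓ (r 0) (4 * r₀)).subset fun b hb => hb.1
  set A : Set ℝ := ⋃ b ∈ F, {t | 0 ≤ t ∧ dist (r t) (b (r t)) ≤ 4 * r₀} with hA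
  have hAbdd : BddAbove A := by
    refine hFfin.bddAbove_biUnion.2 fun b hb => ?_
    by_contra hcon
    refine hb.2 (hE b (hr.mem_rayStab hb.1.1 (4 * r₀) fun T _ => ?_))
    obtain ⟨t, ht, hTt⟩ := not_bddAbove_iff.1 hcon T
    exact ⟨t, hTt.le, ht.2⟩
  have hAne : A.Nonempty :=
    ⟨0, Set.mem_iUnion₂.2 ⟨b, ⟨⟨hb, hbd⟩, hbE⟩, le_rfl, hbd⟩⟩
  obtain ⟨t, htA, htlt⟩ := exists_lt_of_lt_csSup hAne (show sSup A - 1 < sSup A by linarith)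
  obtain ⟨c, hcF, ht0, hct⟩ := Set.mem_iUnion₂.1 htA
  have hpow : ∀ s, 0 ≤ s → ∀ j ≤ n * n, dist (r s) ((g ^ j) (r s)) ≤ 1 := fun s hs j hj =>
    (dist_pow_apply_le g j _).trans <| (mul_le_mul (Nat.cast_le.2 hj) (hgε s hs) dist_nonneg
      (Nat.cast_nonneg _)).trans hε
  obtain ⟨i, j, hij, hj, hd⟩ := ((hcov (r 0)).prod (hcov (r t))).exists_dist_le
    (fun j => ((g ^ j) (c⁻¹ (r 0)), (g ^ j) (c⁻¹ (r (t + 1))))) fun j hj => by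
      constructor
      · have h1 := hpow 0 le_rfl j hj
        have h2 := dist_inv_apply c (r 0)
        have h3 := dist_triangle (r 0) ((g ^ j) (r 0)) ((g ^ j) (c⁻¹ (r 0)))
        rw [(g ^ j).dist_eq] at h3
        rw [mem_closedBall, dist_comm]
        linarith [hcF.1.2]
      · have h1 := hpow t ht0 j hj
        have h2 := dist_inv_apply c (r t)
        have h3 := dist_triangle (r t) ((g ^ j) (r t)) ((g ^ j) (c⁻¹ (r (t + 1))))
        rw [(g ^ j).dist_eq] at h3
        have h4 := dist_triangle (r t) (c⁻¹ (r t)) (c⁻¹ (r (t + 1)))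
        rw [(c⁻¹).dist_eq, hr.dist_eq t (t + 1) ht0 (by linarith), sub_add_cancel_left, abs_neg,
          abs_one] at h4
        rw [mem_closedBall, dist_comm]
        linarith
  rw [Prod.dist_eq, max_le_iff, dist_pow_pow_apply g hij.le,
    dist_pow_pow_apply g hij.le, ← dist_conj_apply, ← dist_conj_apply] at hd
  have hmem : t + 1 ∈ A := by
    refine Set.mem_iUnion₂.2 ⟨c * g ^ (j - i) * c⁻¹, ⟨⟨?_, ?_⟩, fun h => ?_⟩, by linarith, ?_⟩
    · exact Γ.mul_mem (Γ.mul_mem hcF.1.1 (Γ.pow_mem hg _)) (Γ.inv_mem hcF.1.1)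
    · linarith [hd.1]
    · exact hcF.2 (hconj c hcF.1.1 (j - i) (by omega) h)
    · linarith [hd.2]
  linarith [le_csSup hAbdd hmem]

theorem IsConvexRay.mem_of_dist_le' (hr : IsConvexRay Γ r) (hΓ : IsDiscreteSubgroup Γ)
    {E : Set (X ≃ᵢ X)} (hE : ∀ b ∈ rayStab Γ r, b ∈ E) {g : X ≃ᵢ X} (hg : g ∈ Γ)
    (hconj : ∀ b ∈ Γ, ∀ i : ℕ, 1 ≤ i → b * g ^ i * b⁻¹ ∈ E → b ∈ E) {ε r₀ : ℝ}
    (hgε : ∀ t, 0 ≤ t → dist (r t) (g (r t)) ≤ ε) {n : ℕ}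
    (hcov : ∀ y : X, CoverLE (closedBall y (4 * r₀ + 2)) (2 * r₀) n) (hε : (n * n : ℕ) * ε ≤ 1)
    {m : ℕ} {R : ℝ} (hcovR : CoverLE (closedBall (r 0) (R + 1)) (2 * r₀) m) (hmε : m * ε ≤ 1)
    {b : X ≃ᵢ X} (hb : b ∈ Γ) (hbd : dist (r 0) (b (r 0)) ≤ R) : b ∈ E := by
  obtain ⟨i, j, hij, hj, hd⟩ := hcovR.exists_dist_le (fun j => (g ^ j) (b⁻¹ (r 0))) fun j hj => by
    have h1 : dist (r 0) ((g ^ j) (r 0)) ≤ 1 :=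
      (dist_pow_apply_le g j _).trans <| (mul_le_mul (Nat.cast_le.2 hj) (hgε 0 le_rfl) dist_nonneg
        (Nat.cast_nonneg _)).trans hmε
    have h2 := dist_inv_apply b (r 0)
    have h3 := dist_triangle (r 0) ((g ^ j) (r 0)) ((g ^ j) (b⁻¹ (r 0)))
    rw [(g ^ j).dist_eq] at h3
    rw [mem_closedBall, dist_comm]
    linarith
  rw [dist_pow_pow_apply g hij.le, ← dist_conj_apply] at hd
  refine hconj b hb (j - i) (by omega) (hr.mem_of_dist_le hΓ hE hg hconj hgε hcov hε ?_ ?_)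
  · exact Γ.mul_mem (Γ.mul_mem hb (Γ.pow_mem hg _)) (Γ.inv_mem hb)
  · linarith

end RayStabilizer

section Parabolic

variable {X : Type*} [MetricSpace X] {Γ : Subgroup (X ≃ᵢ X)} {r : ℝ → X} {δ : ℝ}

theorem IsConvexRay.dist_zero (hr : IsConvexRay Γ r) {t : ℝ} (ht : 0 ≤ t) :
    dist (r 0) (r t) = t := by
  rw [hr.dist_eq 0 t le_rfl ht, zero_sub, abs_neg, abs_of_nonneg ht]

/-- If `b` does not fix the endpoint of `r`, the rays `r` and `b⁻¹ r` diverge. -/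
theorem IsConvexRay.exists_gromovProduct_le (hr : IsConvexRay Γ r) (hδ : IsDeltaHyperbolic X δ)
    (hδ0 : 0 ≤ δ)
    {b : X ≃ᵢ X} (hb : b ∈ Γ) (hbr : b ∉ rayStab Γ r) :
    ∃ T : ℝ, 0 ≤ T ∧ ∀ t t', 0 ≤ t → 0 ≤ t' →
      t + dist (r 0) (b⁻¹ (r t')) ≤ dist (r t) (b⁻¹ (r t')) + 2 * T := by
  by_contra! hcon
  set d := dist (r 0) (b⁻¹ (r 0)) with hd
  have hd0 : 0 ≤ d := dist_nonneg
  refine hbr ⟨hb, 3 * d + 4 * δ, fun S hS => ?_⟩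
  rw [← dist_inv_apply]
  obtain ⟨t, t', ht, ht', h⟩ := hcon (S + d) (by linarith)
  have e0t := hr.dist_zero ht
  have e0S := hr.dist_zero hS
  have f0t : dist (b⁻¹ (r 0)) (b⁻¹ (r t')) = t' := by rw [(b⁻¹).dist_eq, hr.dist_zero ht']
  have f0S : dist (b⁻¹ (r 0)) (b⁻¹ (r S)) = S := by rw [(b⁻¹).dist_eq, hr.dist_zero hS]
  have tri1 := dist_triangle (r 0) (r t) (b⁻¹ (r t'))
  have tri1' := dist_triangle (r 0) (b⁻¹ (r t')) (r t)
  have tri2 := dist_triangle (r 0) (b⁻¹ (r 0)) (b⁻¹ (r t'))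
  have tri2' := dist_triangle_left (b⁻¹ (r 0)) (b⁻¹ (r t')) (r 0)
  have tri3 := dist_triangle (r 0) (b⁻¹ (r 0)) (b⁻¹ (r S))
  have tri3' := dist_triangle (b⁻¹ (r 0)) (r 0) (b⁻¹ (r S))
  rw [dist_comm (b⁻¹ (r t')) (r t)] at tri1'
  rw [dist_comm (b⁻¹ (r 0)) (r 0)] at tri3'
  have hSt : S ≤ t := by linarith
  have hSt' : S ≤ t' := by linarith
  have eSt : dist (r S) (r t) = t - S := by
    rw [hr.dist_eq S t hS ht, abs_sub_comm, abs_of_nonneg (by linarith)]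
  have fSt : dist (b⁻¹ (r S)) (b⁻¹ (r t')) = t' - S := by
    rw [(b⁻¹).dist_eq, hr.dist_eq S t' hS ht', abs_sub_comm, abs_of_nonneg (by linarith)]
  have q1 := hδ (r S) (b⁻¹ (r t')) (r 0) (r t)
  have q2 := hδ (r S) (b⁻¹ (r S)) (r 0) (b⁻¹ (r t'))
  rw [dist_comm (r S) (r 0), e0S, e0t, eSt, dist_comm (b⁻¹ (r t')) (r t),
    dist_comm (b⁻¹ (r t')) (r 0)] at q1
  rw [dist_comm (r S) (r 0), e0S, fSt, dist_comm (b⁻¹ (r S)) (r 0)] at q2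
  rcases max_cases (S + dist (r t) (b⁻¹ (r t'))) (t - S + dist (r 0) (b⁻¹ (r t'))) with h1 | h1 <;>
  rcases max_cases (S + (t' - S)) (dist (r S) (b⁻¹ (r t')) + dist (r 0) (b⁻¹ (r S)))
    with h2 | h2 <;> linarith

theorem IsConvexRay.mem_rayStab_of_conj (hr : IsConvexRay Γ r) (hδ : IsDeltaHyperbolic X δ)
    (hδ0 : 0 ≤ δ)
    (hΓ : IsDiscreteSubgroup Γ) {C₀ : ℝ}
    (hC₀ : ∀ b ∈ rayStab Γ r, ∃ t, 0 ≤ t ∧ dist (r t) (b (r t)) ≤ C₀) {g : X ≃ᵢ X}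
    (hg : g ∈ rayStab Γ r) (hinf : ¬ IsOfFinOrder g) {b : X ≃ᵢ X} (hb : b ∈ Γ) {i : ℕ}
    (hi : 1 ≤ i) (hbi : b * g ^ i * b⁻¹ ∈ rayStab Γ r) : b ∈ rayStab Γ r := by
  by_contra hbr
  obtain ⟨T, hT0, hT⟩ := hr.exists_gromovProduct_le hδ hδ0 hb hbr
  have hinf' : ¬ IsOfFinOrder (g ^ i) := by
    rw [isOfFinOrder_pow]; rintro (h | h) <;> [exact hinf h; omega]
  have hbdd : ∀ n : ℕ, dist (r 0) (((g ^ i) ^ n) (r 0)) ≤ 2 * T + C₀ + 2 * δ := by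
    intro n
    set γ := (g ^ i) ^ n with hγ
    have hγm : γ ∈ rayStab Γ r := Subgroup.pow_mem _ (Subgroup.pow_mem _ hg _) _
    have hγb : b * γ * b⁻¹ ∈ rayStab Γ r := by
      rw [hγ, ← conj_pow]; exact Subgroup.pow_mem _ hbi _
    obtain ⟨t, ht, hu⟩ := hC₀ _ hγm
    obtain ⟨t', ht', hv⟩ := hC₀ _ hγb
    rw [dist_conj_apply] at hv
    have h1 := hT t t' ht ht'
    have e0t := hr.dist_zero ht
    have h2 := hδ (r 0) (γ (r 0)) (r t) (b⁻¹ (r t'))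
    have h3 := dist_triangle (γ (r 0)) (γ (r t)) (r t)
    have h4 := dist_triangle (γ (r 0)) (γ (b⁻¹ (r t'))) (b⁻¹ (r t'))
    rw [γ.dist_eq, dist_comm (γ (r t)) (r t)] at h3
    rw [γ.dist_eq, dist_comm (γ (b⁻¹ (r t'))) (b⁻¹ (r t'))] at h4
    have h5 : max (dist (r 0) (r t) + dist (γ (r 0)) (b⁻¹ (r t')))
        (dist (r 0) (b⁻¹ (r t')) + dist (γ (r 0)) (r t)) ≤
        t + dist (r 0) (b⁻¹ (r t')) + C₀ := max_le (by linarith) (by linarith)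
    linarith
  obtain ⟨n, hn⟩ := ((hΓ.tendsto_dist_pow (Γ.pow_mem hg.1 i) hinf' (r 0)).eventually_gt_atTop
    (2 * T + C₀ + 2 * δ)).exists
  exact absurd (hbdd n) (not_le.2 hn)

theorem IsConvexRay.dist_le_of_dist_le (hr : IsConvexRay Γ r) (hδ : IsDeltaHyperbolic X δ)
    (hδ0 : 0 ≤ δ)
    {C₀ C₁ : ℝ} (hC₀ : ∀ b ∈ rayStab Γ r, ∃ t, 0 ≤ t ∧ dist (r t) (b (r t)) ≤ C₀)
    {b : X ≃ᵢ X} (hb : b ∈ rayStab Γ r) {t c : ℝ} (ht : 0 ≤ t) (hc : C₁ + C₀ ≤ c)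
    (hC₀0 : 0 ≤ C₀) (hC₁0 : 0 ≤ C₁) (hbt : dist (r t) (b (r t)) ≤ 2 * C₁) :
    dist (r (t + c)) (b (r (t + c))) ≤ 3 * C₀ + 4 * δ := by
  obtain ⟨p, hp0, hp⟩ := hC₀ b hb
  have hs : 0 ≤ max p (t + c) := hp0.trans (le_max_left _ _)
  have hpp := (hr.antitone hb hp0 (le_max_left p (t + c))).trans hp
  set s := max p (t + c) with hsdef
  have hts : t + c ≤ s := le_max_right _ _
  have hc0 : 0 ≤ c := by linarith
  have d1 : dist (r t) (r s) = s - t := by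
    rw [hr.dist_eq t s ht hs, abs_sub_comm, abs_of_nonneg (by linarith)]
  have d2 : dist (r (t + c)) (r s) = s - t - c := by
    rw [hr.dist_eq _ s (by linarith) hs, abs_sub_comm, abs_of_nonneg (by linarith)]; ring
  have d3 : dist (r t) (r (t + c)) = c := by
    rw [hr.dist_eq t _ ht (by linarith), abs_sub_comm, abs_of_nonneg (by linarith)]; ring
  have e1 : dist (b (r t)) (b (r s)) = s - t := by rw [b.dist_eq, d1]
  have e2 : dist (b (r (t + c))) (b (r s)) = s - t - c := by rw [b.dist_eq, d2]
  have e3 : dist (b (r t)) (b (r (t + c))) = c := by rw [b.dist_eq, d3]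
  have t1 := dist_triangle (b (r t)) (b (r s)) (r s)
  have t2 := dist_triangle (b (r (t + c))) (b (r s)) (r s)
  have t3 := dist_triangle (b (r t)) (r s) (b (r s))
  have t4 := dist_triangle (b (r (t + c))) (r s) (b (r s))
  rw [dist_comm (b (r s)) (r s)] at t1 t2
  have q1 := hδ (r (t + c)) (b (r t)) (r s) (r t)
  have q2 := hδ (r (t + c)) (b (r (t + c))) (r s) (b (r t))
  rw [d2, dist_comm (b (r t)) (r t), dist_comm (r (t + c)) (r t), d3, dist_comm (r s) (r t), d1] at q1
  rw [d2, dist_comm (r s) (b (r t)), dist_comm (b (r (t + c))) (b (r t)), e3] at q2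
  rcases max_cases (s - t - c + dist (r t) (b (r t))) (c + dist (b (r t)) (r s)) with h1 | h1 <;>
  rcases max_cases (s - t - c + c)
    (dist (r (t + c)) (b (r t)) + dist (b (r (t + c))) (r s)) with h2 | h2 <;> linarith

end Parabolic

section ParabolicGrowth

open scoped Pointwise

variable {X : Type*} [MetricSpace X] {Γ : Subgroup (X ≃ᵢ X)} {r : ℝ → X} {δ : ℝ}

theorem IsConvexRay.dist_zero_le (hr : IsConvexRay Γ r) (b : X ≃ᵢ X) {t : ℝ} (ht : 0 ≤ t) :
    dist (r 0) (b (r 0)) ≤ 2 * t + dist (r t) (b (r t)) := by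
  have h1 := dist_triangle4 (r 0) (r t) (b (r t)) (b (r 0))
  rw [b.dist_eq, dist_comm (r t) (r 0), hr.dist_zero ht] at h1
  linarith

theorem IsConvexRay.exists_dist_le_of_mem_pow (hr : IsConvexRay Γ r) (hδ : IsDeltaHyperbolic X δ)
    (hδ0 : 0 ≤ δ) {C₀ C₁ : ℝ} (hC₀ : ∀ b ∈ rayStab Γ r, ∃ t, 0 ≤ t ∧ dist (r t) (b (r t)) ≤ C₀)
    (hC₀0 : 0 ≤ C₀) (hC₁ : 3 * C₀ + 4 * δ = C₁) {F : Set (X ≃ᵢ X)} (hF : F.Finite)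
    (hFr : F ⊆ rayStab Γ r) :
    ∃ t₀, 0 ≤ t₀ ∧ ∀ k : ℕ, ∀ b ∈ F ^ (2 ^ k),
      dist (r (t₀ + k * (C₁ + C₀))) (b (r (t₀ + k * (C₁ + C₀)))) ≤ C₁ := by
  choose! p hp0 hp using id hC₀
  obtain ⟨M, hM⟩ := (hF.image p).bddAbove
  refine ⟨max M 0, le_max_right _ _, fun k => ?_⟩
  induction k with
  | zero =>
    intro b hb
    rw [pow_zero, pow_one] at hb
    have := (hr.antitone (hFr hb) (hp0 b (hFr hb))
      ((hM (Set.mem_image_of_mem p hb)).trans (le_max_left M 0))).trans (hp b (hFr hb))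
    simp only [Nat.cast_zero, zero_mul, add_zero]
    linarith
  | succ k ih =>
    intro b hb
    rw [pow_succ, mul_two, pow_add] at hb
    have hbr : ∀ b ∈ F ^ (2 ^ k), b ∈ rayStab Γ r := fun b hb => by
      have h : ∀ n : ℕ, F ^ n ⊆ rayStab Γ r := fun n => by
        induction n with
        | zero => simp
        | succ n ih =>
          rw [pow_succ]
          rintro _ ⟨u, hu, v, hv, rfl⟩
          exact (rayStab Γ r).mul_mem (ih hu) (hFr hv)
      exact h _ hb
    obtain ⟨u, hu, v, hv, rfl⟩ := hb
    have h1 := hr.dist_le_of_dist_le (t := max M 0 + k * (C₁ + C₀)) (c := C₁ + C₀) (C₁ := C₁)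
      hδ hδ0 (fun b hb => ⟨p b, hp0 b hb, hp b hb⟩)
      ((rayStab Γ r).mul_mem (hbr u hu) (hbr v hv))
      (add_nonneg (le_max_right _ _) (mul_nonneg k.cast_nonneg (by linarith))) le_rfl hC₀0
      (by linarith) ((dist_mul_apply_le u v _).trans (by linarith [ih u hu, ih v hv]))
    rw [hC₁, add_assoc] at h1
    rw [show ((k + 1 : ℕ) : ℝ) * (C₁ + C₀) = k * (C₁ + C₀) + (C₁ + C₀) by push_cast; ring]
    exact h1

theorem two_pow_clog_le {n : ℕ} (hn : 1 ≤ n) : 2 ^ Nat.clog 2 n ≤ 2 * n := by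
  rcases hn.eq_or_lt with rfl | hn
  · simp
  · have h := Nat.pow_pred_clog_lt_self one_lt_two hn
    have h2 : 0 < Nat.clog 2 n := Nat.clog_pos one_lt_two hn
    obtain ⟨k, hk⟩ := Nat.exists_eq_succ_of_ne_zero h2.ne'
    rw [hk, Nat.pred_succ] at h
    rw [hk, pow_succ]
    omega

theorem IsConvexRay.growthLE (hr : IsConvexRay Γ r) (hδ : IsDeltaHyperbolic X δ) (hδ0 : 0 ≤ δ)
    (hΓ : IsDiscreteSubgroup Γ) {C₀ : ℝ} (hC₀0 : 0 ≤ C₀)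
    (hC₀ : ∀ b ∈ rayStab Γ r, ∃ t, 0 ≤ t ∧ dist (r t) (b (r t)) ≤ C₀) {r₀ : ℝ} (hr₀ : 0 < r₀)
    {p : ℕ} (hcov : ∀ ρ : ℝ, ∀ k : ℕ, ρ ≤ k * r₀ → CoverLE (closedBall (r 0) ρ) (2 * r₀) (p ^ k)) :
    ∃ d, ∀ Λ : Subgroup (X ≃ᵢ X), Λ ≤ rayStab Γ r → GrowthLE Λ d := by
  obtain ⟨C₁, hC₁⟩ : ∃ C₁, 3 * C₀ + 4 * δ = C₁ := ⟨_, rfl⟩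
  set q := ⌈2 * (C₁ + C₀) / r₀⌉₊ with hq
  have hq' : 2 * (C₁ + C₀) ≤ q * r₀ := by rw [← div_le_iff₀ hr₀]; exact Nat.le_ceil _
  refine ⟨p * q, fun Λ hΛ S hS => ?_⟩
  set F : Set (X ≃ᵢ X) := insert 1 (Λ.subtype '' S) with hF
  have hFfin : F.Finite := (hS.image _).insert _
  have h1F : (1 : X ≃ᵢ X) ∈ F := Set.mem_insert _ _
  have hFr : F ⊆ rayStab Γ r := by
    rintro _ (rfl | ⟨y, -, rfl⟩)
    · exact (rayStab Γ r).one_mem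
    · exact hΛ y.2
  obtain ⟨t₀, ht₀, h⟩ := hr.exists_dist_le_of_mem_pow hδ hδ0 hC₀ hC₀0 hC₁ hFfin hFr
  set a := ⌈(2 * t₀ + C₁) / r₀⌉₊ with ha
  have ha' : 2 * t₀ + C₁ ≤ a * r₀ := by rw [← div_le_iff₀ hr₀]; exact Nat.le_ceil _
  set N := (hΓ (r 0) (2 * (2 * r₀))).toFinset.card with hN
  refine ⟨N * p ^ a * 2 ^ (p * q), fun n hn T hT => ?_⟩
  set k := Nat.clog 2 n with hk
  have hcard := hΓ.card_le (hcov (2 * (t₀ + k * (C₁ + C₀)) + C₁) (a + k * q) (by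
    push_cast
    nlinarith [mul_le_mul_of_nonneg_left hq' (Nat.cast_nonneg (α := ℝ) k)]))
    (T.map ⟨Λ.subtype, Subtype.val_injective⟩) (by
      intro γ hγ
      obtain ⟨y, -, rfl⟩ := Finset.mem_map.1 hγ
      exact (hΛ y.2).1) (by
      intro γ hγ
      obtain ⟨y, hy, rfl⟩ := Finset.mem_map.1 hγ
      have hyF : (y : X ≃ᵢ X) ∈ F ^ (2 ^ k) := by
        have h2 : (y : X ≃ᵢ X) ∈ (Λ.subtype '' S) ^ n := by
          rw [← Set.image_pow]
          exact ⟨y, hT hy, rfl⟩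
        exact Set.pow_subset_pow_right h1F (Nat.le_pow_clog one_lt_two n)
          (Set.pow_subset_pow_left (Set.subset_insert _ _) h2)
      refine (hr.dist_zero_le _ (t := t₀ + k * (C₁ + C₀))
        (add_nonneg ht₀ (mul_nonneg k.cast_nonneg (by linarith)))).trans ?_
      exact add_le_add le_rfl (h k _ hyF))
  rw [Finset.card_map] at hcard
  refine hcard.trans ?_
  have h3 : p ^ (k * q) ≤ (2 * n) ^ (p * q) :=
    calc p ^ (k * q) ≤ (2 ^ p) ^ (k * q) := Nat.pow_le_pow_left Nat.lt_two_pow_self.le _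
      _ = (2 ^ k) ^ (p * q) := by rw [← pow_mul, ← pow_mul]; congr 1; ring
      _ ≤ _ := Nat.pow_le_pow_left (two_pow_clog_le hn) _
  calc N * p ^ (a + k * q) = N * p ^ a * p ^ (k * q) := by rw [pow_add, mul_assoc]
    _ ≤ N * p ^ a * (2 * n) ^ (p * q) := Nat.mul_le_mul_left _ h3
    _ = _ := by rw [mul_pow]; ring

theorem IsConvexRay.isVirtuallyNilpotent_of_le_rayStab (hr : IsConvexRay Γ r)
    (hδ : IsDeltaHyperbolic X δ) (hδ0 : 0 ≤ δ)
    (hΓ : IsDiscreteSubgroup Γ) {C₀ : ℝ} (hC₀0 : 0 ≤ C₀)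
    (hC₀ : ∀ b ∈ rayStab Γ r, ∃ t, 0 ≤ t ∧ dist (r t) (b (r t)) ≤ C₀) {r₀ : ℝ} (hr₀ : 0 < r₀)
    {p : ℕ} (hcov : ∀ ρ : ℝ, ∀ k : ℕ, ρ ≤ k * r₀ → CoverLE (closedBall (r 0) ρ) (2 * r₀) (p ^ k))
    (Λ : Subgroup (X ≃ᵢ X)) (hΛ : Λ ≤ rayStab Γ r) [Group.FG Λ] : IsVirtuallyNilpotent Λ := by
  obtain ⟨d, hd⟩ := hr.growthLE hδ hδ0 hΓ hC₀0 hC₀ hr₀ hcov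
  exact GrowthLE.isVirtuallyNilpotent d _ (hd Λ hΛ)

end ParabolicGrowth

section Busemann

variable {X : Type*} [MetricSpace X] {Γ : Subgroup (X ≃ᵢ X)} {r : ℝ → X} {δ : ℝ}

/-- The Busemann function of the ray `r`. -/
noncomputable def busemann (r : ℝ → X) (y : X) : ℝ :=
  limUnder atTop fun s => dist y (r s) - s

theorem IsConvexRay.tendsto_busemann (hr : IsConvexRay Γ r) (y : X) :
    Tendsto (fun s => dist y (r s) - s) atTop (nhds (busemann r y)) := by
  refine tendsto_nhds_limUnder ⟨⨅ s, (dist y (r (max s 0)) - max s 0), ?_⟩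
  refine (tendsto_atTop_ciInf (f := fun s => dist y (r (max s 0)) - max s 0) ?_ ?_).congr' ?_
  · intro s t hst
    have h0 : max s 0 ≤ max t 0 := max_le_max hst le_rfl
    have h1 := dist_triangle y (r (max s 0)) (r (max t 0))
    rw [hr.dist_eq _ _ (le_max_right _ _) (le_max_right _ _), abs_sub_comm,
      abs_of_nonneg (sub_nonneg.2 h0)] at h1
    simp only
    linarith
  · refine ⟨-dist y (r 0), ?_⟩
    rintro _ ⟨s, rfl⟩
    have h1 := dist_triangle_left (r 0) (r (max s 0)) y
    rw [hr.dist_zero (le_max_right _ _)] at h1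
    simp only
    linarith
  · filter_upwards [eventually_ge_atTop 0] with s hs
    rw [max_eq_left hs]

theorem IsConvexRay.busemann_apply (hr : IsConvexRay Γ r) {t : ℝ} (ht : 0 ≤ t) :
    busemann r (r t) = -t := by
  refine tendsto_nhds_unique (hr.tendsto_busemann (r t)) (tendsto_const_nhds.congr' ?_)
  filter_upwards [eventually_ge_atTop t] with s hs
  rw [hr.dist_eq t s ht (ht.trans hs), abs_sub_comm, abs_of_nonneg (sub_nonneg.2 hs)]
  ring

theorem IsConvexRay.busemann_zero (hr : IsConvexRay Γ r) : busemann r (r 0) = 0 := by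
  rw [hr.busemann_apply le_rfl, neg_zero]

theorem IsConvexRay.busemann_le_add (hr : IsConvexRay Γ r) (y z : X) :
    busemann r y ≤ dist y z + busemann r z := by
  refine le_of_tendsto_of_tendsto' (hr.tendsto_busemann y)
    (tendsto_const_nhds.add (hr.tendsto_busemann z)) fun s => ?_
  linarith [dist_triangle y z (r s)]

/-- The four-point inequality with one point sent to infinity. -/
theorem IsConvexRay.dist_add_busemann_le (hr : IsConvexRay Γ r) (hδ : IsDeltaHyperbolic X δ)
    (y z w : X) :
    dist y z + busemann r w ≤
      max (dist y w + busemann r z) (busemann r y + dist z w) + 2 * δ := by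
  refine le_of_tendsto_of_tendsto' (tendsto_const_nhds.add (hr.tendsto_busemann w))
    (((tendsto_const_nhds.add (hr.tendsto_busemann z)).max
      ((hr.tendsto_busemann y).add tendsto_const_nhds)).add_const _) fun s => ?_
  have h := hδ y z w (r s)
  rcases max_cases (dist y w + dist z (r s)) (dist y (r s) + dist z w) with h1 | h1
  · linarith [le_max_left (dist y w + (dist z (r s) - s)) (dist y (r s) - s + dist z w)]
  · linarith [le_max_right (dist y w + (dist z (r s) - s)) (dist y (r s) - s + dist z w)]

theorem IsConvexRay.sub_le_dist (hr : IsConvexRay Γ r) (y : X) {s : ℝ} (hs : 0 ≤ s) :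
    s - dist y (r 0) ≤ dist y (r s) := by
  have h1 := dist_triangle_left (r 0) (r s) y
  rw [hr.dist_zero hs] at h1
  linarith

theorem IsConvexRay.busemann_mul_le (hr : IsConvexRay Γ r) (hδ : IsDeltaHyperbolic X δ)
    {b : X ≃ᵢ X} (hb : b ∈ rayStab Γ r) (y : X) :
    busemann r (b y) ≤ busemann r y + busemann r (b (r 0)) + 2 * δ := by
  obtain ⟨-, B, hB⟩ := hb
  refine le_of_tendsto_of_tendsto (hr.tendsto_busemann (b y))
    (((hr.tendsto_busemann y).add (hr.tendsto_busemann (b (r 0)))).add_const (2 * δ)) ?_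
  filter_upwards [eventually_ge_atTop 0, eventually_ge_atTop
    (dist y (r 0) + B + dist (b (r 0)) (r 0))] with s hs hs2
  have h := hδ (b y) (r s) (b (r 0)) (b (r s))
  rw [b.dist_eq, b.dist_eq, b.dist_eq, hr.dist_zero hs] at h
  have h2 := hB s hs
  have h3 := hr.sub_le_dist (b (r 0)) hs
  have h4 := hr.sub_le_dist y hs
  rw [dist_comm (r s) (b (r 0))] at h
  rcases max_cases (dist y (r 0) + dist (r s) (b (r s)))
    (dist y (r s) + dist (b (r 0)) (r s)) with h1 | h1
  · linarith [dist_nonneg (x := b (r 0)) (y := r 0), dist_nonneg (x := r s) (y := b (r s))]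
  · linarith

theorem IsConvexRay.le_busemann_mul (hr : IsConvexRay Γ r) (hδ : IsDeltaHyperbolic X δ)
    {b : X ≃ᵢ X} (hb : b ∈ rayStab Γ r) (y : X) :
    busemann r y + busemann r (b (r 0)) ≤ busemann r (b y) + 2 * δ := by
  obtain ⟨-, B, hB⟩ := hb
  refine le_of_tendsto_of_tendsto
    ((hr.tendsto_busemann y).add (hr.tendsto_busemann (b (r 0))))
    ((hr.tendsto_busemann (b y)).add_const (2 * δ)) ?_
  filter_upwards [eventually_ge_atTop 0, eventually_ge_atTop
    (dist y (r 0) + B + dist (b y) (r 0))] with s hs hs2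
  have h := hδ (b y) (b (r s)) (b (r 0)) (r s)
  rw [b.dist_eq, b.dist_eq, dist_comm (b (r s)) (b (r 0)), b.dist_eq, hr.dist_zero hs,
    dist_comm (b (r s)) (r s)] at h
  have h2 := hB s hs
  have h3 := hr.sub_le_dist (b y) hs
  rcases max_cases (dist y (r 0) + dist (r s) (b (r s)))
    (dist (b y) (r s) + s) with h1 | h1 <;> linarith

/-- Far along the ray, the displacement is controlled by the Busemann function. -/
theorem IsConvexRay.eventually_dist_le (hr : IsConvexRay Γ r) (hδ : IsDeltaHyperbolic X δ)
    (hδ0 : 0 < δ) {b : X ≃ᵢ X} (hb : b ∈ rayStab Γ r) :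
    ∀ᶠ t in atTop, dist (r t) (b (r t)) ≤ |busemann r (b (r 0))| + 6 * δ := by
  filter_upwards [eventually_ge_atTop 0, (hr.tendsto_busemann (b (r 0))).eventually_lt_const
    (show busemann r (b (r 0)) < busemann r (b (r 0)) + δ by linarith)] with t ht h
  have h1 := hr.dist_add_busemann_le hδ (r t) (b (r t)) (b (r 0))
  have h2 := hr.busemann_mul_le hδ hb (r t)
  rw [hr.busemann_apply ht] at h1 h2
  rw [b.dist_eq, dist_comm (r t) (r 0), hr.dist_zero ht, dist_comm (r t) (b (r 0))] at h1
  have h4 := neg_abs_le (busemann r (b (r 0)))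
  have h5 := le_abs_self (busemann r (b (r 0)))
  rcases max_cases (dist (b (r 0)) (r t) + busemann r (b (r t))) (-t + t) with h3 | h3 <;> linarith

end Busemann

section Loxodromic

variable {X : Type*} [MetricSpace X] {Γ : Subgroup (X ≃ᵢ X)} {r : ℝ → X} {δ : ℝ} {l : X ≃ᵢ X}

theorem IsConvexRay.busemann_pow_add_le (hr : IsConvexRay Γ r) (hδ : IsDeltaHyperbolic X δ)
    (hl : l ∈ rayStab Γ r) (hβ : busemann r (l (r 0)) ≤ -(5 * δ)) (m n : ℕ) :
    busemann r ((l ^ (m + n)) (r 0)) ≤ busemann r ((l ^ m) (r 0)) - n * (3 * δ) := by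
  induction n with
  | zero => simp
  | succ n ih =>
    have h := hr.busemann_mul_le hδ hl ((l ^ (m + n)) (r 0))
    rw [← IsometryEquiv.mul_apply, ← pow_succ'] at h
    rw [← add_assoc]
    push_cast
    linarith

theorem IsConvexRay.busemann_pow_le (hr : IsConvexRay Γ r) (hδ : IsDeltaHyperbolic X δ)
    (hl : l ∈ rayStab Γ r) (hβ : busemann r (l (r 0)) ≤ -(5 * δ)) (n : ℕ) :
    busemann r ((l ^ n) (r 0)) ≤ -(n * (3 * δ)) := by
  have h := hr.busemann_pow_add_le hδ hl hβ 0 n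
  rwa [pow_zero, IsometryEquiv.coe_one, id, hr.busemann_zero, zero_add, zero_sub] at h

theorem IsConvexRay.le_dist_pow (hr : IsConvexRay Γ r) (n : ℕ) :
    -busemann r ((l ^ n) (r 0)) ≤ dist (r 0) ((l ^ n) (r 0)) := by
  have h := hr.busemann_le_add (r 0) ((l ^ n) (r 0))
  rw [hr.busemann_zero] at h
  linarith

theorem IsConvexRay.dist_pow_le (hr : IsConvexRay Γ r) (hδ : IsDeltaHyperbolic X δ)
    (hδ0 : 0 < δ) (hl : l ∈ rayStab Γ r) (hβ : busemann r (l (r 0)) ≤ -(5 * δ)) (n : ℕ) :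
    dist (r 0) ((l ^ n) (r 0)) ≤
      -busemann r ((l ^ n) (r 0)) + (dist (r 0) (l (r 0)) + 2 * δ) := by
  induction n with
  | zero =>
    rw [pow_zero, IsometryEquiv.coe_one, id, dist_self, hr.busemann_zero]
    linarith [dist_nonneg (x := r 0) (y := l (r 0))]
  | succ n ih =>
    have h1 := hr.dist_add_busemann_le hδ (r 0) ((l ^ (n + 1)) (r 0)) ((l ^ n) (r 0))
    have h2 := hr.busemann_pow_add_le hδ hl hβ n 1
    have h3 : dist ((l ^ (n + 1)) (r 0)) ((l ^ n) (r 0)) = dist (r 0) (l (r 0)) := by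
      rw [pow_succ, IsometryEquiv.mul_apply, IsometryEquiv.dist_eq, dist_comm]
    rw [h3, hr.busemann_zero] at h1
    push_cast at h2
    rcases max_cases (dist (r 0) ((l ^ n) (r 0)) + busemann r ((l ^ (n + 1)) (r 0)))
      (0 + dist (r 0) (l (r 0))) with h4 | h4 <;> linarith

theorem IsConvexRay.dist_pow_ray_le (hr : IsConvexRay Γ r) (hδ : IsDeltaHyperbolic X δ)
    (hδ0 : 0 < δ) (hl : l ∈ rayStab Γ r) (hβ : busemann r (l (r 0)) ≤ -(5 * δ)) (n : ℕ) :
    dist ((l ^ n) (r 0)) (r (-busemann r ((l ^ n) (r 0)))) ≤ dist (r 0) (l (r 0)) + 4 * δ := by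
  have ht : 0 ≤ -busemann r ((l ^ n) (r 0)) := by
    have h1 := hr.busemann_pow_le hδ hl hβ n
    have : 0 ≤ n * (3 * δ) := by positivity
    linarith
  have h1 := hr.dist_add_busemann_le hδ ((l ^ n) (r 0)) (r (-busemann r ((l ^ n) (r 0)))) (r 0)
  have h2 := hr.dist_pow_le hδ hδ0 hl hβ n
  rw [hr.busemann_apply ht, hr.busemann_zero, dist_comm _ (r 0), dist_comm _ (r 0),
    hr.dist_zero ht] at h1
  have h3 : max (dist (r 0) ((l ^ n) (r 0)) + -(-busemann r ((l ^ n) (r 0))))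
      (busemann r ((l ^ n) (r 0)) + -busemann r ((l ^ n) (r 0))) ≤
      dist (r 0) (l (r 0)) + 2 * δ :=
    max_le (by linarith) (by linarith [dist_nonneg (x := r 0) (y := l (r 0))])
  linarith

theorem IsConvexRay.tendsto_busemann_pow (hr : IsConvexRay Γ r) (hδ : IsDeltaHyperbolic X δ)
    (hδ0 : 0 < δ) (hl : l ∈ rayStab Γ r) (hβ : busemann r (l (r 0)) ≤ -(5 * δ)) :
    Tendsto (fun n : ℕ => -busemann r ((l ^ n) (r 0))) atTop atTop := by
  refine tendsto_atTop_mono (fun n => ?_)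
    (tendsto_natCast_atTop_atTop.atTop_mul_const (show 0 < 3 * δ by linarith))
  linarith [hr.busemann_pow_le hδ hl hβ n]

/-- Every element of the stabilizer commutes with a power of `l`. -/
theorem IsConvexRay.exists_commute_pow (hr : IsConvexRay Γ r) (hδ : IsDeltaHyperbolic X δ)
    (hδ0 : 0 < δ) (hΓ : IsDiscreteSubgroup Γ) (hl : l ∈ rayStab Γ r)
    (hβ : busemann r (l (r 0)) ≤ -(5 * δ)) {b : X ≃ᵢ X} (hb : b ∈ rayStab Γ r) :
    ∃ k : ℕ, 1 ≤ k ∧ Commute b (l ^ k) := by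
  set K := dist (r 0) (l (r 0)) + 4 * δ with hK
  have hmem : ∀ n : ℕ, (l ^ n)⁻¹ * b * l ^ n ∈
      {h : X ≃ᵢ X | h ∈ Γ ∧ dist (r 0) (h (r 0)) ≤ 2 * K + dist (r 0) (b (r 0))} := by
    intro n
    refine ⟨Γ.mul_mem (Γ.mul_mem (Γ.inv_mem (Γ.pow_mem hl.1 _)) hb.1) (Γ.pow_mem hl.1 _), ?_⟩
    have h1 := hr.dist_pow_ray_le hδ hδ0 hl hβ n
    have ht : 0 ≤ -busemann r ((l ^ n) (r 0)) := by
      have h1 := hr.busemann_pow_le hδ hl hβ n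
      have : 0 ≤ n * (3 * δ) := by positivity
      linarith
    set t := -busemann r ((l ^ n) (r 0)) with htd
    have h2 := hr.antitone hb le_rfl ht
    have h3 := dist_conj_apply b (l ^ n)⁻¹ (r 0)
    rw [inv_inv] at h3
    rw [h3]
    have h4 := dist_triangle4 ((l ^ n) (r 0)) (r t) (b (r t)) (b ((l ^ n) (r 0)))
    rw [b.dist_eq, dist_comm (r t) ((l ^ n) (r 0))] at h4
    linarith
  obtain ⟨i, j, hij, h⟩ := (hΓ (r 0) _).exists_lt_map_eq_of_forall_mem hmem
  refine ⟨j - i, by omega, ?_⟩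
  have h1 : l ^ j = l ^ (j - i) * l ^ i := by rw [← pow_add]; congr 1; omega
  have h5 : Commute (l ^ (j - i)) (l ^ i) := (Commute.refl l).pow_pow _ _
  have h6 : b = (l ^ (j - i))⁻¹ * b * l ^ (j - i) := by
    calc b = l ^ i * ((l ^ i)⁻¹ * b * l ^ i) * (l ^ i)⁻¹ := by group
      _ = l ^ i * ((l ^ j)⁻¹ * b * l ^ j) * (l ^ i)⁻¹ := by rw [h]
      _ = _ := by
        rw [h1]
        nth_rw 1 [h5.eq]
        group
  have h7 : l ^ (j - i) * b = b * l ^ (j - i) := by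
    nth_rw 1 [h6]; group
  exact h7.symm

theorem IsConvexRay.mem_rayStab_of_commute (hr : IsConvexRay Γ r) (hδ : IsDeltaHyperbolic X δ)
    (hδ0 : 0 < δ) (hl : l ∈ rayStab Γ r) (hβ : busemann r (l (r 0)) ≤ -(5 * δ)) {b : X ≃ᵢ X}
    (hb : b ∈ Γ) {k : ℕ} (hk : 1 ≤ k) (hbk : Commute b (l ^ k)) : b ∈ rayStab Γ r := by
  refine hr.mem_rayStab hb (2 * (dist (r 0) (l (r 0)) + 4 * δ) + dist (r 0) (b (r 0)))
    fun T _ => ?_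
  have h1 := (hr.tendsto_busemann_pow hδ hδ0 hl hβ).comp
    (tendsto_id.const_mul_atTop' (show 0 < k by omega))
  obtain ⟨n, hn⟩ := (h1.eventually_ge_atTop T).exists
  refine ⟨_, hn, ?_⟩
  simp only [Function.comp, id]
  have h2 := hr.dist_pow_ray_le hδ hδ0 hl hβ (k * n)
  set t := -busemann r ((l ^ (k * n)) (r 0)) with ht
  have h4 := dist_triangle4 (r t) ((l ^ (k * n)) (r 0)) (b ((l ^ (k * n)) (r 0))) (b (r t))
  have h5 : dist ((l ^ (k * n)) (r 0)) (b ((l ^ (k * n)) (r 0))) = dist (r 0) (b (r 0)) := by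
    have h6 : b * l ^ (k * n) = l ^ (k * n) * b := by
      rw [pow_mul]; exact (hbk.pow_right n).eq
    rw [← IsometryEquiv.mul_apply, h6, IsometryEquiv.mul_apply, IsometryEquiv.dist_eq]
  rw [b.dist_eq, dist_comm (r t) ((l ^ (k * n)) (r 0)), h5] at h4
  linarith

theorem IsConvexRay.dist_le_of_commute (hr : IsConvexRay Γ r) (hδ : IsDeltaHyperbolic X δ)
    (hδ0 : 0 < δ) (hl : l ∈ rayStab Γ r) (hβ : busemann r (l (r 0)) ≤ -(5 * δ)) {b : X ≃ᵢ X}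
    (hb : b ∈ rayStab Γ r) {k : ℕ} (hk : 1 ≤ k) (hbk : Commute b (l ^ k)) :
    dist (r 0) (b (r 0)) ≤
      2 * (dist (r 0) (l (r 0)) + 4 * δ) + (|busemann r (b (r 0))| + 6 * δ) := by
  have h1 := (hr.tendsto_busemann_pow hδ hδ0 hl hβ).comp
    (tendsto_id.const_mul_atTop' (show 0 < k by omega))
  obtain ⟨n, hn⟩ := (h1.eventually (hr.eventually_dist_le hδ hδ0 hb)).exists
  simp only [Function.comp, id] at hn
  have h2 := hr.dist_pow_ray_le hδ hδ0 hl hβ (k * n)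
  set t := -busemann r ((l ^ (k * n)) (r 0)) with ht
  have h4 := dist_triangle4 ((l ^ (k * n)) (r 0)) (r t) (b (r t)) (b ((l ^ (k * n)) (r 0)))
  have h5 : dist ((l ^ (k * n)) (r 0)) (b ((l ^ (k * n)) (r 0))) = dist (r 0) (b (r 0)) := by
    have h6 : b * l ^ (k * n) = l ^ (k * n) * b := by
      rw [pow_mul]; exact (hbk.pow_right n).eq
    rw [← IsometryEquiv.mul_apply, h6, IsometryEquiv.mul_apply, IsometryEquiv.dist_eq]
  rw [b.dist_eq, dist_comm (r t) ((l ^ (k * n)) (r 0)), h5] at h4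
  linarith

theorem exists_int_mem_Icc {a : ℤ → ℝ} {s S : ℝ} (hs : 0 < s)
    (h1 : ∀ q, s ≤ a q - a (q + 1)) (h2 : ∀ q, a q - a (q + 1) ≤ S) : ∃ q, |a q| ≤ S := by
  have hpos : ∀ n : ℕ, a n ≤ a 0 - n * s := fun n => by
    induction n with
    | zero => simp
    | succ n ih => push_cast; linarith [h1 n]
  have hneg : ∀ n : ℕ, a 0 + n * s ≤ a (-n) := fun n => by
    induction n with
    | zero => simp
    | succ n ih =>
      have := h1 (-(n + 1))
      rw [show -((n : ℤ) + 1) + 1 = -n by ring] at this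
      push_cast
      linarith
  have hanti : Antitone a := antitone_int_of_succ_le fun n => by linarith [h1 n]
  obtain ⟨n, hn⟩ := exists_nat_gt (|a 0| / s)
  rw [div_lt_iff₀ hs] at hn
  obtain ⟨q, hq, hmax⟩ := Int.exists_greatest_of_bdd (P := fun q => 0 ≤ a q)
    ⟨n, fun q hq => by
      by_contra! hlt
      have := hanti hlt.le
      linarith [hpos n, le_abs_self (a 0)]⟩ ⟨-n, by linarith [hneg n, neg_abs_le (a 0)]⟩
  refine ⟨q, ?_⟩
  rw [abs_of_nonneg hq]
  have : a (q + 1) < 0 := by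
    by_contra! h
    have := hmax _ h
    omega
  linarith [h2 q]

/-- The centralizer of a power of `l` is virtually generated by this power. -/
theorem IsConvexRay.exists_finite_of_commute (hr : IsConvexRay Γ r) (hδ : IsDeltaHyperbolic X δ)
    (hδ0 : 0 < δ) (hΓ : IsDiscreteSubgroup Γ) (hl : l ∈ rayStab Γ r)
    (hβ : busemann r (l (r 0)) ≤ -(5 * δ)) {k : ℕ} (hk : 1 ≤ k) :
    ∃ F : Set (X ≃ᵢ X), F.Finite ∧
      ∀ b ∈ Γ, Commute b (l ^ k) → ∃ q : ℤ, b * (l ^ k) ^ q ∈ F := by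
  refine ⟨_, hΓ (r 0) (2 * (dist (r 0) (l (r 0)) + 4 * δ) +
    (-busemann r ((l ^ k) (r 0)) + 2 * δ + 6 * δ)), fun b hb hbk => ?_⟩
  have hbr := hr.mem_rayStab_of_commute hδ hδ0 hl hβ hb hk hbk
  have hlk : l ^ k ∈ rayStab Γ r := (rayStab Γ r).pow_mem hl k
  have hm : ∀ q : ℤ, b * (l ^ k) ^ q ∈ rayStab Γ r := fun q =>
    (rayStab Γ r).mul_mem hbr ((rayStab Γ r).zpow_mem hlk q)
  have hk' : 3 * δ ≤ k * (3 * δ) := by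
    have : (1 : ℝ) ≤ k := by exact_mod_cast hk
    nlinarith
  have hbk' := hr.busemann_pow_le hδ hl hβ k
  obtain ⟨q, hq⟩ := exists_int_mem_Icc (a := fun q => busemann r ((b * (l ^ k) ^ q) (r 0)))
    (s := -busemann r ((l ^ k) (r 0)) - 2 * δ) (S := -busemann r ((l ^ k) (r 0)) + 2 * δ)
    (by linarith) (fun q => by
      have h := hr.busemann_mul_le hδ (hm q) ((l ^ k) (r 0))
      rw [← IsometryEquiv.mul_apply, mul_assoc, ← zpow_add_one] at h
      linarith) (fun q => by
      have h := hr.le_busemann_mul hδ (hm q) ((l ^ k) (r 0))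
      rw [← IsometryEquiv.mul_apply, mul_assoc, ← zpow_add_one] at h
      linarith)
  refine ⟨q, (hm q).1, ?_⟩
  have h := hr.dist_le_of_commute hδ hδ0 hl hβ (hm q) hk
    (hbk.mul_left ((Commute.refl (l ^ k)).zpow_left q))
  linarith

end Loxodromic

section CommensurableSubgroup

variable {G : Type*} [Group G] {Γ : Subgroup G} {l : G}

theorem exists_pow_eq_zpow_of_commute
    (hfin : ∀ k : ℕ, 1 ≤ k → ∃ F : Set G, F.Finite ∧
      ∀ b ∈ Γ, Commute b (l ^ k) → ∃ q : ℤ, b * (l ^ k) ^ q ∈ F)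
    {b : G} (hb : b ∈ Γ) {k : ℕ} (hk : 1 ≤ k) (hbk : Commute b (l ^ k)) :
    ∃ a : ℕ, 1 ≤ a ∧ ∃ c : ℤ, b ^ a = l ^ c := by
  obtain ⟨F, hF, h⟩ := hfin k hk
  choose q hq using fun j : ℕ => h (b ^ j) (Γ.pow_mem hb j) (hbk.pow_left j)
  obtain ⟨i, j, hij, he⟩ := hF.exists_lt_map_eq_of_forall_mem hq
  refine ⟨j - i, by omega, k * (q i - q j), ?_⟩
  have h1 : b ^ j = b ^ i * b ^ (j - i) := by rw [← pow_add]; congr 1; omega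
  rw [h1, mul_assoc, mul_right_inj] at he
  rw [zpow_mul, zpow_natCast, zpow_sub, he]
  group

theorem exists_conj_pow_eq
    (habs : ∀ b ∈ Γ, ∀ P Q : ℤ, b * l ^ P * b⁻¹ = l ^ Q → Q.natAbs ≤ P.natAbs)
    {b : G} (hb : b ∈ Γ) {P Q : ℤ} (hP : P ≠ 0) (h : b * l ^ P * b⁻¹ = l ^ Q) :
    ∃ N : ℕ, 1 ≤ N ∧ (b * l ^ N * b⁻¹ = l ^ N ∨ b * l ^ N * b⁻¹ = (l ^ N)⁻¹) := by
  have h1 := habs b hb P Q h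
  have h2 := habs b⁻¹ (Γ.inv_mem hb) Q P (by rw [← h]; group)
  refine ⟨P.natAbs, by omega, ?_⟩
  have h3 : b * l ^ (-P) * b⁻¹ = l ^ (-Q) := by
    rw [zpow_neg, zpow_neg, ← h]; group
  rw [← zpow_natCast]
  rcases Int.natAbs_eq P with hP' | hP' <;>
    rcases Int.natAbs_eq_natAbs_iff.1 (le_antisymm h1 h2) with hQ | hQ
  · left; rw [← hP', h, hQ]
  · right; rw [← hP', h, hQ, zpow_neg]
  · left; rw [← neg_eq_iff_eq_neg.2 hP', h3, hQ]
  · right; rw [← neg_eq_iff_eq_neg.2 hP', h3, hQ, neg_neg, zpow_neg, inv_inv]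

theorem conj_pow_mul_eq {b x : G} {N : ℕ}
    (h : b * x ^ N * b⁻¹ = x ^ N ∨ b * x ^ N * b⁻¹ = (x ^ N)⁻¹) (m : ℕ) :
    b * x ^ (N * m) * b⁻¹ = x ^ (N * m) ∨ b * x ^ (N * m) * b⁻¹ = (x ^ (N * m))⁻¹ := by
  rw [pow_mul, ← conj_pow]
  rcases h with h | h
  · left; rw [h]
  · right; rw [h, inv_pow]

theorem exists_conj_pow_eq_of_conj
    (hfin : ∀ k : ℕ, 1 ≤ k → ∃ F : Set G, F.Finite ∧
      ∀ b ∈ Γ, Commute b (l ^ k) → ∃ q : ℤ, b * (l ^ k) ^ q ∈ F)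
    (habs : ∀ b ∈ Γ, ∀ P Q : ℤ, b * l ^ P * b⁻¹ = l ^ Q → Q.natAbs ≤ P.natAbs)
    {g : G} (hg : g ∈ Γ) (hinf : ¬ IsOfFinOrder g) {k : ℕ} (hk : 1 ≤ k) (hgk : Commute g (l ^ k))
    {b : G} (hb : b ∈ Γ) {i : ℕ} (hi : 1 ≤ i) {N : ℕ} (hN : 1 ≤ N)
    (h : b * g ^ i * b⁻¹ * l ^ N * (b * g ^ i * b⁻¹)⁻¹ = l ^ N ∨
      b * g ^ i * b⁻¹ * l ^ N * (b * g ^ i * b⁻¹)⁻¹ = (l ^ N)⁻¹) :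
    ∃ N : ℕ, 1 ≤ N ∧ (b * l ^ N * b⁻¹ = l ^ N ∨ b * l ^ N * b⁻¹ = (l ^ N)⁻¹) := by
  obtain ⟨p, hp, c, hc⟩ := exists_pow_eq_zpow_of_commute hfin hg hk hgk
  set u := b * g ^ i * b⁻¹ with hu
  have huΓ : u ∈ Γ := Γ.mul_mem (Γ.mul_mem hb (Γ.pow_mem hg i)) (Γ.inv_mem hb)
  have h2 : u ^ 2 * l ^ N * (u ^ 2)⁻¹ = l ^ N := by
    have : u ^ 2 * l ^ N * (u ^ 2)⁻¹ = u * (u * l ^ N * u⁻¹) * u⁻¹ := by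
      simp only [pow_two, mul_inv_rev, mul_assoc]
    rw [this]
    rcases h with h | h
    · rw [h, h]
    · rw [h, show u * (l ^ N)⁻¹ * u⁻¹ = (u * l ^ N * u⁻¹)⁻¹ by group, h, inv_inv]
  obtain ⟨a, ha, c', hc'⟩ := exists_pow_eq_zpow_of_commute hfin (Γ.pow_mem huΓ 2) hN
    (show Commute (u ^ 2) (l ^ N) from mul_inv_eq_iff_eq_mul.1 h2)
  have hne : ∀ n : ℕ, 1 ≤ n → g ^ n ≠ 1 := fun n hn h =>
    hinf (isOfFinOrder_iff_pow_eq_one.2 ⟨n, hn, h⟩)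
  have hc0 : c ≠ 0 := by
    rintro rfl
    exact hne p hp (by simpa using hc)
  refine exists_conj_pow_eq habs hb (P := c * (i * 2 * a : ℕ)) (Q := c' * p)
    (mul_ne_zero hc0 (by exact_mod_cast (by positivity : i * 2 * a ≠ 0))) ?_
  rw [zpow_mul, zpow_natCast, zpow_mul, zpow_natCast, ← hc, ← hc', hu, ← pow_mul, ← pow_mul,
    conj_pow, ← pow_mul, conj_pow, ← pow_mul]
  congr 3
  ring

theorem isVirtuallyNilpotent_of_relIndex {Λ : Subgroup G} {z : G} {T : Set G} (hT : T.Finite)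
    (h : ∀ b ∈ Λ, ∃ t ∈ T, b * t⁻¹ ∈ Subgroup.zpowers z) : IsVirtuallyNilpotent Λ := by
  classical
  let H : Subgroup Λ := (Subgroup.zpowers z).subgroupOf Λ
  have hcomm : ∀ a b : H, a * b = b * a := by
    intro a b
    obtain ⟨m, hm⟩ := Subgroup.mem_zpowers_iff.1 (Subgroup.mem_subgroupOf.1 a.2)
    obtain ⟨n, hn⟩ := Subgroup.mem_zpowers_iff.1 (Subgroup.mem_subgroupOf.1 b.2)
    apply Subtype.ext
    apply Subtype.ext
    push_cast
    rw [← hm, ← hn]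
    exact ((Commute.refl z).zpow_zpow m n).eq
  refine ⟨H, ?_, ?_⟩
  · let c : G → Λ := fun t => if h : ∃ b : Λ, (b : G) * t⁻¹ ∈ Subgroup.zpowers z then h.choose else 1
    refine Subgroup.finiteIndex_of_finite_cover H (hT.image c) fun b => ?_
    obtain ⟨t, ht, hbt⟩ := h b b.2
    refine ⟨c t, Set.mem_image_of_mem c ht, ?_⟩
    have hex : ∃ b : Λ, (b : G) * t⁻¹ ∈ Subgroup.zpowers z := ⟨b, hbt⟩
    have hc : c t = hex.choose := dif_pos hex
    rw [Subgroup.mem_subgroupOf, hc]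
    have := mul_mem hbt (inv_mem hex.choose_spec)
    rw [mul_inv_rev, inv_inv, ← mul_assoc, inv_mul_cancel_right] at this
    exact_mod_cast this
  · let _ : CommGroup H := { (inferInstance : Group H) with mul_comm := hcomm }
    exact CommGroup.isNilpotent

theorem isVirtuallyNilpotent_of_conj_pow_eq
    (hfin : ∀ k : ℕ, 1 ≤ k → ∃ F : Set G, F.Finite ∧
      ∀ b ∈ Γ, Commute b (l ^ k) → ∃ q : ℤ, b * (l ^ k) ^ q ∈ F)
    {Λ : Subgroup G} (hΛ : Λ ≤ Γ) {N : ℕ} (hN : 1 ≤ N)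
    (h : ∀ b ∈ Λ, b * l ^ N * b⁻¹ = l ^ N ∨ b * l ^ N * b⁻¹ = (l ^ N)⁻¹) :
    IsVirtuallyNilpotent Λ := by
  obtain ⟨F, hF, hFc⟩ := hfin N hN
  have key : ∀ b ∈ Γ, b * l ^ N * b⁻¹ = l ^ N → ∃ f ∈ F, b * f⁻¹ ∈ Subgroup.zpowers (l ^ N) := by
    intro b hb hbl
    have hbc : Commute b (l ^ N) := mul_inv_eq_iff_eq_mul.1 hbl
    obtain ⟨q, hq⟩ := hFc b hb hbc
    refine ⟨_, hq, Subgroup.mem_zpowers_iff.2 ⟨-q, ?_⟩⟩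
    rw [(hbc.zpow_right q).eq, mul_inv_rev, mul_inv_cancel_left, zpow_neg]
  by_cases hex : ∃ b₀ ∈ Λ, b₀ * l ^ N * b₀⁻¹ = (l ^ N)⁻¹
  · obtain ⟨b₀, hb₀, h₀⟩ := hex
    refine isVirtuallyNilpotent_of_relIndex (z := l ^ N) (hF.union (hF.image (· * b₀)))
      fun b hb => ?_
    rcases h b hb with h1 | h1
    · obtain ⟨f, hf, hbf⟩ := key b (hΛ hb) h1
      exact ⟨f, Or.inl hf, hbf⟩
    · obtain ⟨f, hf, hbf⟩ := key (b * b₀⁻¹) (hΛ (mul_mem hb (inv_mem hb₀))) (by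
        have h2 : b₀⁻¹ * (l ^ N)⁻¹ * b₀ = l ^ N := by rw [← h₀]; group
        have h3 : b * b₀⁻¹ * l ^ N * (b * b₀⁻¹)⁻¹ =
            b * (b₀⁻¹ * (l ^ N)⁻¹ * b₀)⁻¹ * b⁻¹ := by group
        rw [h3, h2, show b * (l ^ N)⁻¹ * b⁻¹ = (b * l ^ N * b⁻¹)⁻¹ by group, h1, inv_inv])
      refine ⟨f * b₀, Or.inr ⟨f, hf, rfl⟩, ?_⟩
      rwa [mul_inv_rev, ← mul_assoc]
  · push Not at hex
    exact isVirtuallyNilpotent_of_relIndex (z := l ^ N) hF fun b hb =>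
      key b (hΛ hb) ((h b hb).resolve_right (hex b hb))

theorem exists_forall_closure_conj_pow_eq {S : Set G} (hS : S.Finite)
    (h : ∀ b ∈ S, ∃ N : ℕ, 1 ≤ N ∧ (b * l ^ N * b⁻¹ = l ^ N ∨ b * l ^ N * b⁻¹ = (l ^ N)⁻¹)) :
    ∃ N : ℕ, 1 ≤ N ∧ ∀ b ∈ Subgroup.closure S,
      b * l ^ N * b⁻¹ = l ^ N ∨ b * l ^ N * b⁻¹ = (l ^ N)⁻¹ := by
  choose! n hn1 hn using h
  refine ⟨∏ b ∈ hS.toFinset, n b, Finset.one_le_prod' fun b hb => hn1 b (hS.mem_toFinset.1 hb),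
    fun b hb => ?_⟩
  induction hb using Subgroup.closure_induction with
  | mem b hb =>
    obtain ⟨m, hm⟩ := Finset.dvd_prod_of_mem n (hS.mem_toFinset.2 hb)
    rw [hm]
    exact conj_pow_mul_eq (hn b hb) m
  | one => left; group
  | mul a b _ _ ha hb =>
    set y := l ^ ∏ b ∈ hS.toFinset, n b
    have e : a * b * y * (a * b)⁻¹ = a * (b * y * b⁻¹) * a⁻¹ := by group
    rw [e]
    have e2 : a * y⁻¹ * a⁻¹ = (a * y * a⁻¹)⁻¹ := by group
    rcases hb with hb | hb <;> rcases ha with ha | ha <;> simp [hb, ha, e2]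
  | inv a _ ha =>
    set y := l ^ ∏ b ∈ hS.toFinset, n b
    rcases ha with ha | ha
    · left
      nth_rw 1 [← ha]; group
    · right
      have : y = (a * y * a⁻¹)⁻¹ := by rw [ha, inv_inv]
      nth_rw 1 [this]; group

end CommensurableSubgroup

section Dichotomy

variable {X : Type*} [MetricSpace X] {Γ : Subgroup (X ≃ᵢ X)} {r : ℝ → X} {δ : ℝ} {l : X ≃ᵢ X}

theorem dist_zpow_pow_apply (l : X ≃ᵢ X) (Q : ℤ) (n : ℕ) (y : X) :
    dist y (((l ^ Q) ^ n) y) = dist y ((l ^ (Q.natAbs * n)) y) := by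
  obtain ⟨m, rfl | rfl⟩ := Q.eq_nat_or_neg
  · rw [zpow_natCast, ← pow_mul, Int.natAbs_natCast]
  · rw [zpow_neg, inv_pow, dist_inv_apply, zpow_natCast, ← pow_mul, Int.natAbs_neg,
      Int.natAbs_natCast]

theorem IsConvexRay.natAbs_le_of_conj (hr : IsConvexRay Γ r) (hδ : IsDeltaHyperbolic X δ)
    (hδ0 : 0 < δ) (hl : l ∈ rayStab Γ r) (hβ : busemann r (l (r 0)) ≤ -(5 * δ)) (b : X ≃ᵢ X)
    {P Q : ℤ} (h : b * l ^ P * b⁻¹ = l ^ Q) : Q.natAbs ≤ P.natAbs := by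
  by_contra! hlt
  obtain ⟨m, hm⟩ := exists_add_of_le hlt.le
  have hm1 : (1 : ℝ) ≤ m := by exact_mod_cast (by omega : 1 ≤ m)
  obtain ⟨n, hn⟩ := exists_nat_gt
    ((2 * dist (r 0) (b (r 0)) + (dist (r 0) (l (r 0)) + 2 * δ)) / (3 * δ))
  rw [div_lt_iff₀ (by linarith)] at hn
  have h1 := dist_zpow_pow_apply l Q n (r 0)
  rw [← h, conj_pow] at h1
  have h2 := dist_mul_apply_le (b * (l ^ P) ^ n) b⁻¹ (r 0)
  have h3 := dist_mul_apply_le b ((l ^ P) ^ n) (r 0)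
  rw [dist_inv_apply] at h2
  rw [dist_zpow_pow_apply] at h3
  have h4 := hr.dist_pow_le hδ hδ0 hl hβ (P.natAbs * n)
  have h5 := hr.le_dist_pow (l := l) (Q.natAbs * n)
  have h6 := hr.busemann_pow_add_le hδ hl hβ (P.natAbs * n) (m * n)
  rw [← add_mul, ← hm] at h6
  have h7 : (n : ℝ) * (3 * δ) ≤ (m * n : ℕ) * (3 * δ) := by
    refine mul_le_mul_of_nonneg_right ?_ (by linarith)
    push_cast
    exact le_mul_of_one_le_left n.cast_nonneg hm1
  linarith

theorem IsConvexRay.isVirtuallyNilpotent_closure_of_busemann_le (hr : IsConvexRay Γ r)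
    (hδ : IsDeltaHyperbolic X δ) (hδ0 : 0 < δ) (hΓ : IsDiscreteSubgroup Γ)
    (hl : l ∈ rayStab Γ r) (hβ : busemann r (l (r 0)) ≤ -(5 * δ)) {g : X ≃ᵢ X}
    (hg : g ∈ rayStab Γ r) (hinf : ¬ IsOfFinOrder g) {S : Set (X ≃ᵢ X)} (hS : S.Finite)
    (hSΓ : S ⊆ Γ)
    (hSE : ∀ E : Set (X ≃ᵢ X), (∀ b ∈ rayStab Γ r, b ∈ E) →
      (∀ b ∈ Γ, ∀ i : ℕ, 1 ≤ i → b * g ^ i * b⁻¹ ∈ E → b ∈ E) → S ⊆ E) :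
    IsVirtuallyNilpotent (Subgroup.closure S) := by
  have hfin := fun k hk => hr.exists_finite_of_commute hδ hδ0 hΓ hl hβ (k := k) hk
  have habs : ∀ b ∈ Γ, ∀ P Q : ℤ, b * l ^ P * b⁻¹ = l ^ Q → Q.natAbs ≤ P.natAbs :=
    fun b _ P Q h => hr.natAbs_le_of_conj hδ hδ0 hl hβ b h
  obtain ⟨k, hk, hgk⟩ := hr.exists_commute_pow hδ hδ0 hΓ hl hβ hg
  have hE := hSE {b | ∃ N : ℕ, 1 ≤ N ∧
      (b * l ^ N * b⁻¹ = l ^ N ∨ b * l ^ N * b⁻¹ = (l ^ N)⁻¹)} (fun b hb => by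
    obtain ⟨k, hk, hbk⟩ := hr.exists_commute_pow hδ hδ0 hΓ hl hβ hb
    exact ⟨k, hk, Or.inl (mul_inv_eq_iff_eq_mul.2 hbk.eq)⟩) fun b hb i hi ⟨N, hN, h⟩ =>
    exists_conj_pow_eq_of_conj hfin habs hg.1 hinf hk hgk hb hi hN h
  obtain ⟨N, hN, h⟩ := exists_forall_closure_conj_pow_eq hS hE
  exact isVirtuallyNilpotent_of_conj_pow_eq hfin ((Subgroup.closure_le Γ).2 hSΓ) hN h

theorem IsConvexRay.exists_busemann_le (hr : IsConvexRay Γ r) (hδ : IsDeltaHyperbolic X δ)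
    (hδ0 : 0 < δ) {b : X ≃ᵢ X} (hb : b ∈ rayStab Γ r)
    (h : ∀ t, 0 ≤ t → 13 * δ < dist (r t) (b (r t))) :
    ∃ l ∈ rayStab Γ r, busemann r (l (r 0)) ≤ -(5 * δ) := by
  obtain ⟨t, ht1, ht⟩ := ((eventually_ge_atTop 0).and (hr.eventually_dist_le hδ hδ0 hb)).exists
  have h1 := h t ht1
  rcases abs_cases (busemann r (b (r 0))) with h2 | h2
  · refine ⟨b⁻¹, inv_mem hb, ?_⟩
    have h3 := hr.le_busemann_mul hδ hb (b⁻¹ (r 0))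
    rw [IsometryEquiv.apply_inv_self, hr.busemann_zero] at h3
    linarith
  · exact ⟨b, hb, by linarith⟩

theorem IsConvexRay.isVirtuallyNilpotent_closure (hr : IsConvexRay Γ r)
    (hδ : IsDeltaHyperbolic X δ) (hδ0 : 0 < δ) (hΓ : IsDiscreteSubgroup Γ) {r₀ : ℝ} (hr₀ : 0 < r₀)
    {p : ℕ} (hcov : ∀ ρ : ℝ, ∀ k : ℕ, ρ ≤ k * r₀ → CoverLE (closedBall (r 0) ρ) (2 * r₀) (p ^ k))
    {g : X ≃ᵢ X} (hg : g ∈ rayStab Γ r) (hinf : ¬ IsOfFinOrder g) {S : Set (X ≃ᵢ X)}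
    (hS : S.Finite) (hSΓ : S ⊆ Γ)
    (hSE : ∀ E : Set (X ≃ᵢ X), (∀ b ∈ rayStab Γ r, b ∈ E) →
      (∀ b ∈ Γ, ∀ i : ℕ, 1 ≤ i → b * g ^ i * b⁻¹ ∈ E → b ∈ E) → S ⊆ E) :
    IsVirtuallyNilpotent (Subgroup.closure S) := by
  by_cases hP : ∀ b ∈ rayStab Γ r, ∃ t, 0 ≤ t ∧ dist (r t) (b (r t)) ≤ 13 * δ
  · have hle : Subgroup.closure S ≤ rayStab Γ r :=
      (Subgroup.closure_le _).2 <| hSE (rayStab Γ r) (fun b hb => hb) fun b hb i hi h =>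
        hr.mem_rayStab_of_conj hδ hδ0.le hΓ hP hg hinf hb hi h
    have : Finite S := hS
    have : Group.FG (Subgroup.closure S) := Group.closure_finite_fg S
    exact hr.isVirtuallyNilpotent_of_le_rayStab hδ hδ0.le hΓ (by linarith) hP hr₀ hcov _ hle
  · push Not at hP
    obtain ⟨b, hb, h⟩ := hP
    obtain ⟨l, hl, hβ⟩ := hr.exists_busemann_le hδ hδ0 hb h
    exact hr.isVirtuallyNilpotent_closure_of_busemann_le hδ hδ0 hΓ hl hβ hg hinf hS hSΓ hSE

end Dichotomy

theorem pow_ceil_le_exp {r₀ s : ℝ} (hr₀ : 0 < r₀) (hs : 0 ≤ s) (p : ℕ) :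
    ((p ^ ⌈(s + 2) / r₀⌉₊ : ℕ) : ℝ) ≤ Real.exp (p * (2 / r₀ + 1)) * Real.exp (p / r₀ * s) := by
  have h1 : (⌈(s + 2) / r₀⌉₊ : ℝ) ≤ (s + 2) / r₀ + 1 := (Nat.ceil_lt_add_one (by positivity)).le
  have h2 : (p : ℝ) ≤ Real.exp p := by linarith [Real.add_one_le_exp (p : ℝ)]
  rw [← Real.exp_add]
  calc ((p ^ ⌈(s + 2) / r₀⌉₊ : ℕ) : ℝ) ≤ Real.exp p ^ ⌈(s + 2) / r₀⌉₊ := by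
        push_cast
        exact pow_le_pow_left₀ p.cast_nonneg h2 _
    _ = Real.exp (p * ⌈(s + 2) / r₀⌉₊) := by rw [← Real.exp_nat_mul, mul_comm]
    _ ≤ Real.exp (p * ((s + 2) / r₀ + 1)) :=
        Real.exp_le_exp.2 (mul_le_mul_of_nonneg_left h1 p.cast_nonneg)
    _ = _ := by congr 1; field_simp; ring

/-- **Corollary 6.2**: pointwise systolic estimate via the nilpotence radius. -/
theorem pointwise_systolic_estimate
    (P₀ r₀ : ℝ) (hP₀ : 0 < P₀) (hr₀ : 0 < r₀) :
    ∃ ε₀ : ℝ, 0 < ε₀ ∧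
      ∀ δ : ℝ, 0 < δ →
        ∃ H₀ : ℝ, 0 < H₀ ∧
          ∀ (X : Type*) [MetricSpace X] [CompleteSpace X] (σ : X → X → ℝ → X),
            IsGCB σ → IsDeltaHyperbolic X δ → IsPacked X P₀ r₀ →
            ∀ Γ : Subgroup (X ≃ᵢ X), (∀ g ∈ Γ, IsSigmaIsometry σ g) →
              IsDiscreteSubgroup Γ → IsNonElementary Γ →
              ∀ x : X,
                BddAbove {r : ℝ | 0 ≤ r ∧ IsVirtuallyNilpotent ↥(almostStabilizer Γ r x)} →
                ∀ g ∈ Γ, ¬ IsOfFinOrder g →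
                  min ε₀ ((1 / H₀) * Real.exp (-H₀ * nilrad Γ x)) ≤ dist x (g x) := by
  refine ⟨1, one_pos, fun δ hδ0 => ?_⟩
  set p := ⌊P₀⌋₊ with hp
  set n := p ^ ⌈(4 * r₀ + 2) / r₀⌉₊ with hn
  set A := Real.exp (p * (2 / r₀ + 1)) with hA
  have hA0 : 0 < A := Real.exp_pos _
  have hpr : 0 ≤ p / r₀ := by positivity
  have hnn : (0 : ℝ) ≤ (n * n : ℕ) := Nat.cast_nonneg _
  obtain ⟨H, hH1, hH2, hH3⟩ : ∃ H : ℝ, p / r₀ ≤ H ∧ A ≤ H ∧ (n * n : ℕ) ≤ H :=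
    ⟨p / r₀ + A + (n * n : ℕ), by linarith, by linarith, by linarith⟩
  have hH0 : 0 < H := hA0.trans_le hH2
  refine ⟨H, hH0, ?_⟩
  intro X _ _ σ hσ hδ hpack Γ hΓσ hΓ _ x hbdd g hg hinf
  by_contra! hlt
  rw [lt_min_iff] at hlt
  set s := nilrad Γ x with hs
  have hs0 : 0 ≤ s := Real.sSup_nonneg fun r hr => hr.1
  have hε0 : 0 ≤ dist x (g x) := dist_nonneg
  have hHε : H * Real.exp (H * s) * dist x (g x) ≤ 1 := by
    have h1 := hlt.2.le
    rw [neg_mul, Real.exp_neg, one_div, ← mul_inv, ← one_div, le_div_iff₀ (by positivity)] at h1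
    linarith
  have hexp : 1 ≤ Real.exp (H * s) := Real.one_le_exp (by positivity)
  have hmε : ((p ^ ⌈(s + 2) / r₀⌉₊ : ℕ) : ℝ) * dist x (g x) ≤ 1 := by
    refine (mul_le_mul_of_nonneg_right ((pow_ceil_le_exp hr₀ hs0 p).trans ?_) hε0).trans hHε
    exact mul_le_mul hH2 (Real.exp_le_exp.2 (mul_le_mul_of_nonneg_right hH1 hs0))
      (Real.exp_pos _).le hH0.le
  have hnε : ((n * n : ℕ) : ℝ) * dist x (g x) ≤ 1 :=
    (mul_le_mul_of_nonneg_right (hH3.trans (le_mul_of_one_le_right hH0.le hexp)) hε0).trans hHε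
  have hprop := hpack.properSpace hσ hr₀
  obtain ⟨r, hr, rfl, hgr⟩ := exists_isConvexRay hσ hΓσ hΓ hg hinf x
  have hcov : ∀ (y : X) (ρ : ℝ) (k : ℕ), ρ ≤ k * r₀ →
      CoverLE (closedBall y ρ) (2 * r₀) (p ^ k) :=
    fun y ρ k hk => hpack.coverLE_closedBall hσ hr₀ y hk
  have hceil : ∀ u : ℝ, u ≤ ⌈u / r₀⌉₊ * r₀ := fun u => by
    rw [← div_le_iff₀ hr₀]; exact Nat.le_ceil _
  have hvn : IsVirtuallyNilpotent (almostStabilizer Γ (s + 1) (r 0)) := by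
    refine hr.isVirtuallyNilpotent_closure hδ hδ0 hΓ hr₀ (hcov (r 0)) (g := g) ⟨hg, _, hgr⟩ hinf
      (hΓ (r 0) (s + 1)) (fun b hb => hb.1) fun E hE hconj b hb => ?_
    exact hr.mem_of_dist_le' hΓ hE hg hconj hgr (fun y => hcov y _ _ (hceil _)) hnε
      (hcov (r 0) (s + 1 + 1) _ (by rw [add_assoc, one_add_one_eq_two]; exact hceil _)) hmε
      hb.1 hb.2
  have hle := le_csSup hbdd ⟨by linarith, hvn⟩
  rw [hs, nilrad] at hle
  linarith
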